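/- Let n ≥ 3, let Ω ⊆ ℝⁿ be a bounded nonempty connected open set with smooth boundary, and let ε > 0. Then there exists a bounded nonempty connected open set Ω' ⊆ Ω with smooth boundary such that the frontier ∂Ω' is connected, vol(Ω) − vol(Ω') < ε, |H^{n−1}(∂Ω) − H^{n−1}(∂Ω')| < ε, and |σ₁(Ω) − σ₁(Ω')| < ε. -/

import Mathlib

open MeasureTheory

/-- The first nonzero Steklov eigenvalue of a domain `Ω ⊆ ℝⁿ`, defined variationally. -/
noncomputable def stekSigma1 {n : ℕ} (Ω : Set (EuclideanSpace ℝ (Fin n))) : ℝ :=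
  sInf { q : ℝ | ∃ f : EuclideanSpace ℝ (Fin n) → ℝ, ContDiff ℝ (⊤ : ℕ∞) f ∧
    (∫ x in frontier Ω, f x ∂(μH[(n : ℝ) - 1])) = 0 ∧
    (0 < ∫ x in frontier Ω, (f x) ^ 2 ∂(μH[(n : ℝ) - 1])) ∧
    q = (∫ x in Ω, ‖gradient f x‖ ^ 2) /
        (∫ x in frontier Ω, (f x) ^ 2 ∂(μH[(n : ℝ) - 1])) }

/-- `Ω` has smooth boundary: near each frontier point, `Ω` is the sublevel set `{g < 0}` of a
smooth function `g` with nonvanishing gradient, and the frontier is `{g = 0}`. -/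
def HasSmoothBoundary {n : ℕ} (Ω : Set (EuclideanSpace ℝ (Fin n))) : Prop :=
  ∀ x ∈ frontier Ω, ∃ U : Set (EuclideanSpace ℝ (Fin n)), IsOpen U ∧ x ∈ U ∧
    ∃ g : EuclideanSpace ℝ (Fin n) → ℝ, ContDiff ℝ (⊤ : ℕ∞) g ∧
      (∀ y ∈ U, gradient g y ≠ 0) ∧
      Ω ∩ U = {y | g y < 0} ∩ U ∧ frontier Ω ∩ U = {y | g y = 0} ∩ U

set_option linter.unusedSectionVars false

namespace Steklov
open Set Filter Topology Metric
open scoped ENNReal NNReal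

theorem lintegral_comp_le_of_antilipschitzOn {X Y : Type*} [EMetricSpace X] [MeasurableSpace X]
    [BorelSpace X] [EMetricSpace Y] [MeasurableSpace Y] [BorelSpace Y] {d : ℝ} (hd : 0 ≤ d)
    {B : Set X} (hB : MeasurableSet B) {P : X → Y} (hP : ContinuousOn P B) {C : ℝ≥0}
    (hC : ∀ x ∈ B, ∀ x' ∈ B, edist x x' ≤ C * edist (P x) (P x'))
    {H : Y → ℝ≥0∞} (hH : Measurable H) :
    ∫⁻ x in B, H (P x) ∂μH[d] ≤ (C : ℝ≥0∞) ^ d * ∫⁻ y, H y ∂μH[d] := by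
  have hPm : AEMeasurable P (μH[d].restrict B) := hP.aemeasurable hB
  rw [← lintegral_map' hH.aemeasurable hPm, ← smul_eq_mul, ← lintegral_smul_measure]
  refine lintegral_mono' (Measure.le_iff.2 fun A hA => ?_) le_rfl
  rw [Measure.map_apply_of_aemeasurable hPm hA, Measure.smul_apply, smul_eq_mul]
  have hsub : (μH[d].restrict B) (P ⁻¹' A) = μH[d] (P ⁻¹' A ∩ B) := Measure.restrict_apply' hB
  rw [hsub]
  set S := P ⁻¹' A ∩ B with hS
  rcases S.eq_empty_or_nonempty with h0 | ⟨x₀, hx₀⟩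
  · simp [h0]
  have : Nonempty X := ⟨x₀⟩
  have hinj : InjOn P S := by
    intro x hx x' hx' h
    have := hC x hx.2 x' hx'.2
    rw [h, edist_self, mul_zero] at this
    exact edist_le_zero.1 this
  have hL : LipschitzOnWith C (Function.invFunOn P S) (P '' S) := by
    rintro _ ⟨x, hx, rfl⟩ _ ⟨x', hx', rfl⟩
    rw [hinj.leftInvOn_invFunOn hx, hinj.leftInvOn_invFunOn hx']
    exact hC x hx.2 x' hx'.2
  have h1 := hL.hausdorffMeasure_image_le hd
  rw [hinj.leftInvOn_invFunOn.image_image] at h1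
  refine h1.trans (mul_le_mul_right ?_ _)
  exact measure_mono (by rintro _ ⟨x, hx, rfl⟩; exact hx.1)

theorem sq_intervalIntegral_le {v : ℝ → ℝ} {a b : ℝ} (hab : a ≤ b) (hv : ContinuousOn v (Icc a b)) :
    (∫ s in a..b, v s) ^ 2 ≤ (b - a) * ∫ s in a..b, v s ^ 2 := by
  rcases hab.eq_or_lt with rfl | hlt
  · simp
  have hi : IntervalIntegrable v volume a b :=
    ContinuousOn.intervalIntegrable (by rwa [uIcc_of_le hab])
  have hi2 : IntervalIntegrable (fun s => v s ^ 2) volume a b :=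
    ContinuousOn.intervalIntegrable (by rw [uIcc_of_le hab]; exact hv.pow 2)
  set I := ∫ s in a..b, v s
  have hb : 0 < b - a := sub_pos.2 hlt
  have key : 0 ≤ ∫ s in a..b, (v s ^ 2 - (2 * (I / (b - a))) * v s + (I / (b - a)) ^ 2) :=
    intervalIntegral.integral_nonneg hab fun s _ => by nlinarith [sq_nonneg (v s - I / (b - a))]
  rw [intervalIntegral.integral_add (hi2.sub (hi.const_mul _)) intervalIntegrable_const,
    intervalIntegral.integral_sub hi2 (hi.const_mul _), intervalIntegral.integral_const_mul,
    intervalIntegral.integral_const, smul_eq_mul] at key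
  have e : (b - a) * (I / (b - a)) = I := by field_simp
  have := mul_nonneg hb.le key
  have e2 : (b - a) * (∫ s in a..b, v s ^ 2) - I ^ 2 =
    (b - a) * (((∫ s in a..b, v s ^ 2) - 2 * (I / (b - a)) * I + (b - a) * (I / (b - a)) ^ 2)) := by
    field_simp; ring
  linarith

theorem sq_le_of_hasDerivAt {u u' : ℝ → ℝ} {a b : ℝ}
    (hu : ∀ s ∈ Icc a b, HasDerivAt u (u' s) s) (hu' : ContinuousOn u' (Icc a b))
    {x y : ℝ} (hx : x ∈ Icc a b) (hy : y ∈ Icc a b) :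
    ENNReal.ofReal (u x ^ 2) ≤ 2 * ENNReal.ofReal (u y ^ 2) +
      2 * ENNReal.ofReal (b - a) * ∫⁻ s in Icc a b, ENNReal.ofReal (u' s ^ 2) := by
  wlog hxy : x ≤ y generalizing u u' a b x y
  · have hmem : ∀ s ∈ Icc (-b) (-a), -s ∈ Icc a b := fun s hs => ⟨by linarith [hs.2], by linarith [hs.1]⟩
    have hmp : MapsTo (fun s : ℝ => -s) (Icc (-b) (-a)) (Icc a b) := hmem
    have := this (u := fun s => u (-s)) (u' := fun s => - u' (-s)) (a := -b) (b := -a)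
      (fun s hs => by
        have h := (hu (-s) (hmem s hs)).comp s (hasDerivAt_neg s)
        rw [mul_neg_one] at h
        exact h)
      ((hu'.comp continuous_neg.continuousOn hmp).neg)
      (x := -x) (y := -y) ⟨by linarith [hx.2], by linarith [hx.1]⟩
      ⟨by linarith [hy.2], by linarith [hy.1]⟩ (by linarith)
    simp only [neg_neg, neg_sq] at this
    rw [show -a - -b = b - a by ring] at this
    refine this.trans_eq ?_
    congr 2
    have e : (∫⁻ s in Icc (-b) (-a), ENNReal.ofReal (u' (-s) ^ 2)) =
        ∫⁻ s, (Icc a b).indicator (fun s => ENNReal.ofReal (u' s ^ 2)) (-s) := by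
      rw [← lintegral_indicator measurableSet_Icc]
      refine lintegral_congr fun s => ?_
      by_cases hs : s ∈ Icc (-b) (-a)
      · rw [indicator_of_mem hs, indicator_of_mem (hmem s hs)]
      · rw [indicator_of_notMem hs, indicator_of_notMem]
        exact fun h => hs ⟨by linarith [h.2], by linarith [h.1]⟩
    rw [e, lintegral_neg_eq_self (μ := volume)
      (fun s => (Icc a b).indicator (fun s => ENNReal.ofReal (u' s ^ 2)) s),
      lintegral_indicator measurableSet_Icc]
  have hsub : Icc x y ⊆ Icc a b := Icc_subset_Icc hx.1 hy.2
  have h_int : ∫ s in x..y, u' s = u y - u x :=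
    intervalIntegral.integral_eq_sub_of_hasDerivAt
      (fun s hs => hu s (hsub (by rwa [uIcc_of_le hxy] at hs)))
      (ContinuousOn.intervalIntegrable (by rw [uIcc_of_le hxy]; exact hu'.mono hsub))
  have hcs := sq_intervalIntegral_le hxy (hu'.mono hsub)
  rw [h_int] at hcs
  have hi2 : IntegrableOn (fun s => u' s ^ 2) (Icc x y) :=
    ((hu'.mono hsub).pow 2).integrableOn_Icc
  have hmain : u x ^ 2 ≤ 2 * u y ^ 2 + 2 * (b - a) * ∫ s in Icc x y, u' s ^ 2 := by
    rw [intervalIntegral.integral_of_le hxy, ← integral_Icc_eq_integral_Ioc] at hcs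
    have h0 : 0 ≤ ∫ s in Icc x y, u' s ^ 2 := integral_nonneg fun _ => sq_nonneg _
    have : (y - x) * (∫ s in Icc x y, u' s ^ 2) ≤ (b - a) * ∫ s in Icc x y, u' s ^ 2 :=
      mul_le_mul_of_nonneg_right (by linarith [hx.1, hy.2]) h0
    nlinarith [sq_nonneg (u x - 2 * u y)]
  have hba : 0 ≤ b - a := by linarith [hx.1, hy.2]
  calc ENNReal.ofReal (u x ^ 2)
      ≤ ENNReal.ofReal (2 * u y ^ 2 + 2 * (b - a) * ∫ s in Icc x y, u' s ^ 2) :=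
        ENNReal.ofReal_le_ofReal hmain
    _ = 2 * ENNReal.ofReal (u y ^ 2) + 2 * ENNReal.ofReal (b - a) *
          ∫⁻ s in Icc x y, ENNReal.ofReal (u' s ^ 2) := by
        rw [ENNReal.ofReal_add (by positivity)
          (mul_nonneg (by positivity) (integral_nonneg fun _ => sq_nonneg _)),
          ENNReal.ofReal_mul (by norm_num), ENNReal.ofReal_mul (by positivity),
          ENNReal.ofReal_mul (by norm_num),
          ofReal_integral_eq_lintegral_ofReal hi2 (Eventually.of_forall fun _ => sq_nonneg _)]
        simp
    _ ≤ _ := by gcongr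

/-- The half-open spherical shell `a ≤ ‖y‖ < b`. -/
def shell (F : Type*) [NormedAddCommGroup F] (a b : ℝ) : Set F := {y | a ≤ ‖y‖ ∧ ‖y‖ < b}

section Shell
variable {F : Type*} [NormedAddCommGroup F] [NormedSpace ℝ F] [FiniteDimensional ℝ F]
  [MeasurableSpace F] [BorelSpace F] (μ : Measure F) [μ.IsAddHaarMeasure]

theorem measurableSet_shell (F : Type*) [NormedAddCommGroup F] [MeasurableSpace F] [BorelSpace F]
    (a b : ℝ) : MeasurableSet (shell F a b) :=
  (measurableSet_le measurable_const measurable_norm).inter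
    (measurableSet_lt measurable_norm measurable_const)

theorem lintegral_comp_smul {g : F → ℝ≥0∞} (hg : Measurable g) {r : ℝ} (hr : r ≠ 0) :
    ∫⁻ y, g (r • y) ∂μ =
      ENNReal.ofReal |(r ^ Module.finrank ℝ F)⁻¹| * ∫⁻ y, g y ∂μ := by
  rw [← smul_eq_mul, ← lintegral_smul_measure, ← Measure.map_addHaar_smul μ hr,
    lintegral_map hg (measurable_const_smul r)]

theorem volume_log_window_le {r x : ℝ} (hr : 0 < r) (Λ : ℝ) (hx : 0 < x) :
    ∫⁻ σ in Icc 0 Λ, (if r ≤ Real.exp (-σ) * x ∧ Real.exp (-σ) * x < 2 * r then 1 else 0 : ℝ≥0∞) ≤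
      ENNReal.ofReal (Real.log 2) := by
  have h1 : ∀ σ, (if r ≤ Real.exp (-σ) * x ∧ Real.exp (-σ) * x < 2 * r then 1 else 0 : ℝ≥0∞) ≤
      (Icc (Real.log (x / (2 * r))) (Real.log (x / r))).indicator 1 σ := by
    intro σ
    split_ifs with h
    · rw [indicator_of_mem]
      · rfl
      · have he : 0 < Real.exp σ := Real.exp_pos σ
        rw [Real.exp_neg] at h
        constructor
        · rw [Real.log_le_iff_le_exp (by positivity), div_le_iff₀ (by positivity)]
          have := h.2
          rw [inv_mul_lt_iff₀ he] at this
          linarith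
        · rw [Real.le_log_iff_exp_le (by positivity), le_div_iff₀ hr]
          have := h.1
          rw [le_inv_mul_iff₀ he] at this
          linarith
    · exact zero_le
  calc _ ≤ ∫⁻ σ, (if r ≤ Real.exp (-σ) * x ∧ Real.exp (-σ) * x < 2 * r then 1 else 0 : ℝ≥0∞) :=
        setLIntegral_le_lintegral _ _
    _ ≤ ∫⁻ σ, (Icc (Real.log (x / (2 * r))) (Real.log (x / r))).indicator 1 σ := lintegral_mono h1
    _ = _ := by
      rw [lintegral_indicator_one measurableSet_Icc, Real.volume_Icc,
        Real.log_div hx.ne' hr.ne', Real.log_div hx.ne' (by positivity),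
        Real.log_mul two_ne_zero hr.ne']
      congr 1; ring

theorem lintegral_shell_le (hF : 2 ≤ Module.finrank ℝ F) {U G : F → ℝ≥0∞} (hU : Measurable U)
    (hG : Measurable G) {r R Λ : ℝ} (hr : 0 < r) (hΛ : 0 ≤ Λ) (hR : 2 * r * Real.exp Λ = R)
    (hUG : ∀ y ∈ shell F r (2 * r), U y ≤ 2 * U (Real.exp Λ • y) + 2 * ENNReal.ofReal Λ *
      ∫⁻ σ in Icc 0 Λ, ENNReal.ofReal (‖Real.exp σ • y‖ ^ 2) * G (Real.exp σ • y)) :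
    ∫⁻ y in shell F r (2 * r), U y ∂μ ≤
      2 * ENNReal.ofReal ((2 * r / R) ^ 2) * ∫⁻ y in shell F r R, U y ∂μ +
      ENNReal.ofReal (8 * r ^ 2 * Λ) * ∫⁻ y in shell F r R, G y ∂μ := by
  set d := Module.finrank ℝ F
  have hA := measurableSet_shell F r (2 * r)
  have hAR := measurableSet_shell F r R
  have hRpos : 0 < R := by rw [← hR]; positivity
  have hscale : ∀ σ, 0 ≤ σ → ENNReal.ofReal |(Real.exp σ ^ d)⁻¹| ≤
      ENNReal.ofReal (Real.exp (-σ) ^ 2) := by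
    intro σ hσ
    apply ENNReal.ofReal_le_ofReal
    rw [abs_of_pos (by positivity), Real.exp_neg, inv_pow]
    exact inv_anti₀ (by positivity) (pow_le_pow_right₀ (Real.one_le_exp hσ) hF)
  have hmem : ∀ σ ∈ Icc 0 Λ, ∀ y ∈ shell F r (2 * r), Real.exp σ • y ∈ shell F r R := by
    intro σ hσ y hy
    have h1 := Real.one_le_exp hσ.1
    have h2 := Real.exp_le_exp.2 hσ.2
    have hn : ‖Real.exp σ • y‖ = Real.exp σ * ‖y‖ := by
      rw [norm_smul, Real.norm_eq_abs, abs_of_pos (Real.exp_pos σ)]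
    refine ⟨?_, ?_⟩
    · rw [hn]; nlinarith [hy.1]
    · rw [hn, ← hR]
      calc Real.exp σ * ‖y‖ < Real.exp σ * (2 * r) := by
            have := hy.2; gcongr
        _ ≤ Real.exp Λ * (2 * r) := by gcongr
        _ = _ := by ring
  have t1 : ∫⁻ y in shell F r (2 * r), U (Real.exp Λ • y) ∂μ ≤
      ENNReal.ofReal ((2 * r / R) ^ 2) * ∫⁻ y in shell F r R, U y ∂μ := by
    calc ∫⁻ y in shell F r (2 * r), U (Real.exp Λ • y) ∂μ
        ≤ ∫⁻ y, (shell F r R).indicator U (Real.exp Λ • y) ∂μ := by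
          rw [← lintegral_indicator hA]
          refine lintegral_mono fun y => ?_
          by_cases hy : y ∈ shell F r (2 * r)
          · rw [indicator_of_mem hy, indicator_of_mem (hmem Λ ⟨hΛ, le_rfl⟩ y hy)]
          · rw [indicator_of_notMem hy]; exact zero_le
      _ = ENNReal.ofReal |(Real.exp Λ ^ d)⁻¹| * ∫⁻ y in shell F r R, U y ∂μ := by
          rw [lintegral_comp_smul μ (hU.indicator hAR) (Real.exp_pos Λ).ne',
            lintegral_indicator hAR]
      _ ≤ _ := by
          refine mul_le_mul_left ((hscale Λ hΛ).trans_eq ?_) _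
          congr 2
          rw [Real.exp_neg, ← hR]; field_simp
  have t2 : ∫⁻ y in shell F r (2 * r), (∫⁻ σ in Icc 0 Λ,
      ENNReal.ofReal (‖Real.exp σ • y‖ ^ 2) * G (Real.exp σ • y)) ∂μ ≤
      ENNReal.ofReal (4 * r ^ 2) * ∫⁻ y in shell F r R, G y ∂μ := by
    have hmeas : Measurable (fun p : F × ℝ => Real.exp p.2 • p.1) := by fun_prop
    rw [lintegral_lintegral_swap (by
      have : Measurable (fun p : F × ℝ =>
          ENNReal.ofReal (‖Real.exp p.2 • p.1‖ ^ 2) * G (Real.exp p.2 • p.1)) :=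
        (ENNReal.measurable_ofReal.comp (hmeas.norm.pow_const 2)).mul (hG.comp hmeas)
      exact this.aemeasurable)]
    let w : F → ℝ → ℝ≥0∞ := fun z σ =>
      if r ≤ Real.exp (-σ) * ‖z‖ ∧ Real.exp (-σ) * ‖z‖ < 2 * r then 1 else 0
    have hw : Measurable (fun p : ℝ × F => w p.2 p.1) := by
      refine Measurable.ite ?_ measurable_const measurable_const
      have hc : Measurable (fun p : ℝ × F => Real.exp (-p.1) * ‖p.2‖) := by fun_prop
      exact (measurableSet_le measurable_const hc).inter (measurableSet_lt hc measurable_const)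
    have hstep : ∀ σ ∈ Icc 0 Λ, ∫⁻ y in shell F r (2 * r),
        ENNReal.ofReal (‖Real.exp σ • y‖ ^ 2) * G (Real.exp σ • y) ∂μ ≤
        ∫⁻ z in shell F r R, w z σ * (ENNReal.ofReal (4 * r ^ 2) * G z) ∂μ := by
      intro σ hσ
      have hwσ : Measurable (fun z => w z σ) := hw.comp (measurable_prodMk_left (x := σ))
      set k : F → ℝ≥0∞ := (shell F r R).indicator
        (fun z => w z σ * (ENNReal.ofReal (‖z‖ ^ 2) * G z)) with hk
      have hkm : Measurable k :=
        (hwσ.mul ((ENNReal.measurable_ofReal.comp (measurable_norm.pow_const 2)).mul hG)).indicator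
          hAR
      calc _ ≤ ∫⁻ y, k (Real.exp σ • y) ∂μ := by
            rw [← lintegral_indicator hA]
            refine lintegral_mono fun y => ?_
            by_cases hy : y ∈ shell F r (2 * r)
            · rw [indicator_of_mem hy, hk, indicator_of_mem (hmem σ hσ y hy)]
              have : w (Real.exp σ • y) σ = 1 := by
                have hn : Real.exp (-σ) * ‖Real.exp σ • y‖ = ‖y‖ := by
                  rw [norm_smul, Real.norm_eq_abs, abs_of_pos (Real.exp_pos σ), ← mul_assoc,
                    ← Real.exp_add]; simp
                simp only [w]
                rw [hn]; exact if_pos hy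
              rw [this, one_mul]
            · rw [indicator_of_notMem hy]; exact zero_le
        _ = ENNReal.ofReal |(Real.exp σ ^ d)⁻¹| * ∫⁻ y, k y ∂μ :=
            lintegral_comp_smul μ hkm (Real.exp_pos σ).ne'
        _ ≤ ENNReal.ofReal (Real.exp (-σ) ^ 2) * ∫⁻ y, k y ∂μ :=
            mul_le_mul_left (hscale σ hσ.1) _
        _ ≤ _ := by
            rw [← lintegral_const_mul _ hkm, ← lintegral_indicator hAR]
            refine lintegral_mono fun z => ?_
            by_cases hz : z ∈ shell F r R
            · rw [hk, indicator_of_mem hz, indicator_of_mem hz]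
              simp only [w]
              split_ifs with h
              · rw [one_mul, one_mul, ← mul_assoc, ← ENNReal.ofReal_mul (by positivity)]
                refine mul_le_mul_left (ENNReal.ofReal_le_ofReal ?_) _
                have : 0 ≤ Real.exp (-σ) * ‖z‖ := by positivity
                nlinarith [h.2]
              · simp
            · rw [hk, indicator_of_notMem hz, indicator_of_notMem hz, mul_zero]
    refine (setLIntegral_mono' measurableSet_Icc hstep).trans ?_
    rw [lintegral_lintegral_swap (by
      have : Measurable (fun p : ℝ × F => w p.2 p.1 * (ENNReal.ofReal (4 * r ^ 2) * G p.2)) :=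
        hw.mul ((hG.comp measurable_snd).const_mul _)
      exact this.aemeasurable), ← lintegral_const_mul _ hG]
    refine setLIntegral_mono' hAR fun z hz => ?_
    have hwz : Measurable (fun σ => w z σ) := hw.comp (measurable_prodMk_right (y := z))
    rw [lintegral_mul_const _ hwz]
    have hz0 : 0 < ‖z‖ := hr.trans_le hz.1
    calc _ ≤ ENNReal.ofReal (Real.log 2) * (ENNReal.ofReal (4 * r ^ 2) * G z) :=
          mul_le_mul_left (volume_log_window_le hr Λ hz0) _
      _ ≤ 1 * (ENNReal.ofReal (4 * r ^ 2) * G z) := by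
          gcongr
          rw [ENNReal.ofReal_le_one]
          linarith [Real.log_two_lt_d9]
      _ = _ := one_mul _
  have hmeasσ : Measurable (fun y : F => ∫⁻ σ in Icc 0 Λ,
      ENNReal.ofReal (‖Real.exp σ • y‖ ^ 2) * G (Real.exp σ • y)) := by
    have hmeas : Measurable (fun p : F × ℝ => Real.exp p.2 • p.1) := by fun_prop
    exact Measurable.lintegral_prod_right'
      (f := fun p : F × ℝ => ENNReal.ofReal (‖Real.exp p.2 • p.1‖ ^ 2) * G (Real.exp p.2 • p.1))
      ((ENNReal.measurable_ofReal.comp (hmeas.norm.pow_const 2)).mul (hG.comp hmeas))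
  calc ∫⁻ y in shell F r (2 * r), U y ∂μ
      ≤ ∫⁻ y in shell F r (2 * r), (2 * U (Real.exp Λ • y) + 2 * ENNReal.ofReal Λ *
      ∫⁻ σ in Icc 0 Λ, ENNReal.ofReal (‖Real.exp σ • y‖ ^ 2) * G (Real.exp σ • y)) ∂μ :=
        setLIntegral_mono' hA hUG
    _ = 2 * (∫⁻ y in shell F r (2 * r), U (Real.exp Λ • y) ∂μ) + 2 * ENNReal.ofReal Λ *
        ∫⁻ y in shell F r (2 * r), (∫⁻ σ in Icc 0 Λ,
          ENNReal.ofReal (‖Real.exp σ • y‖ ^ 2) * G (Real.exp σ • y)) ∂μ := by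
        have hUm : Measurable (fun y : F => U (Real.exp Λ • y)) :=
          hU.comp (measurable_const_smul _)
        rw [lintegral_add_right _ (hmeasσ.const_mul _), lintegral_const_mul _ hmeasσ,
          lintegral_const_mul _ hUm]
    _ ≤ 2 * (ENNReal.ofReal ((2 * r / R) ^ 2) * ∫⁻ y in shell F r R, U y ∂μ) +
        2 * ENNReal.ofReal Λ * (ENNReal.ofReal (4 * r ^ 2) * ∫⁻ y in shell F r R, G y ∂μ) := by
        gcongr
    _ = _ := by
        rw [← mul_assoc, ← mul_assoc]
        congr 2
        rw [show (2 : ℝ≥0∞) = ENNReal.ofReal 2 by simp, ← ENNReal.ofReal_mul (by norm_num),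
          ← ENNReal.ofReal_mul (by positivity)]
        congr 1; ring
end Shell

theorem hasDerivAt_expNegInvGlue (x : ℝ) :
    HasDerivAt expNegInvGlue (x⁻¹ ^ 2 * expNegInvGlue x) x := by
  have := expNegInvGlue.hasDerivAt_polynomial_eval_inv_mul 1 x
  simpa using this

theorem expNegInvGlue_lt {x y : ℝ} (hy : 0 < y) (h : x < y) :
    expNegInvGlue x < expNegInvGlue y := by
  rcases le_or_gt x 0 with hx | hx
  · rw [expNegInvGlue.zero_of_nonpos hx]; exact expNegInvGlue.pos_of_pos hy
  · rw [expNegInvGlue, expNegInvGlue, if_neg hx.not_ge, if_neg hy.not_ge, Real.exp_lt_exp]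
    exact neg_lt_neg (inv_strictAnti₀ hx h)

/-- A defining function for the solid cylinder `(0,1) × F` with a neighbourhood of the axis,
rounded off at both ends, removed. -/
noncomputable def tubeFun {F : Type*} [Norm F] (δ : ℝ) (x : ℝ × F) : ℝ :=
  expNegInvGlue (1 - ‖x.2‖ ^ 2 / δ ^ 2) + expNegInvGlue (1 / 2 - 2 * x.1) +
    expNegInvGlue (2 * x.1 - 3 / 2) - expNegInvGlue (1 / 2)

section TubeFun
variable {F : Type*} [NormedAddCommGroup F] {δ : ℝ}

theorem tubeFun_reflect (δ : ℝ) (x : ℝ × F) : tubeFun δ (1 - x.1, x.2) = tubeFun δ x := by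
  simp only [tubeFun]
  rw [show (1:ℝ) / 2 - 2 * (1 - x.1) = 2 * x.1 - 3 / 2 by ring,
    show 2 * (1 - x.1) - 3 / 2 = 1 / 2 - 2 * x.1 by ring]
  ring

theorem tubeFun_antitone_norm (δ : ℝ) {τ : ℝ} {y y' : F} (h : ‖y‖ ≤ ‖y'‖) :
    tubeFun δ (τ, y') ≤ tubeFun δ (τ, y) := by
  have : expNegInvGlue (1 - ‖y'‖ ^ 2 / δ ^ 2) ≤ expNegInvGlue (1 - ‖y‖ ^ 2 / δ ^ 2) := by
    apply expNegInvGlue.monotone; gcongr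
  simp only [tubeFun]; linarith

theorem glue_half_pos : 0 < expNegInvGlue (1 / 2) := expNegInvGlue.pos_of_pos (by norm_num)

theorem glue_left_le {τ : ℝ} {y : F} (h : tubeFun δ (τ, y) ≤ 0) :
    expNegInvGlue (1 / 2 - 2 * τ) ≤ expNegInvGlue (1 / 2) := by
  simp only [tubeFun] at h
  linarith [expNegInvGlue.nonneg (1 - ‖y‖ ^ 2 / δ ^ 2), expNegInvGlue.nonneg (2 * τ - 3 / 2)]

theorem nonneg_of_tubeFun_nonpos {τ : ℝ} {y : F} (h : tubeFun δ (τ, y) ≤ 0) : 0 ≤ τ := by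
  by_contra! hτ
  have := expNegInvGlue_lt (x := 1 / 2) (y := 1 / 2 - 2 * τ) (by linarith) (by linarith)
  exact (glue_left_le h).not_gt this

theorem le_one_of_tubeFun_nonpos {τ : ℝ} {y : F} (h : tubeFun δ (τ, y) ≤ 0) : τ ≤ 1 := by
  rw [← tubeFun_reflect] at h
  linarith [nonneg_of_tubeFun_nonpos h]

theorem pos_of_tubeFun_neg {τ : ℝ} {y : F} (h : tubeFun δ (τ, y) < 0) : 0 < τ := by
  refine (nonneg_of_tubeFun_nonpos h.le).lt_of_ne ?_
  rintro rfl
  simp only [tubeFun] at h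
  norm_num at h
  linarith [expNegInvGlue.nonneg (1 - ‖y‖ ^ 2 / δ ^ 2), expNegInvGlue.nonneg (-3 / 2)]

theorem lt_one_of_tubeFun_neg {τ : ℝ} {y : F} (h : tubeFun δ (τ, y) < 0) : τ < 1 := by
  rw [← tubeFun_reflect] at h
  linarith [pos_of_tubeFun_neg h]

theorem glue_norm_of_le (hδ : 0 < δ) {y : F} (hy : δ ≤ ‖y‖) :
    expNegInvGlue (1 - ‖y‖ ^ 2 / δ ^ 2) = 0 := by
  apply expNegInvGlue.zero_of_nonpos
  rw [sub_nonpos, one_le_div (by positivity)]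
  gcongr

theorem tubeFun_neg_of_le (hδ : 0 < δ) {τ : ℝ} {y : F} (hy : δ ≤ ‖y‖) (h0 : 0 < τ) (h1 : τ < 1) :
    tubeFun δ (τ, y) < 0 := by
  simp only [tubeFun, glue_norm_of_le hδ hy, zero_add]
  rcases le_total τ (1 / 2) with h | h
  · rw [expNegInvGlue.zero_of_nonpos (x := 2 * τ - 3 / 2) (by linarith)]
    linarith [expNegInvGlue_lt (x := 1 / 2 - 2 * τ) (y := 1 / 2) (by norm_num) (by linarith)]
  · rw [expNegInvGlue.zero_of_nonpos (x := 1 / 2 - 2 * τ) (by linarith)]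
    linarith [expNegInvGlue_lt (x := 2 * τ - 3 / 2) (y := 1 / 2) (by norm_num) (by linarith)]

theorem tubeFun_eq_zero_of_le (hδ : 0 < δ) {τ : ℝ} {y : F} (hy : δ ≤ ‖y‖) (h : τ = 0 ∨ τ = 1) :
    tubeFun δ (τ, y) = 0 := by
  simp only [tubeFun, glue_norm_of_le hδ hy, zero_add]
  rcases h with rfl | rfl <;> norm_num

theorem tubeFun_eq_zero_iff_of_le (hδ : 0 < δ) {τ : ℝ} {y : F} (hy : δ ≤ ‖y‖) :
    tubeFun δ (τ, y) = 0 ↔ τ = 0 ∨ τ = 1 := by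
  refine ⟨fun h => ?_, tubeFun_eq_zero_of_le hδ hy⟩
  by_contra! hc
  have h0 := nonneg_of_tubeFun_nonpos h.le
  have h1 := le_one_of_tubeFun_nonpos h.le
  exact (tubeFun_neg_of_le hδ hy (h0.lt_of_ne' hc.1) (h1.lt_of_ne hc.2)).ne h

theorem sq_norm_ge_of_tubeFun_nonpos (hδ : 0 < δ) {τ : ℝ} {y : F} (h : tubeFun δ (τ, y) ≤ 0) :
    δ ^ 2 / 2 ≤ ‖y‖ ^ 2 := by
  by_contra! hc
  have : expNegInvGlue (1 / 2) < expNegInvGlue (1 - ‖y‖ ^ 2 / δ ^ 2) := by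
    have : ‖y‖ ^ 2 / δ ^ 2 < 1 / 2 := by
      rw [div_lt_iff₀ (by positivity)]; linarith
    exact expNegInvGlue_lt (by linarith) (by linarith)
  simp only [tubeFun] at h
  linarith [expNegInvGlue.nonneg (1 / 2 - 2 * τ), expNegInvGlue.nonneg (2 * τ - 3 / 2)]

theorem half_le_norm_of_tubeFun_nonpos (hδ : 0 < δ) {τ : ℝ} {y : F} (h : tubeFun δ (τ, y) ≤ 0) :
    δ / 2 ≤ ‖y‖ := by
  have := sq_norm_ge_of_tubeFun_nonpos hδ h
  by_contra! hc
  nlinarith [norm_nonneg y]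

theorem tubeFun_lower (δ : ℝ) {τ : ℝ} (y : F) (hτ : τ ≤ 3 / 4) : tubeFun δ (τ, y) =
    expNegInvGlue (1 - ‖y‖ ^ 2 / δ ^ 2) + expNegInvGlue (1 / 2 - 2 * τ) - expNegInvGlue (1 / 2) := by
  simp only [tubeFun]
  rw [expNegInvGlue.zero_of_nonpos (x := 2 * τ - 3 / 2) (by linarith)]
  ring

/-- On the lower half of the wall, the radius is a decreasing function of the height. -/
theorem norm_le_of_tubeFun_eq_zero (hδ : 0 < δ) {τ τ' : ℝ} {y y' : F} (h : tubeFun δ (τ, y) = 0)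
    (h' : tubeFun δ (τ', y') = 0) (hτ : τ < τ') (hτ' : τ' ≤ 1 / 2) : ‖y'‖ ≤ ‖y‖ := by
  have h0 := nonneg_of_tubeFun_nonpos h.le
  rw [tubeFun_lower δ y (by linarith)] at h
  rw [tubeFun_lower δ y' (by linarith)] at h'
  by_contra! hc
  have hc2 : 1 - ‖y'‖ ^ 2 / δ ^ 2 < 1 - ‖y‖ ^ 2 / δ ^ 2 := by gcongr
  have hm := expNegInvGlue.monotone (show 1 / 2 - 2 * τ' ≤ 1 / 2 - 2 * τ by linarith)
  have hlt : expNegInvGlue (1 / 2 - 2 * τ') < expNegInvGlue (1 / 2) := by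
    apply expNegInvGlue_lt <;> linarith
  have hpos : 0 < 1 - ‖y'‖ ^ 2 / δ ^ 2 := by
    by_contra! h3
    rw [expNegInvGlue.zero_of_nonpos h3] at h'
    linarith
  have := expNegInvGlue_lt (hpos.trans hc2) hc2
  linarith

/-- Moving up and outward from the lower half of the wall leads into the domain. -/
theorem tubeFun_neg_of_ray (hδ : 0 < δ) {τ s : ℝ} {y y' : F} (h : tubeFun δ (τ, y) = 0)
    (hs : 0 < s) (hτ : τ + s ≤ 3 / 4) (hy : ‖y‖ < ‖y'‖) : tubeFun δ (τ + s, y') < 0 := by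
  have h0 := nonneg_of_tubeFun_nonpos h.le
  rw [tubeFun_lower δ y (by linarith)] at h
  rw [tubeFun_lower δ y' hτ]
  have hc2 : 1 - ‖y'‖ ^ 2 / δ ^ 2 < 1 - ‖y‖ ^ 2 / δ ^ 2 := by gcongr
  have hm := expNegInvGlue.monotone (show 1 / 2 - 2 * (τ + s) ≤ 1 / 2 - 2 * τ by linarith)
  have hm2 := expNegInvGlue.monotone hc2.le
  rcases le_or_gt (1 - ‖y‖ ^ 2 / δ ^ 2) 0 with h3 | h3
  · rw [expNegInvGlue.zero_of_nonpos h3] at h hm2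
    have : expNegInvGlue (1 / 2 - 2 * (τ + s)) < expNegInvGlue (1 / 2) := by
      apply expNegInvGlue_lt <;> linarith
    linarith [expNegInvGlue.nonneg (1 - ‖y'‖ ^ 2 / δ ^ 2)]
  · have := expNegInvGlue_lt h3 hc2
    linarith

end TubeFun

section TubeFunSmooth
variable {F : Type*} [NormedAddCommGroup F] [InnerProductSpace ℝ F] {δ : ℝ}

theorem contDiff_tubeFun (δ : ℝ) : ContDiff ℝ (⊤ : ℕ∞) (tubeFun (F := F) δ) := by
  have h := expNegInvGlue.contDiff (n := ⊤)
  have hn : ContDiff ℝ (⊤ : ℕ∞) (fun x : ℝ × F => ‖x.2‖ ^ 2) := contDiff_snd.norm_sq ℝ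
  unfold tubeFun
  refine ContDiff.sub (ContDiff.add (ContDiff.add ?_ ?_) ?_) contDiff_const
  · exact h.comp (contDiff_const.sub (hn.div_const _))
  · exact h.comp (contDiff_const.sub (contDiff_const.mul contDiff_fst))
  · exact h.comp ((contDiff_const.mul contDiff_fst).sub contDiff_const)

theorem fderiv_tubeFun_ne_zero (hδ : 0 < δ) {x : ℝ × F} (hx : tubeFun δ x = 0) :
    fderiv ℝ (tubeFun δ) x ≠ 0 := by
  intro h0
  have hd : HasFDerivAt (tubeFun δ) (0 : ℝ × F →L[ℝ] ℝ) x := by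
    rw [← h0]
    exact ((contDiff_tubeFun δ).differentiable (by simp) x).hasFDerivAt
  obtain ⟨τ, y⟩ := x
  have hline : ∀ v : ℝ × F, HasDerivAt (fun s : ℝ => tubeFun δ ((τ, y) + s • v)) 0 0 := by
    intro v
    have h1 : HasDerivAt (fun s : ℝ => (τ, y) + s • v) v 0 := by
      simpa using ((hasDerivAt_id (0:ℝ)).smul_const v).const_add (τ, y)
    have h2 : HasFDerivAt (tubeFun δ) (0 : ℝ × F →L[ℝ] ℝ) ((τ, y) + (0:ℝ) • v) := by simpa using hd
    simpa [Function.comp_def] using h2.comp_hasDerivAt (0:ℝ) h1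
  have ht : HasDerivAt (fun s : ℝ => tubeFun δ ((τ, y) + s • ((1 : ℝ), (0 : F))))
      ((1 / 2 - 2 * τ)⁻¹ ^ 2 * expNegInvGlue (1 / 2 - 2 * τ) * (-2) +
        (2 * τ - 3 / 2)⁻¹ ^ 2 * expNegInvGlue (2 * τ - 3 / 2) * 2) 0 := by
    have e1 : HasDerivAt (fun s : ℝ => expNegInvGlue (1 / 2 - 2 * (τ + s)))
        ((1 / 2 - 2 * τ)⁻¹ ^ 2 * expNegInvGlue (1 / 2 - 2 * τ) * (-2)) 0 := by
      have a : HasDerivAt (fun s : ℝ => 1 / 2 - 2 * (τ + s)) (-2) 0 := by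
        simpa only [id, mul_one] using
          (((hasDerivAt_id (0:ℝ)).const_add τ).const_mul 2).const_sub (1/2)
      have b := hasDerivAt_expNegInvGlue (1 / 2 - 2 * (τ + 0))
      have := b.comp (0:ℝ) a
      simpa [Function.comp_def] using this
    have e2 : HasDerivAt (fun s : ℝ => expNegInvGlue (2 * (τ + s) - 3 / 2))
        ((2 * τ - 3 / 2)⁻¹ ^ 2 * expNegInvGlue (2 * τ - 3 / 2) * 2) 0 := by
      have a : HasDerivAt (fun s : ℝ => 2 * (τ + s) - 3 / 2) 2 0 := by
        simpa using (((hasDerivAt_id (0:ℝ)).const_add τ).const_mul 2).sub_const (3/2)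
      have b := hasDerivAt_expNegInvGlue (2 * (τ + 0) - 3 / 2)
      have := b.comp (0:ℝ) a
      simpa [Function.comp_def] using this
    have := ((e1.const_add (expNegInvGlue (1 - ‖y‖ ^ 2 / δ ^ 2))).add e2).sub_const
      (expNegInvGlue (1 / 2))
    simpa [tubeFun, Pi.add_def] using this
  have e1 := ht.unique (hline _)
  have hr : HasDerivAt (fun s : ℝ => tubeFun δ ((τ, y) + s • ((0 : ℝ), y)))
      ((1 - ‖y‖ ^ 2 / δ ^ 2)⁻¹ ^ 2 * expNegInvGlue (1 - ‖y‖ ^ 2 / δ ^ 2) *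
        (-(2 * ‖y‖ ^ 2 / δ ^ 2))) 0 := by
    have hn : ∀ s : ℝ, ‖y + s • y‖ ^ 2 = (1 + s) ^ 2 * ‖y‖ ^ 2 := by
      intro s
      rw [show y + s • y = (1 + s) • y by module, norm_smul, mul_pow, Real.norm_eq_abs, sq_abs]
    have a : HasDerivAt (fun s : ℝ => 1 - (1 + s) ^ 2 * ‖y‖ ^ 2 / δ ^ 2)
        (-(2 * ‖y‖ ^ 2 / δ ^ 2)) 0 := by
      have := (((((hasDerivAt_id (0:ℝ)).const_add 1).pow 2).mul_const (‖y‖ ^ 2)).div_const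
        (δ ^ 2)).const_sub 1
      simpa using this
    have b := hasDerivAt_expNegInvGlue (1 - (1 + 0) ^ 2 * ‖y‖ ^ 2 / δ ^ 2)
    have := b.comp (0:ℝ) a
    have := ((this.add_const (expNegInvGlue (1 / 2 - 2 * τ))).add_const
      (expNegInvGlue (2 * τ - 3 / 2))).sub_const (expNegInvGlue (1 / 2))
    simpa [tubeFun, hn, Function.comp_def] using this
  have e2 := hr.unique (hline _)
  have hq : ∀ u : ℝ, 0 < u → 0 < u⁻¹ ^ 2 * expNegInvGlue u := fun u hu =>
    mul_pos (by positivity) (expNegInvGlue.pos_of_pos hu)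
  rcases lt_or_ge 0 (1 / 2 - 2 * τ) with h1 | h1
  · rw [expNegInvGlue.zero_of_nonpos (x := 2 * τ - 3 / 2) (by linarith)] at e1
    linarith [hq _ h1]
  rcases lt_or_ge 0 (2 * τ - 3 / 2) with h3 | h3
  · rw [expNegInvGlue.zero_of_nonpos h1] at e1
    linarith [hq _ h3]
  have hE : expNegInvGlue (1 - ‖y‖ ^ 2 / δ ^ 2) = expNegInvGlue (1 / 2) := by
    simp only [tubeFun] at hx
    rw [expNegInvGlue.zero_of_nonpos h1, expNegInvGlue.zero_of_nonpos h3] at hx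
    linarith
  have hu : 0 < 1 - ‖y‖ ^ 2 / δ ^ 2 := by
    by_contra! hc
    rw [expNegInvGlue.zero_of_nonpos hc] at hE
    exact glue_half_pos.ne hE
  have hy : 0 < ‖y‖ := by linarith [half_le_norm_of_tubeFun_nonpos hδ hx.le]
  have h4 : 0 < 2 * ‖y‖ ^ 2 / δ ^ 2 := by positivity
  nlinarith [mul_pos (hq _ hu) h4]

end TubeFunSmooth

section Connectivity
variable {F : Type*} [NormedAddCommGroup F] [InnerProductSpace ℝ F] {δ R : ℝ}

theorem exists_norm_eq_of_one_lt_rank (hF : 1 < Module.rank ℝ F) {r : ℝ} (hr : 0 ≤ r) :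
    ∃ y : F, ‖y‖ = r := by
  obtain ⟨y, hy⟩ := (isConnected_sphere hF (0 : F) hr).nonempty
  exact ⟨y, by simpa using hy⟩

theorem isPreconnected_tubeFun_neg (hF : 1 < Module.rank ℝ F) (hδ : 0 < δ) (hR : δ < R) :
    IsPreconnected {x : ℝ × F | tubeFun δ x < 0 ∧ ‖x.2‖ < R} := by
  set r := (δ + R) / 2 with hr
  have hδr : δ ≤ r := by linarith
  have hrR : r < R := by linarith
  have hr0 : 0 < r := by linarith
  have hcore : IsPreconnected (Ioo (0 : ℝ) 1 ×ˢ sphere (0 : F) r) :=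
    isPreconnected_Ioo.prod (isPreconnected_sphere hF 0 r)
  obtain ⟨y₀, hy₀⟩ := exists_norm_eq_of_one_lt_rank hF hr0.le
  refine isPreconnected_of_forall ((1 / 2 : ℝ), y₀) ?_
  rintro ⟨τ, y⟩ ⟨hx, hy⟩
  have hpos : 0 < ‖y‖ := (half_pos hδ).trans_le (half_le_norm_of_tubeFun_nonpos hδ hx.le)
  have h0 := pos_of_tubeFun_neg hx
  have h1 := lt_one_of_tubeFun_neg hx
  have hend : ‖(r / ‖y‖) • y‖ = r := by
    rw [norm_smul, Real.norm_of_nonneg (by positivity), div_mul_cancel₀ _ hpos.ne']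
  refine ⟨(fun t : ℝ => (τ, t • y)) '' uIcc 1 (r / ‖y‖) ∪ Ioo (0 : ℝ) 1 ×ˢ sphere (0 : F) r,
    ?_, Or.inr ⟨by norm_num, by simpa using hy₀⟩, Or.inl ⟨1, left_mem_uIcc, by simp⟩, ?_⟩
  · rintro _ (⟨t, ht, rfl⟩ | ⟨hτ, hy'⟩)
    · rcases le_total 1 (r / ‖y‖) with hle | hle
      · rw [uIcc_of_le hle] at ht
        have hn : ‖t • y‖ = t * ‖y‖ := by rw [norm_smul, Real.norm_of_nonneg (by linarith [ht.1])]
        refine ⟨(tubeFun_antitone_norm δ ?_).trans_lt hx, ?_⟩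
        · rw [hn]; nlinarith [ht.1]
        · have := (le_div_iff₀ hpos).1 ht.2
          simp only [hn]; linarith
      · rw [uIcc_of_ge hle] at ht
        have ht0 : 0 ≤ t := le_trans (by positivity) ht.1
        have hn : ‖t • y‖ = t * ‖y‖ := by rw [norm_smul, Real.norm_of_nonneg ht0]
        have := (div_le_iff₀ hpos).1 ht.1
        refine ⟨tubeFun_neg_of_le hδ ?_ h0 h1, ?_⟩
        · rw [hn]; linarith
        · simp only [hn]; nlinarith [ht.2]
    · rw [mem_sphere_zero_iff_norm] at hy'
      exact ⟨tubeFun_neg_of_le hδ (by rw [hy']; exact hδr) hτ.1 hτ.2, by rw [hy']; exact hrR⟩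
  · refine IsPreconnected.union (τ, (r / ‖y‖) • y) ⟨_, right_mem_uIcc, rfl⟩
      ⟨⟨h0, h1⟩, by simpa using hend⟩ ?_ hcore
    exact isPreconnected_uIcc.image _ (by fun_prop)

theorem isPreconnected_shell (hF : 1 < Module.rank ℝ F) {a b : ℝ} (ha : 0 ≤ a) :
    IsPreconnected (shell F a b) := by
  have : shell F a b = (fun p : ℝ × F => p.1 • p.2) '' (Ico a b ×ˢ sphere (0 : F) 1) := by
    ext y
    constructor
    · rintro ⟨h1, h2⟩
      rcases eq_or_ne y 0 with rfl | hy
      · obtain ⟨y₀, hy₀⟩ := exists_norm_eq_of_one_lt_rank hF (zero_le_one (α := ℝ))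
        exact ⟨(‖(0 : F)‖, y₀), ⟨⟨h1, h2⟩, by simpa using hy₀⟩, by simp⟩
      · refine ⟨(‖y‖, ‖y‖⁻¹ • y), ⟨⟨h1, h2⟩, ?_⟩, ?_⟩
        · simp [norm_smul, hy]
        · simp [smul_smul, hy]
    · rintro ⟨⟨t, y⟩, ⟨ht, hy⟩, rfl⟩
      have : ‖t • y‖ = t := by
        rw [norm_smul, mem_sphere_zero_iff_norm.1 hy, Real.norm_of_nonneg (ha.trans ht.1), mul_one]
      simpa [shell, this] using ht
  rw [this]
  exact (isPreconnected_Ico.prod (isPreconnected_sphere hF 0 1)).image _ (by fun_prop)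

theorem glue_neg_inv_log {x : ℝ} (h0 : 0 ≤ x) (h1 : x < 1) :
    expNegInvGlue (-(Real.log x)⁻¹) = x := by
  rcases h0.eq_or_lt with rfl | h0
  · simp [expNegInvGlue.zero]
  · have : Real.log x < 0 := Real.log_neg h0 h1
    have h2 : ¬ -(Real.log x)⁻¹ ≤ 0 := by
      rw [not_le, neg_pos]; exact inv_lt_zero.2 this
    rw [expNegInvGlue, if_neg h2, inv_neg, inv_inv, neg_neg, Real.exp_log h0]

theorem continuousOn_neg_inv_log : ContinuousOn (fun x : ℝ => -(Real.log x)⁻¹) (Ico 0 1) := by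
  rintro x ⟨h0, h1⟩
  rcases h0.eq_or_lt with rfl | h0
  · have h2 : Tendsto (fun x : ℝ => -(Real.log x)⁻¹) (𝓝[>] 0) (𝓝 (-(Real.log 0)⁻¹)) := by
      simpa using (tendsto_inv_atBot_zero.comp Real.tendsto_log_nhdsGT_zero).neg
    have : ContinuousWithinAt (fun x : ℝ => -(Real.log x)⁻¹) (Ici 0) 0 := by
      rw [← Ioi_insert]
      exact continuousWithinAt_insert_self.2 h2
    exact this.mono Ico_subset_Ici_self
  · have : Real.log x ≠ 0 := (Real.log_neg h0 h1).ne
    exact ((Real.continuousAt_log h0.ne').inv₀ this).neg.continuousWithinAt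

theorem glue_half_lt_one : expNegInvGlue (1 / 2) < 1 := by
  rw [expNegInvGlue, if_neg (by norm_num)]
  simp

theorem glue_injOn {x y : ℝ} (hy : 0 ≤ y) (hx : 0 ≤ x) (h : expNegInvGlue x = expNegInvGlue y) :
    x = y := by
  rcases lt_trichotomy x y with h1 | h1 | h1
  · exact absurd h (expNegInvGlue_lt (hx.trans_lt h1) h1).ne
  · exact h1
  · exact absurd h (expNegInvGlue_lt (hy.trans_lt h1) h1).ne'

theorem isPreconnected_tubeFun_zero (hF : 1 < Module.rank ℝ F) (hδ : 0 < δ) (hR : δ < R) :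
    IsPreconnected {x : ℝ × F | tubeFun δ x = 0 ∧ ‖x.2‖ < R} := by
  set r := √(δ ^ 2 / 2) with hr
  have hr2 : r ^ 2 = δ ^ 2 / 2 := Real.sq_sqrt (by positivity)
  have hr0 : 0 < r := by rw [hr]; positivity
  have hrδ : r < δ := by nlinarith
  obtain ⟨y₀, hy₀⟩ := exists_norm_eq_of_one_lt_rank hF hr0.le
  set T : F → ℝ := fun y => (1 / 2 - -(Real.log (expNegInvGlue (1 / 2) -
    expNegInvGlue (1 - ‖y‖ ^ 2 / δ ^ 2)))⁻¹) / 2 with hT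
  have hval : ∀ y ∈ shell F r R, expNegInvGlue (1 / 2) - expNegInvGlue (1 - ‖y‖ ^ 2 / δ ^ 2)
      ∈ Ico (0 : ℝ) (expNegInvGlue (1 / 2) + 1 - expNegInvGlue (1 / 2)) ∧
      expNegInvGlue (1 / 2) - expNegInvGlue (1 - ‖y‖ ^ 2 / δ ^ 2) ≤ expNegInvGlue (1 / 2) := by
    rintro y ⟨h1, -⟩
    have h2 : 1 - ‖y‖ ^ 2 / δ ^ 2 ≤ 1 / 2 := by
      have : 1 / 2 ≤ ‖y‖ ^ 2 / δ ^ 2 := by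
        rw [le_div_iff₀ (by positivity)]; nlinarith
      linarith
    have := expNegInvGlue.monotone h2
    have := expNegInvGlue.nonneg (1 - ‖y‖ ^ 2 / δ ^ 2)
    have := glue_half_lt_one
    refine ⟨⟨by linarith, by linarith⟩, by linarith⟩
  have hTc : ContinuousOn T (shell F r R) := by
    have h1 : Continuous (fun y : F => expNegInvGlue (1 / 2) -
        expNegInvGlue (1 - ‖y‖ ^ 2 / δ ^ 2)) := by
      have := expNegInvGlue.contDiff (n := 0).continuous
      fun_prop
    have := continuousOn_neg_inv_log.comp h1.continuousOn
      (fun y hy => by simpa using (hval y hy).1)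
    exact (continuousOn_const.sub this).div_const 2
  have hTg : ∀ y ∈ shell F r R, expNegInvGlue (1 / 2 - 2 * T y) =
      expNegInvGlue (1 / 2) - expNegInvGlue (1 - ‖y‖ ^ 2 / δ ^ 2) := by
    intro y hy
    have h1 := (hval y hy).1
    rw [hT]
    convert glue_neg_inv_log h1.1 (by simpa using h1.2) using 2
    ring
  have hTle : ∀ y ∈ shell F r R, T y ≤ 1 / 4 := by
    intro y hy
    have h1 := (hval y hy).1
    rw [add_sub_cancel_left] at h1
    have : (Real.log (expNegInvGlue (1 / 2) - expNegInvGlue (1 - ‖y‖ ^ 2 / δ ^ 2)))⁻¹ ≤ 0 :=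
      inv_nonpos.2 (Real.log_nonpos h1.1 h1.2.le)
    simp only [hT]; linarith
  have hmem : ∀ y ∈ shell F r R, tubeFun δ (T y, y) = 0 := by
    intro y hy
    rw [tubeFun_lower δ y (by linarith [hTle y hy]), hTg y hy]; ring
  have hgraph : ∀ τ (y : F), tubeFun δ (τ, y) = 0 → ‖y‖ < R → τ ≤ 1 / 4 → y ∈ shell F r R ∧
      T y = τ := by
    intro τ y h hyR hτ
    have hy : y ∈ shell F r R := by
      refine ⟨?_, hyR⟩
      have := sq_norm_ge_of_tubeFun_nonpos hδ h.le
      by_contra! hc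
      nlinarith [norm_nonneg y]
    refine ⟨hy, ?_⟩
    rw [tubeFun_lower δ y (by linarith)] at h
    have := glue_injOn (x := 1 / 2 - 2 * T y) (y := 1 / 2 - 2 * τ) (by linarith)
      (by linarith [hTle y hy]) (by rw [hTg y hy]; linarith)
    linarith
  have hmid : ∀ τ (y : F), 1 / 4 ≤ τ → τ ≤ 3 / 4 → (tubeFun δ (τ, y) = 0 ↔ ‖y‖ = r) := by
    intro τ y h1 h2
    rw [tubeFun_lower δ y h2, expNegInvGlue.zero_of_nonpos (x := 1 / 2 - 2 * τ) (by linarith),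
      add_zero, sub_eq_zero]
    constructor
    · intro h
      have hpos : 0 ≤ 1 - ‖y‖ ^ 2 / δ ^ 2 := by
        by_contra! hc
        rw [expNegInvGlue.zero_of_nonpos hc.le] at h
        exact glue_half_pos.ne h
      have := glue_injOn (by norm_num) hpos h
      have h3 : ‖y‖ ^ 2 / δ ^ 2 = 1 / 2 := by linarith
      rw [div_eq_iff (by positivity)] at h3
      have h4 : ‖y‖ ^ 2 = r ^ 2 := by rw [hr2, h3]; ring
      exact (pow_left_inj₀ (norm_nonneg y) hr0.le (by norm_num)).1 h4
    · intro h
      congr 1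
      rw [h, hr2]; field_simp; norm_num
  set S := {x : ℝ × F | tubeFun δ x = 0 ∧ ‖x.2‖ < R}
  set A := (fun y => (T y, y)) '' shell F r R
  set B := (fun y => (1 - T y, y)) '' shell F r R
  set C := Icc (1 / 4 : ℝ) (3 / 4) ×ˢ sphere (0 : F) r
  have hsh := isPreconnected_shell hF (b := R) hr0.le
  have hA : IsPreconnected A := hsh.image _ (hTc.prodMk continuousOn_id)
  have hB : IsPreconnected B := hsh.image _ ((continuousOn_const.sub hTc).prodMk continuousOn_id)
  have hC : IsPreconnected C := isPreconnected_Icc.prod (isPreconnected_sphere hF 0 r)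
  have hy₀s : y₀ ∈ shell F r R := ⟨hy₀.ge, by linarith⟩
  have hT₀ : T y₀ = 1 / 4 :=
    (hgraph (1 / 4) y₀ ((hmid _ _ le_rfl (by norm_num)).2 hy₀) hy₀s.2 le_rfl).2
  have hAC : IsPreconnected (A ∪ C) := IsPreconnected.union (1 / 4, y₀) ⟨y₀, hy₀s, by simp only [hT₀]⟩
    ⟨by norm_num, by simpa using hy₀⟩ hA hC
  have hACB : IsPreconnected (A ∪ C ∪ B) := IsPreconnected.union (3 / 4, y₀)
    (Or.inr ⟨by norm_num, by simpa using hy₀⟩) ⟨y₀, hy₀s, by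
      simp only [hT₀]; norm_num⟩ hAC hB
  convert hACB using 1
  ext ⟨τ, y⟩
  constructor
  · rintro ⟨h, hy⟩
    rcases le_total τ (1 / 4) with h1 | h1
    · obtain ⟨h2, h3⟩ := hgraph τ y h hy h1
      exact Or.inl (Or.inl ⟨y, h2, by simp only [h3]⟩)
    rcases le_total τ (3 / 4) with h2 | h2
    · exact Or.inl (Or.inr ⟨⟨h1, h2⟩, by simpa using (hmid τ y h1 h2).1 h⟩)
    · rw [← tubeFun_reflect] at h
      obtain ⟨h2, h3⟩ := hgraph (1 - τ) y h hy (by linarith)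
      exact Or.inr ⟨y, h2, by simp only [h3]; simp⟩
  · rintro ((⟨y, hy, h⟩ | ⟨h1, h2⟩) | ⟨y, hy, h⟩)
    · rw [← h]; exact ⟨hmem y hy, hy.2⟩
    · have h3 : ‖y‖ = r := by simpa using h2
      exact ⟨(hmid τ y h1.1 h1.2).2 h3, by simp only [h3]; linarith⟩
    · rw [← h]; exact ⟨(tubeFun_reflect δ (T y, y)).trans (hmem y hy), hy.2⟩

end Connectivity

/-- The square of a function, as an extended nonnegative real. -/
noncomputable def sqVal {X : Type*} (h : X → ℝ) (x : X) : ℝ≥0∞ := ENNReal.ofReal (h x ^ 2)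

/-- The energy density of a function, as an extended nonnegative real. -/
noncomputable def gradSq {X : Type*} [NormedAddCommGroup X] [NormedSpace ℝ X] (h : X → ℝ) (x : X) :
    ℝ≥0∞ := ENNReal.ofReal (‖fderiv ℝ h x‖ ^ 2)

/-- Integration over the unit interval in the first variable. -/
noncomputable def colInt {F : Type*} (V : ℝ × F → ℝ≥0∞) (y : F) : ℝ≥0∞ :=
  ∫⁻ τ in Icc (0 : ℝ) 1, V (τ, y)

/-- The cylinder of radius `R` with a rounded neighbourhood of its axis removed. -/
def tubeDom (F : Type*) [Norm F] (δ R : ℝ) : Set (ℝ × F) := {x | tubeFun δ x < 0 ∧ ‖x.2‖ < R}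

theorem measurable_sqVal {X : Type*} [TopologicalSpace X] [MeasurableSpace X]
    [OpensMeasurableSpace X] {h : X → ℝ} (hh : Continuous h) : Measurable (sqVal h) :=
  ENNReal.measurable_ofReal.comp (hh.measurable.pow_const 2)

theorem measurable_gradSq {X : Type*} [NormedAddCommGroup X] [NormedSpace ℝ X] [MeasurableSpace X]
    [OpensMeasurableSpace X] {h : X → ℝ} (hh : ContDiff ℝ 1 h) : Measurable (gradSq h) :=
  ENNReal.measurable_ofReal.comp
    ((hh.continuous_fderiv (by simp)).norm.measurable.pow_const 2)

theorem sqVal_along_le {X : Type*} [NormedAddCommGroup X] [NormedSpace ℝ X] {h : X → ℝ}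
    (hh : ContDiff ℝ 1 h) {γ γ' : ℝ → X} (hγ : ∀ s, HasDerivAt γ (γ' s) s) (hγ' : Continuous γ')
    {a b x y : ℝ} (hx : x ∈ Icc a b) (hy : y ∈ Icc a b) :
    sqVal h (γ x) ≤ 2 * sqVal h (γ y) + 2 * ENNReal.ofReal (b - a) *
      ∫⁻ s in Icc a b, ENNReal.ofReal (‖γ' s‖ ^ 2) * gradSq h (γ s) := by
  have hγc : Continuous γ := continuous_iff_continuousAt.2 fun s => (hγ s).continuousAt
  have hd : ∀ s, HasDerivAt (fun s => h (γ s)) (fderiv ℝ h (γ s) (γ' s)) s := fun s =>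
    ((hh.differentiable (by simp) (γ s)).hasFDerivAt).comp_hasDerivAt s (hγ s)
  have hc : Continuous fun s => fderiv ℝ h (γ s) (γ' s) :=
    ((hh.continuous_fderiv (by simp)).comp hγc).clm_apply hγ'
  refine (sq_le_of_hasDerivAt (fun s _ => hd s) hc.continuousOn hx hy).trans ?_
  refine add_le_add le_rfl (mul_le_mul' le_rfl (lintegral_mono fun s => ?_))
  rw [gradSq, ← ENNReal.ofReal_mul (by positivity), ← mul_pow]
  apply ENNReal.ofReal_le_ofReal
  rw [← sq_abs, ← Real.norm_eq_abs]
  gcongr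
  rw [mul_comm]
  exact ContinuousLinearMap.le_opNorm _ _

section Model
variable {F : Type*} [NormedAddCommGroup F] [InnerProductSpace ℝ F] [FiniteDimensional ℝ F]
  [MeasurableSpace F] [BorelSpace F] {δ R : ℝ}

theorem measurable_colInt {V : ℝ × F → ℝ≥0∞} (hV : Measurable V) : Measurable (colInt V) :=
  Measurable.lintegral_prod_right' (f := fun p : F × ℝ => V (p.2, p.1)) (hV.comp measurable_swap)

theorem measurableSet_tubeDom (F : Type*) [NormedAddCommGroup F] [InnerProductSpace ℝ F]
    [FiniteDimensional ℝ F] [MeasurableSpace F] [BorelSpace F] (δ R : ℝ) :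
    MeasurableSet (tubeDom F δ R) :=
  (measurableSet_lt (contDiff_tubeFun δ).continuous.measurable measurable_const).inter
    (measurableSet_lt (measurable_norm.comp measurable_snd) measurable_const)

theorem setLIntegral_colInt {V : ℝ × F → ℝ≥0∞} (hV : Measurable V) {s : Set F}
    (hs : MeasurableSet s) :
    ∫⁻ y in s, colInt V y = ∫⁻ x in Ioo (0 : ℝ) 1 ×ˢ s, V x := by
  rw [Measure.volume_eq_prod, ← Measure.prod_restrict, lintegral_prod_symm' _ hV]
  refine setLIntegral_congr_fun hs fun y _ => ?_
  exact setLIntegral_congr Ioo_ae_eq_Icc.symm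

theorem setLIntegral_colInt_shell_le (hδ : 0 < δ) {V : ℝ × F → ℝ≥0∞} (hV : Measurable V) {a b : ℝ}
    (ha : δ ≤ a) (hb : b ≤ R) :
    ∫⁻ y in shell F a b, colInt V y ≤ ∫⁻ x in tubeDom F δ R, V x := by
  rw [setLIntegral_colInt hV (measurableSet_shell F a b)]
  apply lintegral_mono_set
  rintro ⟨τ, y⟩ ⟨hτ, hy⟩
  exact ⟨tubeFun_neg_of_le hδ (ha.trans hy.1) hτ.1 hτ.2, hy.2.trans_le hb⟩

variable {h : ℝ × F → ℝ}

theorem colInt_sqVal_le (hh : ContDiff ℝ 1 h) (y : F) :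
    colInt (sqVal h) y ≤ 2 * sqVal h (0, y) + 2 * colInt (gradSq h) y := by
  have hγ : ∀ s : ℝ, HasDerivAt (fun s : ℝ => (s, y)) ((1 : ℝ), (0 : F)) s := fun s =>
    (hasDerivAt_id s).prodMk (hasDerivAt_const s y)
  have key : ∀ τ ∈ Icc (0 : ℝ) 1, sqVal h (τ, y) ≤
      2 * sqVal h (0, y) + 2 * colInt (gradSq h) y := by
    intro τ hτ
    have := sqVal_along_le hh hγ continuous_const hτ (left_mem_Icc.2 zero_le_one)
    simpa [colInt, Prod.norm_def] using this
  refine (setLIntegral_mono measurable_const key).trans ?_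
  simp

theorem colInt_sqVal_dilate_le (hh : ContDiff ℝ 1 h) {Λ : ℝ} (hΛ : 0 ≤ Λ) (y : F) :
    colInt (sqVal h) y ≤ 2 * colInt (sqVal h) (Real.exp Λ • y) + 2 * ENNReal.ofReal Λ *
      ∫⁻ σ in Icc 0 Λ, ENNReal.ofReal (‖Real.exp σ • y‖ ^ 2) *
        colInt (gradSq h) (Real.exp σ • y) := by
  have hG := measurable_gradSq hh
  have hV := measurable_sqVal hh.continuous
  have hm : Measurable (fun p : ℝ × ℝ =>
      ENNReal.ofReal (‖Real.exp p.2 • y‖ ^ 2) * gradSq h (p.1, Real.exp p.2 • y)) := by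
    have h1 : Measurable (fun p : ℝ × ℝ => Real.exp p.2 • y) := by fun_prop
    exact (ENNReal.measurable_ofReal.comp (h1.norm.pow_const 2)).mul
      (hG.comp (measurable_fst.prodMk h1))
  have hγ : ∀ τ s : ℝ, HasDerivAt (fun s : ℝ => (τ, Real.exp s • y)) ((0 : ℝ), Real.exp s • y) s :=
    fun τ s => (hasDerivAt_const s τ).prodMk ((Real.hasDerivAt_exp s).smul_const y)
  have key : ∀ τ : ℝ, sqVal h (τ, y) ≤ 2 * sqVal h (τ, Real.exp Λ • y) + 2 * ENNReal.ofReal Λ *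
      ∫⁻ σ in Icc 0 Λ, ENNReal.ofReal (‖Real.exp σ • y‖ ^ 2) * gradSq h (τ, Real.exp σ • y) := by
    intro τ
    have := sqVal_along_le hh (hγ τ) (by fun_prop) (left_mem_Icc.2 hΛ) (right_mem_Icc.2 hΛ)
    simpa [Prod.norm_def] using this
  have hm1 : Measurable fun τ : ℝ => sqVal h (τ, Real.exp Λ • y) :=
    hV.comp (measurable_id.prodMk measurable_const)
  have hm2 : Measurable fun τ : ℝ => ∫⁻ σ in Icc 0 Λ,
      ENNReal.ofReal (‖Real.exp σ • y‖ ^ 2) * gradSq h (τ, Real.exp σ • y) :=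
    hm.lintegral_prod_right'
  calc colInt (sqVal h) y
      ≤ ∫⁻ τ in Icc (0 : ℝ) 1, (2 * sqVal h (τ, Real.exp Λ • y) + 2 * ENNReal.ofReal Λ *
        ∫⁻ σ in Icc 0 Λ, ENNReal.ofReal (‖Real.exp σ • y‖ ^ 2) *
          gradSq h (τ, Real.exp σ • y)) := lintegral_mono fun τ => key τ
    _ = 2 * colInt (sqVal h) (Real.exp Λ • y) + 2 * ENNReal.ofReal Λ *
        ∫⁻ τ in Icc (0 : ℝ) 1, ∫⁻ σ in Icc 0 Λ, ENNReal.ofReal (‖Real.exp σ • y‖ ^ 2) *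
          gradSq h (τ, Real.exp σ • y) := by
        rw [lintegral_add_right _ (hm2.const_mul _), lintegral_const_mul _ hm1,
          lintegral_const_mul _ hm2, colInt]
    _ = _ := by
        rw [lintegral_lintegral_swap hm.aemeasurable]
        congr 2
        refine lintegral_congr fun σ => ?_
        rw [colInt, lintegral_const_mul]
        exact hG.comp (measurable_id.prodMk measurable_const)

/-- The size of the shell estimate. -/
noncomputable def shellConst (R r : ℝ) : ℝ := (16 / R ^ 2 + 8 * Real.log (R / (2 * r))) * r ^ 2

/-- The integral of the square of a function over a thin shell is controlled by the boundary values
at the bottom of the cylinder and the energy. -/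
theorem setLIntegral_shell_sqVal_le (hF : 2 ≤ Module.finrank ℝ F) (hh : ContDiff ℝ 1 h) (hδ : 0 < δ)
    {r : ℝ} (hr : δ ≤ r) (hR : 2 * r ≤ R) :
    ∫⁻ y in shell F r (2 * r), colInt (sqVal h) y ≤ ENNReal.ofReal (shellConst R r) *
      ((∫⁻ y in shell F δ R, sqVal h (0, y)) + ∫⁻ x in tubeDom F δ R, gradSq h x) := by
  have hr0 : 0 < r := hδ.trans_le hr
  have hR0 : 0 < R := by linarith
  set Λ := Real.log (R / (2 * r)) with hΛdef
  have hΛ : 0 ≤ Λ := Real.log_nonneg (by rw [le_div_iff₀ (by positivity)]; linarith)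
  have hexp : 2 * r * Real.exp Λ = R := by
    rw [hΛdef, Real.exp_log (by positivity)]; field_simp
  have hV := measurable_sqVal hh.continuous
  have hG := measurable_gradSq hh
  set X := (∫⁻ y in shell F δ R, sqVal h (0, y)) + ∫⁻ x in tubeDom F δ R, gradSq h x with hX
  have hmain := lintegral_shell_le (volume : Measure F) hF (measurable_colInt hV)
    (measurable_colInt hG) hr0 hΛ hexp (fun y _ => colInt_sqVal_dilate_le hh hΛ y)
  have hGle : ∫⁻ y in shell F r R, colInt (gradSq h) y ≤ X :=
    (setLIntegral_colInt_shell_le hδ hG hr le_rfl).trans le_add_self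
  have hUle : ∫⁻ y in shell F r R, colInt (sqVal h) y ≤ 2 * X := by
    have hm0 : Measurable fun y : F => sqVal h (0, y) := hV.comp (measurable_const.prodMk measurable_id)
    calc _ ≤ ∫⁻ y in shell F r R, (2 * sqVal h (0, y) + 2 * colInt (gradSq h) y) :=
          lintegral_mono fun y => colInt_sqVal_le hh y
      _ = 2 * (∫⁻ y in shell F r R, sqVal h (0, y)) +
          2 * ∫⁻ y in shell F r R, colInt (gradSq h) y := by
          rw [lintegral_add_left (hm0.const_mul _), lintegral_const_mul _ hm0,
            lintegral_const_mul _ (measurable_colInt hG)]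
      _ ≤ 2 * (∫⁻ y in shell F δ R, sqVal h (0, y)) + 2 * ∫⁻ x in tubeDom F δ R, gradSq h x := by
          gcongr
          · exact fun y hy => ⟨hr.trans hy.1, hy.2⟩
          · exact setLIntegral_colInt_shell_le hδ hG hr le_rfl
      _ = 2 * X := by rw [hX, mul_add]
  calc _ ≤ _ := hmain
    _ ≤ 2 * ENNReal.ofReal ((2 * r / R) ^ 2) * (2 * X) + ENNReal.ofReal (8 * r ^ 2 * Λ) * X := by
        gcongr
    _ = ENNReal.ofReal (shellConst R r) * X := by
        rw [show 2 * ENNReal.ofReal ((2 * r / R) ^ 2) * (2 * X) =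
          (2 * 2 * ENNReal.ofReal ((2 * r / R) ^ 2)) * X by ring, ← add_mul]
        congr 1
        rw [show (2 : ℝ≥0∞) = ENNReal.ofReal 2 by simp, ← ENNReal.ofReal_mul (by norm_num),
          ← ENNReal.ofReal_mul (by norm_num), ← ENNReal.ofReal_add (by positivity) (by positivity),
          shellConst, ← hΛdef]
        congr 1
        field_simp
        ring

end Model

section Wall
variable {F : Type*} [NormedAddCommGroup F] [InnerProductSpace ℝ F] [FiniteDimensional ℝ F]
  [MeasurableSpace F] [BorelSpace F] {δ R : ℝ}

theorem exists_finset_directions (F : Type*) [NormedAddCommGroup F] [InnerProductSpace ℝ F]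
    [FiniteDimensional ℝ F] : ∃ t : Finset F, (∀ k ∈ t, ‖k‖ = 1) ∧
      ∀ y : F, y ≠ 0 → ∃ k ∈ t, ‖y‖ / 2 ≤ inner ℝ y k := by
  obtain ⟨s, hs, hfin, hcov⟩ := (isCompact_sphere (0 : F) 1).finite_cover_balls
    (zero_lt_one (α := ℝ))
  refine ⟨hfin.toFinset, fun k hk => by simpa using hs (hfin.mem_toFinset.1 hk), fun y hy => ?_⟩
  have hn : 0 < ‖y‖ := norm_pos_iff.2 hy
  have hu : ‖‖y‖⁻¹ • y‖ = 1 := by simp [norm_smul, hn.ne']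
  obtain ⟨k, hk, hball⟩ := mem_iUnion₂.1 (hcov (show ‖y‖⁻¹ • y ∈ sphere (0 : F) 1 by simpa using hu))
  refine ⟨k, hfin.mem_toFinset.2 hk, ?_⟩
  have hk1 : ‖k‖ = 1 := by simpa using hs hk
  rw [mem_ball, dist_eq_norm] at hball
  have h1 := norm_sub_sq_real (‖y‖⁻¹ • y) k
  rw [hu, hk1, real_inner_smul_left] at h1
  have h2 : ‖‖y‖⁻¹ • y - k‖ ^ 2 < 1 := by
    have := norm_nonneg (‖y‖⁻¹ • y - k); nlinarith
  have h3 : 1 / 2 < ‖y‖⁻¹ * inner ℝ y k := by linarith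
  rw [lt_inv_mul_iff₀ hn] at h3
  linarith

/-- The part of the lower half of the wall seen from the direction `k`. -/
def wallPiece (δ : ℝ) (k : F) : Set (ℝ × F) :=
  {x | tubeFun δ x = 0 ∧ x.1 ≤ 1 / 2 ∧ ‖x.2‖ / 2 ≤ inner ℝ x.2 k}

theorem dist_le_of_mem_wallPiece (hδ : 0 < δ) {k : F} (hk : ‖k‖ = 1) {x x' : ℝ × F}
    (hx : x ∈ wallPiece δ k) (hx' : x' ∈ wallPiece δ k) :
    dist x x' ≤ 4 * dist (x.2 - x.1 • k) (x'.2 - x'.1 • k) := by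
  wlog hle : x.1 ≤ x'.1 generalizing x x'
  · rw [dist_comm x, dist_comm (x.2 - _)]
    exact this hx' hx (le_of_not_ge hle)
  obtain ⟨τ, y⟩ := x
  obtain ⟨τ', y'⟩ := x'
  obtain ⟨hz, h2, hi⟩ := hx
  obtain ⟨hz', h2', hi'⟩ := hx'
  simp only at hle hi hi' h2 h2'
  rw [dist_comm (τ, y), dist_comm (y - _), Prod.dist_eq, dist_eq_norm, dist_eq_norm, dist_eq_norm]
  simp only
  set w := y' - τ' • k - (y - τ • k) with hw
  have hτ : τ' - τ ≤ 3 * ‖w‖ := by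
    rcases hle.eq_or_lt with h | h
    · rw [h, sub_self]; positivity
    have hyy := norm_le_of_tubeFun_eq_zero hδ hz hz' h h2'
    set a := inner ℝ y k
    set a' := inner ℝ y' k
    have hkk : inner ℝ k k = (1 : ℝ) := by rw [real_inner_self_eq_norm_sq, hk]; norm_num
    have hnorm : ∀ v : F, ‖v - inner ℝ v k • k‖ ^ 2 = ‖v‖ ^ 2 - (inner ℝ v k) ^ 2 := by
      intro v
      rw [norm_sub_sq_real, real_inner_smul_right, norm_smul, hk, Real.norm_eq_abs, mul_one, sq_abs]
      ring
    have hz1 := hnorm y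
    have hz2 := hnorm y'
    have hdz : ‖(y' - a' • k) - (y - a • k)‖ ≤ ‖w‖ := by
      have e : (y' - a' • k) - (y - a • k) = w - inner ℝ w k • k := by
        have : inner ℝ w k = a' - τ' - (a - τ) := by
          simp only [hw, inner_sub_left, real_inner_smul_left, hkk, a, a', mul_one]
        rw [this, hw]; module
      rw [e]
      have := hnorm w
      refine le_of_sq_le_sq ?_ (norm_nonneg _)
      nlinarith [sq_nonneg (inner ℝ w k)]
    have hwk : |inner ℝ w k| ≤ ‖w‖ := by
      simpa [hk] using abs_real_inner_le_norm w k
    have hwi : inner ℝ w k = a' - τ' - (a - τ) := by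
      simp only [hw, inner_sub_left, real_inner_smul_left, hkk, a, a', mul_one]
    have htri : ‖y - a • k‖ - ‖y' - a' • k‖ ≤ ‖w‖ :=
      (norm_sub_norm_le _ _).trans (by rw [norm_sub_rev]; exact hdz)
    have hy : 0 < ‖y‖ := (half_pos hδ).trans_le (half_le_norm_of_tubeFun_nonpos hδ hz.le)
    have hp1 : ‖y - a • k‖ ≤ ‖y‖ := by
      refine le_of_sq_le_sq ?_ (norm_nonneg _)
      nlinarith [sq_nonneg a]
    have hp2 : ‖y' - a' • k‖ ≤ ‖y'‖ := by
      refine le_of_sq_le_sq ?_ (norm_nonneg _)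
      nlinarith [sq_nonneg a']
    have hs : 0 < a + a' := by linarith [norm_nonneg y']
    have h1 : (a' - a) * (a + a') ≤ ‖w‖ * (2 * (a + a')) := by
      have e1 : (a' - a) * (a + a') ≤ (‖y - a • k‖ - ‖y' - a' • k‖) *
          (‖y - a • k‖ + ‖y' - a' • k‖) := by nlinarith [norm_nonneg y']
      have e2 : (‖y - a • k‖ - ‖y' - a' • k‖) * (‖y - a • k‖ + ‖y' - a' • k‖) ≤
          ‖w‖ * (‖y - a • k‖ + ‖y' - a' • k‖) :=
        mul_le_mul_of_nonneg_right htri (by positivity)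
      have e3 : ‖w‖ * (‖y - a • k‖ + ‖y' - a' • k‖) ≤ ‖w‖ * (2 * (a + a')) :=
        mul_le_mul_of_nonneg_left (by linarith) (norm_nonneg _)
      linarith
    have h3 : a' - a ≤ 2 * ‖w‖ := by
      by_contra! hc
      nlinarith
    have := (abs_le.1 hwk).1
    linarith
  refine max_le ?_ ?_
  · rw [Real.norm_of_nonneg (by linarith)]; linarith [norm_nonneg w]
  · have e : y' - y = w + (τ' - τ) • k := by rw [hw]; module
    rw [e]
    refine (norm_add_le _ _).trans ?_
    rw [norm_smul, hk, Real.norm_of_nonneg (by linarith)]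
    linarith

theorem lintegral_colInt_shear {V : ℝ × F → ℝ≥0∞} (hV : Measurable V) (k : F) :
    ∫⁻ w, colInt (fun p => V (p.1, p.2 + p.1 • k)) w = ∫⁻ y, colInt V y := by
  have hV' : Measurable (fun p : F × ℝ => V (p.2, p.1 + p.2 • k)) :=
    hV.comp (measurable_snd.prodMk (measurable_fst.add (measurable_snd.smul_const k)))
  have hVs : Measurable (fun p : F × ℝ => V (p.2, p.1)) := hV.comp measurable_swap
  simp only [colInt]
  rw [lintegral_lintegral_swap (f := fun w τ => V (τ, w + τ • k)) hV'.aemeasurable,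
    lintegral_lintegral_swap (f := fun y τ => V (τ, y)) hVs.aemeasurable]
  refine lintegral_congr fun τ => ?_
  exact lintegral_add_right_eq_self (fun y => V (τ, y)) (τ • k)

theorem measurable_colInt_shear {V : ℝ × F → ℝ≥0∞} (hV : Measurable V) (k : F) :
    Measurable (colInt (fun p => V (p.1, p.2 + p.1 • k))) :=
  measurable_colInt
    (hV.comp (measurable_fst.prodMk (measurable_snd.add (measurable_fst.smul_const k))))

theorem setLIntegral_line_le (V : ℝ × F → ℝ≥0∞) {k y : F} {τ : ℝ} {S : Set ℝ}
    (hS : MeasurableSet S) (hτ : ∀ s ∈ S, τ + s ∈ Icc (0 : ℝ) 1) {A : Set (ℝ × F)}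
    (hA : ∀ s ∈ S, (τ + s, y + s • k) ∈ A) :
    ∫⁻ s in S, V (τ + s, y + s • k) ≤
      colInt (fun p => A.indicator V (p.1, p.2 + p.1 • k)) (y - τ • k) := by
  rw [colInt, ← lintegral_indicator measurableSet_Icc, ← lintegral_indicator hS]
  refine le_trans (lintegral_mono fun s => ?_) (lintegral_add_left_eq_self _ τ).le
  by_cases hs : s ∈ S
  · rw [indicator_of_mem hs, indicator_of_mem (hτ s hs),
      show y - τ • k + (τ + s) • k = y + s • k by module, indicator_of_mem (hA s hs)]
  · rw [indicator_of_notMem hs]; exact zero_le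

variable {h : ℝ × F → ℝ}

/-- The bound obtained by moving from the wall along the direction `(1, k)`. -/
noncomputable def rayBound (h : ℝ × F → ℝ) (δ R ℓ : ℝ) (k : F) (w : F) : ℝ≥0∞ :=
  ENNReal.ofReal (2 / ℓ) *
    colInt (fun p => (univ ×ˢ shell F ℓ (4 * ℓ)).indicator (sqVal h) (p.1, p.2 + p.1 • k)) w +
  ENNReal.ofReal (4 * ℓ) *
    colInt (fun p => (tubeDom F δ R).indicator (gradSq h) (p.1, p.2 + p.1 • k)) w

theorem sqVal_le_rayBound (hh : ContDiff ℝ 1 h) (hδ : 0 < δ) {ℓ : ℝ} (hℓ : 0 < ℓ) (hℓ' : ℓ ≤ 1 / 8)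
    (hR : 4 * ℓ ≤ R) {k : F} (hk : ‖k‖ = 1) {x : ℝ × F} (hx : x ∈ wallPiece δ k)
    (hxℓ : ‖x.2‖ < 2 * ℓ) : sqVal h x ≤ rayBound h δ R ℓ k (x.2 - x.1 • k) := by
  obtain ⟨τ, y⟩ := x
  obtain ⟨hz, h2, hi⟩ := hx
  simp only at h2 hi hxℓ ⊢
  have hτ0 := nonneg_of_tubeFun_nonpos hz.le
  have hsq : ∀ s : ℝ, ‖y + s • k‖ ^ 2 = ‖y‖ ^ 2 + 2 * s * inner ℝ y k + s ^ 2 := by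
    intro s
    rw [norm_add_sq_real, real_inner_smul_right, norm_smul, hk, mul_one, Real.norm_eq_abs, sq_abs]
    ring
  have hge : ∀ s : ℝ, 0 < s → ‖y‖ < ‖y + s • k‖ ∧ s ≤ ‖y + s • k‖ := by
    intro s hs
    have hp : 0 ≤ 2 * s * inner ℝ y k := by
      have : 0 ≤ inner ℝ y k := le_trans (by positivity) hi
      positivity
    constructor
    · refine lt_of_pow_lt_pow_left₀ 2 (norm_nonneg _) ?_
      rw [hsq]; nlinarith
    · refine le_of_sq_le_sq ?_ (norm_nonneg _)
      rw [hsq]; nlinarith [norm_nonneg y]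
  have hle : ∀ s : ℝ, 0 < s → ‖y + s • k‖ ≤ ‖y‖ + s := by
    intro s hs
    refine (norm_add_le _ _).trans ?_
    rw [norm_smul, hk, Real.norm_of_nonneg hs.le, mul_one]
  have hγ : ∀ s : ℝ, HasDerivAt (fun s : ℝ => (τ + s, y + s • k)) ((1 : ℝ), k) s := fun s => by
    have h1 : HasDerivAt (fun s : ℝ => y + s • k) k s := by
      simpa using ((hasDerivAt_id s).smul_const k).const_add y
    exact ((hasDerivAt_id s).const_add τ).prodMk h1
  set I := ∫⁻ s in Icc 0 (2 * ℓ), gradSq h (τ + s, y + s • k)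
  have key : ∀ s ∈ Icc ℓ (2 * ℓ), sqVal h (τ, y) ≤ 2 * sqVal h (τ + s, y + s • k) +
      ENNReal.ofReal (4 * ℓ) * I := by
    intro s hs
    have := sqVal_along_le hh hγ continuous_const (a := 0) (b := 2 * ℓ) (x := 0) (y := s)
      ⟨le_rfl, by linarith⟩ ⟨by linarith [hs.1], hs.2⟩
    simp only [add_zero, zero_smul, sub_zero] at this
    refine this.trans_eq ?_
    have hn : ‖((1 : ℝ), k)‖ = 1 := by simp [Prod.norm_def, hk]
    rw [show (2 : ℝ≥0∞) * ENNReal.ofReal (2 * ℓ) = ENNReal.ofReal (4 * ℓ) by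
      rw [show (2 : ℝ≥0∞) = ENNReal.ofReal 2 by simp, ← ENNReal.ofReal_mul (by norm_num)]
      congr 1; ring]
    simp [hn, I]
  have hm : Measurable fun s : ℝ => sqVal h (τ + s, y + s • k) :=
    (measurable_sqVal hh.continuous).comp (by fun_prop)
  have h_int : ENNReal.ofReal ℓ * sqVal h (τ, y) ≤
      2 * (∫⁻ s in Icc ℓ (2 * ℓ), sqVal h (τ + s, y + s • k)) +
        ENNReal.ofReal ℓ * (ENNReal.ofReal (4 * ℓ) * I) := by
    calc ENNReal.ofReal ℓ * sqVal h (τ, y) = ∫⁻ _ in Icc ℓ (2 * ℓ), sqVal h (τ, y) := by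
          rw [setLIntegral_const, Real.volume_Icc, mul_comm, show 2 * ℓ - ℓ = ℓ by ring]
      _ ≤ ∫⁻ s in Icc ℓ (2 * ℓ), (2 * sqVal h (τ + s, y + s • k) + ENNReal.ofReal (4 * ℓ) * I) :=
          setLIntegral_mono' measurableSet_Icc key
      _ = _ := by
          rw [lintegral_add_right _ measurable_const, lintegral_const_mul _ hm, setLIntegral_const,
            Real.volume_Icc, show 2 * ℓ - ℓ = ℓ by ring, mul_comm (_ * I)]
  have hV : ∫⁻ s in Icc ℓ (2 * ℓ), sqVal h (τ + s, y + s • k) ≤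
      colInt (fun p => (univ ×ˢ shell F ℓ (4 * ℓ)).indicator (sqVal h) (p.1, p.2 + p.1 • k))
        (y - τ • k) := by
    refine setLIntegral_line_le _ measurableSet_Icc
      (fun s hs => ⟨by linarith [hs.1], by linarith [hs.2]⟩) fun s hs => ⟨mem_univ _, ?_, ?_⟩
    · exact hs.1.trans (hge s (by linarith [hs.1])).2
    · have := hle s (by linarith [hs.1])
      simp only; linarith [hs.2]
  have hG : I ≤ colInt (fun p => (tubeDom F δ R).indicator (gradSq h) (p.1, p.2 + p.1 • k))
        (y - τ • k) := by
    have : I = ∫⁻ s in Ioc 0 (2 * ℓ), gradSq h (τ + s, y + s • k) :=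
      setLIntegral_congr Ioc_ae_eq_Icc.symm
    rw [this]
    refine setLIntegral_line_le _ measurableSet_Ioc
      (fun s hs => ⟨by linarith [hs.1], by linarith [hs.2]⟩) fun s hs => ⟨?_, ?_⟩
    · exact tubeFun_neg_of_ray hδ hz hs.1 (by linarith [hs.2]) (hge s hs.1).1
    · have := hle s hs.1
      simp only; linarith [hs.2]
  have hfin : sqVal h (τ, y) = ENNReal.ofReal ℓ⁻¹ * (ENNReal.ofReal ℓ * sqVal h (τ, y)) := by
    rw [← mul_assoc, ← ENNReal.ofReal_mul (by positivity), inv_mul_cancel₀ hℓ.ne']; simp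
  rw [hfin]
  refine (mul_le_mul' le_rfl h_int).trans ?_
  rw [rayBound, mul_add, ← mul_assoc, ← mul_assoc (ENNReal.ofReal ℓ⁻¹),
    ← ENNReal.ofReal_mul (by positivity), inv_mul_cancel₀ hℓ.ne', ENNReal.ofReal_one, one_mul]
  refine add_le_add (mul_le_mul' ?_ hV) (mul_le_mul' le_rfl hG)
  rw [show (2 : ℝ≥0∞) = ENNReal.ofReal 2 by simp, ← ENNReal.ofReal_mul (by positivity)]
  apply le_of_eq; congr 1; ring

theorem measurable_rayBound (hh : ContDiff ℝ 1 h) (ℓ : ℝ) (k : F) :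
    Measurable (rayBound h δ R ℓ k) :=
  ((measurable_colInt_shear ((measurable_sqVal hh.continuous).indicator
    (MeasurableSet.univ.prod (measurableSet_shell F _ _))) k).const_mul _).add
  ((measurable_colInt_shear ((measurable_gradSq hh).indicator
    (measurableSet_tubeDom F δ R)) k).const_mul _)

theorem lintegral_rayBound_le (hh : ContDiff ℝ 1 h) (ℓ : ℝ) (k : F) :
    ∫⁻ w, rayBound h δ R ℓ k w ≤
      ENNReal.ofReal (2 / ℓ) * (∫⁻ y in shell F ℓ (4 * ℓ), colInt (sqVal h) y) +
      ENNReal.ofReal (4 * ℓ) * ∫⁻ x in tubeDom F δ R, gradSq h x := by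
  have hVi := (measurable_sqVal hh.continuous).indicator
    (MeasurableSet.univ.prod (measurableSet_shell F ℓ (4 * ℓ)) : MeasurableSet ((univ : Set ℝ) ×ˢ _))
  have hGi := (measurable_gradSq hh).indicator (measurableSet_tubeDom F δ R)
  simp only [rayBound]
  rw [lintegral_add_left ((measurable_colInt_shear hVi k).const_mul _),
    lintegral_const_mul _ (measurable_colInt_shear hVi k),
    lintegral_const_mul _ (measurable_colInt_shear hGi k), lintegral_colInt_shear hVi,
    lintegral_colInt_shear hGi]
  refine add_le_add (mul_le_mul' le_rfl ?_) (mul_le_mul' le_rfl ?_)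
  · rw [← lintegral_indicator (measurableSet_shell F _ _)]
    refine lintegral_mono fun y => ?_
    by_cases hy : y ∈ shell F ℓ (4 * ℓ)
    · rw [indicator_of_mem hy]
      exact lintegral_mono fun τ => indicator_le_self _ _ _
    · have : ∀ τ : ℝ, ((univ : Set ℝ) ×ˢ shell F ℓ (4 * ℓ)).indicator (sqVal h) (τ, y) = 0 :=
        fun τ => indicator_of_notMem (fun hm => hy hm.2) _
      simp [colInt, this]
  · rw [← setLIntegral_univ, setLIntegral_colInt hGi MeasurableSet.univ,
      ← lintegral_indicator (measurableSet_tubeDom F δ R)]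
    exact setLIntegral_le_lintegral _ _

end Wall

theorem setLIntegral_biUnion_finset_le {ι X : Type*} [MeasurableSpace X] {μ : Measure X}
    (t : Finset ι) (s : ι → Set X) (f : X → ℝ≥0∞) :
    ∫⁻ x in ⋃ k ∈ t, s k, f x ∂μ ≤ ∑ k ∈ t, ∫⁻ x in s k, f x ∂μ := by
  classical
  induction t using Finset.induction_on with
  | empty => simp
  | insert a t ha ih =>
    rw [Finset.set_biUnion_insert, Finset.sum_insert ha]
    exact (lintegral_union_le _ _ _).trans (add_le_add le_rfl ih)

section WallTotal
variable {F : Type*} [NormedAddCommGroup F] [InnerProductSpace ℝ F] [FiniteDimensional ℝ F]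
  [MeasurableSpace F] [BorelSpace F] {δ R : ℝ} {h : ℝ × F → ℝ}
  {X : Type*} [EMetricSpace X] [MeasurableSpace X] [BorelSpace X] {d : ℝ}

theorem setLIntegral_lower_wall_le (hd : 0 ≤ d) {c : ℝ≥0∞} (hc : (μH[d] : Measure F) = c • volume)
    {t : Finset F} (ht1 : ∀ k ∈ t, ‖k‖ = 1)
    (ht : ∀ y : F, y ≠ 0 → ∃ k ∈ t, ‖y‖ / 2 ≤ inner ℝ y k)
    (hh : ContDiff ℝ 1 h) (hδ : 0 < δ) {ℓ : ℝ} (hℓ : 0 < ℓ) (hℓ' : ℓ ≤ 1 / 8)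
    (hR : 4 * ℓ ≤ R) {Θ : X → ℝ × F} (hΘ : Continuous Θ) {B : Set X} (hB : MeasurableSet B)
    {K : ℝ≥0} (hK : ∀ z ∈ B, ∀ z' ∈ B, edist z z' ≤ K * edist (Θ z) (Θ z'))
    (hB0 : ∀ z ∈ B, tubeFun δ (Θ z) = 0) (hB1 : ∀ z ∈ B, (Θ z).1 ≤ 1 / 2)
    (hB2 : ∀ z ∈ B, ‖(Θ z).2‖ < 2 * ℓ) :
    ∫⁻ z in B, sqVal h (Θ z) ∂μH[d] ≤ t.card * (((K * 4 : ℝ≥0) : ℝ≥0∞) ^ d * (c *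
      (ENNReal.ofReal (2 / ℓ) * (∫⁻ y in shell F ℓ (4 * ℓ), colInt (sqVal h) y) +
      ENNReal.ofReal (4 * ℓ) * ∫⁻ x in tubeDom F δ R, gradSq h x))) := by
  set Bk : F → Set X := fun k => B ∩ {z | ‖(Θ z).2‖ / 2 ≤ inner ℝ (Θ z).2 k}
  have hcl : ∀ k, IsClosed {z | ‖(Θ z).2‖ / 2 ≤ inner ℝ (Θ z).2 k} := fun k =>
    isClosed_le (by fun_prop) (by fun_prop)
  have hsub : B ⊆ ⋃ k ∈ t, Bk k := by
    intro z hz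
    have hn := half_le_norm_of_tubeFun_nonpos hδ (τ := (Θ z).1) (y := (Θ z).2) (hB0 z hz).le
    obtain ⟨k, hk, hki⟩ := ht (Θ z).2 (norm_pos_iff.1 (by linarith))
    exact mem_iUnion₂.2 ⟨k, hk, hz, hki⟩
  have hpiece : ∀ k ∈ t, ∫⁻ z in Bk k, sqVal h (Θ z) ∂μH[d] ≤ ((K * 4 : ℝ≥0) : ℝ≥0∞) ^ d * (c *
      (ENNReal.ofReal (2 / ℓ) * (∫⁻ y in shell F ℓ (4 * ℓ), colInt (sqVal h) y) +
      ENNReal.ofReal (4 * ℓ) * ∫⁻ x in tubeDom F δ R, gradSq h x)) := by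
    intro k hk
    have hmem : ∀ z ∈ Bk k, Θ z ∈ wallPiece δ k := fun z hz => ⟨hB0 z hz.1, hB1 z hz.1, hz.2⟩
    have hBm : MeasurableSet (Bk k) := hB.inter (hcl k).measurableSet
    calc ∫⁻ z in Bk k, sqVal h (Θ z) ∂μH[d]
        ≤ ∫⁻ z in Bk k, rayBound h δ R ℓ k ((Θ z).2 - (Θ z).1 • k) ∂μH[d] :=
          setLIntegral_mono' hBm fun z hz =>
            sqVal_le_rayBound hh hδ hℓ hℓ' hR (ht1 k hk) (hmem z hz) (hB2 z hz.1)
      _ ≤ ((K * 4 : ℝ≥0) : ℝ≥0∞) ^ d * ∫⁻ w, rayBound h δ R ℓ k w ∂μH[d] := by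
          refine lintegral_comp_le_of_antilipschitzOn hd hBm (P := fun z => (Θ z).2 - (Θ z).1 • k)
            (by fun_prop) ?_ (measurable_rayBound hh ℓ k)
          intro z hz z' hz'
          refine (hK z hz.1 z' hz'.1).trans ?_
          rw [ENNReal.coe_mul, mul_assoc]
          refine mul_le_mul' le_rfl ?_
          have := dist_le_of_mem_wallPiece hδ (ht1 k hk) (hmem z hz) (hmem z' hz')
          rw [edist_dist, edist_dist]
          refine (ENNReal.ofReal_le_ofReal this).trans_eq ?_
          rw [ENNReal.ofReal_mul (by norm_num)]
          norm_num
      _ ≤ _ := by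
          refine mul_le_mul' le_rfl ?_
          rw [hc, lintegral_smul_measure, smul_eq_mul]
          exact mul_le_mul' le_rfl (lintegral_rayBound_le hh ℓ k)
  calc ∫⁻ z in B, sqVal h (Θ z) ∂μH[d] ≤ ∫⁻ z in ⋃ k ∈ t, Bk k, sqVal h (Θ z) ∂μH[d] :=
        lintegral_mono_set hsub
    _ ≤ ∑ k ∈ t, ∫⁻ z in Bk k, sqVal h (Θ z) ∂μH[d] := by
        exact setLIntegral_biUnion_finset_le t Bk _
    _ ≤ ∑ k ∈ t, _ := Finset.sum_le_sum hpiece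
    _ = _ := by rw [Finset.sum_const, nsmul_eq_mul]

/-- Reflection of the cylinder exchanging its two ends. -/
def reflect (x : ℝ × F) : ℝ × F := (1 - x.1, x.2)

theorem contDiff_reflect {n : WithTop ℕ∞} : ContDiff ℝ n (reflect (F := F)) :=
  (contDiff_const.sub contDiff_fst).prodMk contDiff_snd

theorem reflect_reflect (x : ℝ × F) : reflect (reflect x) = x := by simp [reflect]

theorem measurePreserving_reflect : MeasurePreserving (reflect (F := F)) volume volume := by
  rw [Measure.volume_eq_prod]
  exact (Measure.measurePreserving_sub_left volume (1 : ℝ)).prod (MeasurePreserving.id volume)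

theorem colInt_sqVal_reflect (h : ℝ × F → ℝ) :
    colInt (sqVal (h ∘ reflect)) = colInt (sqVal h) := by
  funext y
  have e : ∀ τ : ℝ, (Icc (0 : ℝ) 1).indicator (fun τ => sqVal (h ∘ reflect) (τ, y)) τ =
      (Icc (0 : ℝ) 1).indicator (fun τ => sqVal h (τ, y)) (1 - τ) := by
    intro τ
    by_cases hτ : τ ∈ Icc (0 : ℝ) 1
    · rw [indicator_of_mem hτ, indicator_of_mem
        (show 1 - τ ∈ Icc (0 : ℝ) 1 from ⟨by linarith [hτ.2], by linarith [hτ.1]⟩)]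
      rfl
    · rw [indicator_of_notMem hτ, indicator_of_notMem]
      exact fun hc => hτ ⟨by linarith [hc.2], by linarith [hc.1]⟩
  rw [colInt, colInt, ← lintegral_indicator measurableSet_Icc,
    ← lintegral_indicator measurableSet_Icc]
  simp_rw [e]
  exact lintegral_sub_left_eq_self _ 1

theorem gradSq_reflect_le (hh : ContDiff ℝ 1 h) (x : ℝ × F) :
    gradSq (h ∘ reflect) x ≤ gradSq h (reflect x) := by
  apply ENNReal.ofReal_le_ofReal
  gcongr
  have h1 : HasFDerivAt (reflect (F := F)) ((-ContinuousLinearMap.fst ℝ ℝ F).prod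
      (ContinuousLinearMap.snd ℝ ℝ F)) x :=
    (hasFDerivAt_fst.const_sub 1).prodMk hasFDerivAt_snd
  have h2 := (hh.differentiable (by simp) (reflect x)).hasFDerivAt
  rw [(h2.comp x h1).fderiv]
  refine (ContinuousLinearMap.opNorm_comp_le _ _).trans ?_
  refine mul_le_of_le_one_right (norm_nonneg _) ?_
  refine ContinuousLinearMap.opNorm_le_bound _ zero_le_one fun v => ?_
  simp [Prod.norm_def]

theorem setLIntegral_gradSq_reflect_le (hh : ContDiff ℝ 1 h) :
    ∫⁻ x in tubeDom F δ R, gradSq (h ∘ reflect) x ≤ ∫⁻ x in tubeDom F δ R, gradSq h x := by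
  have hpre : reflect ⁻¹' tubeDom F δ R = tubeDom F δ R := by
    ext x
    simp only [tubeDom, mem_preimage, mem_ofPred_eq, reflect]
    rw [tubeFun_reflect]
  refine (lintegral_mono fun x => gradSq_reflect_le hh x).trans_eq ?_
  have := measurePreserving_reflect.setLIntegral_comp_preimage (measurableSet_tubeDom F δ R)
    (measurable_gradSq hh)
  rw [hpre] at this
  exact this

/-- The size of the wall estimate. -/
noncomputable def wallConst (R ℓ : ℝ) : ℝ :=
  2 / ℓ * (shellConst R ℓ + shellConst R (2 * ℓ)) + 4 * ℓ

theorem shellConst_nonneg {r : ℝ} (hr : 0 < r) (hR : 2 * r ≤ R) : 0 ≤ shellConst R r := by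
  have : 0 ≤ Real.log (R / (2 * r)) :=
    Real.log_nonneg (by rw [le_div_iff₀ (by positivity)]; linarith)
  unfold shellConst; positivity

/-- The integral of the square of a function over the part of the wall near the axis is controlled
by its boundary values at the bottom of the cylinder and its energy. -/
theorem setLIntegral_wall_le (hF : 2 ≤ Module.finrank ℝ F) (hd : 0 ≤ d) {c : ℝ≥0∞}
    (hc : (μH[d] : Measure F) = c • volume)
    {t : Finset F} (ht1 : ∀ k ∈ t, ‖k‖ = 1)
    (ht : ∀ y : F, y ≠ 0 → ∃ k ∈ t, ‖y‖ / 2 ≤ inner ℝ y k)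
    (hh : ContDiff ℝ 1 h) (hδ : 0 < δ) {ℓ : ℝ} (hδℓ : δ ≤ ℓ) (hℓ' : ℓ ≤ 1 / 8)
    (hR : 4 * ℓ ≤ R) {Θ : X → ℝ × F} (hΘ : Continuous Θ) {B : Set X} (hB : MeasurableSet B)
    {K : ℝ≥0} (hK : ∀ z ∈ B, ∀ z' ∈ B, edist z z' ≤ K * edist (Θ z) (Θ z'))
    (hB0 : ∀ z ∈ B, tubeFun δ (Θ z) = 0) (hBR : ∀ z ∈ B, ‖(Θ z).2‖ < 2 * ℓ) :
    ∫⁻ z in B, sqVal h (Θ z) ∂μH[d] ≤ 2 * (t.card * (((K * 4 : ℝ≥0) : ℝ≥0∞) ^ d * (c *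
      (ENNReal.ofReal (wallConst R ℓ) *
        ((∫⁻ y in shell F δ R, sqVal h (0, y)) + ∫⁻ x in tubeDom F δ R, gradSq h x))))) := by
  have hℓ : 0 < ℓ := hδ.trans_le hδℓ
  set X' := (∫⁻ y in shell F δ R, sqVal h (0, y)) + ∫⁻ x in tubeDom F δ R, gradSq h x with hX'
  have hshell : ∫⁻ y in shell F ℓ (4 * ℓ), colInt (sqVal h) y ≤
      ENNReal.ofReal (shellConst R ℓ + shellConst R (2 * ℓ)) * X' := by
    have hsub : shell F ℓ (4 * ℓ) ⊆ shell F ℓ (2 * ℓ) ∪ shell F (2 * ℓ) (2 * (2 * ℓ)) := by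
      rintro y ⟨h1, h2⟩
      rcases lt_or_ge ‖y‖ (2 * ℓ) with h3 | h3
      · exact Or.inl ⟨h1, h3⟩
      · exact Or.inr ⟨h3, by linarith⟩
    calc _ ≤ _ := lintegral_mono_set hsub
      _ ≤ (∫⁻ y in shell F ℓ (2 * ℓ), colInt (sqVal h) y) +
          ∫⁻ y in shell F (2 * ℓ) (2 * (2 * ℓ)), colInt (sqVal h) y := lintegral_union_le _ _ _
      _ ≤ ENNReal.ofReal (shellConst R ℓ) * X' + ENNReal.ofReal (shellConst R (2 * ℓ)) * X' :=
          add_le_add (setLIntegral_shell_sqVal_le hF hh hδ hδℓ (by linarith))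
            (setLIntegral_shell_sqVal_le hF hh hδ (by linarith) (by linarith))
      _ = _ := by
          rw [← add_mul, ENNReal.ofReal_add (shellConst_nonneg hℓ (by linarith))
            (shellConst_nonneg (by linarith) (by linarith))]
  have hbound : ENNReal.ofReal (2 / ℓ) * (∫⁻ y in shell F ℓ (4 * ℓ), colInt (sqVal h) y) +
      ENNReal.ofReal (4 * ℓ) * ∫⁻ x in tubeDom F δ R, gradSq h x ≤
      ENNReal.ofReal (wallConst R ℓ) * X' := by
    have hs := add_nonneg (shellConst_nonneg (R := R) hℓ (by linarith))
      (shellConst_nonneg (R := R) (r := 2 * ℓ) (by linarith) (by linarith))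
    calc _ ≤ ENNReal.ofReal (2 / ℓ) * (ENNReal.ofReal (shellConst R ℓ + shellConst R (2 * ℓ)) * X') +
          ENNReal.ofReal (4 * ℓ) * X' :=
          add_le_add (mul_le_mul' le_rfl hshell) (mul_le_mul' le_rfl le_add_self)
      _ = _ := by
          rw [← mul_assoc, ← ENNReal.ofReal_mul (by positivity), ← add_mul,
            ← ENNReal.ofReal_add (by positivity) (by positivity)]
          rfl
  set B1 := B ∩ {z | (Θ z).1 ≤ 1 / 2} with hB1
  set B2 := B ∩ {z | 1 / 2 ≤ (Θ z).1} with hB2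
  have hm1 : MeasurableSet B1 :=
    hB.inter (isClosed_le (by fun_prop) continuous_const).measurableSet
  have hm2 : MeasurableSet B2 :=
    hB.inter (isClosed_le continuous_const (by fun_prop)).measurableSet
  have hlow := setLIntegral_lower_wall_le hd hc ht1 ht hh hδ hℓ hℓ' hR hΘ hm1
    (fun z hz z' hz' => hK z hz.1 z' hz'.1) (fun z hz => hB0 z hz.1) (fun z hz => hz.2)
    (fun z hz => hBR z hz.1)
  have hrc : Continuous (reflect (F := F)) := (contDiff_reflect (n := 0)).continuous
  have hup := setLIntegral_lower_wall_le hd hc ht1 ht (h := h ∘ reflect)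
    (hh.comp contDiff_reflect) hδ hℓ hℓ' hR (Θ := reflect ∘ Θ)
    (hrc.comp hΘ) hm2 (K := K)
    (fun z hz z' hz' => by
      refine (hK z hz.1 z' hz'.1).trans_eq ?_
      simp [reflect, Prod.edist_eq])
    (fun z hz => (tubeFun_reflect δ (Θ z)).trans (hB0 z hz.1))
    (fun z hz => by
      have : 1 / 2 ≤ (Θ z).1 := hz.2
      simp only [Function.comp, reflect]; linarith)
    (fun z hz => hBR z hz.1)
  have hupV : ∀ z, sqVal (h ∘ reflect) ((reflect ∘ Θ) z) = sqVal h (Θ z) := fun z => by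
    simp [sqVal, reflect_reflect]
  simp_rw [hupV] at hup
  rw [colInt_sqVal_reflect] at hup
  have hcover : B ⊆ B1 ∪ B2 := fun z hz => (le_total (Θ z).1 (1 / 2)).imp (⟨hz, ·⟩) (⟨hz, ·⟩)
  calc _ ≤ _ := lintegral_mono_set hcover
    _ ≤ (∫⁻ z in B1, sqVal h (Θ z) ∂μH[d]) + ∫⁻ z in B2, sqVal h (Θ z) ∂μH[d] :=
        lintegral_union_le _ _ _
    _ ≤ _ := by
        rw [two_mul]
        refine add_le_add (hlow.trans ?_) (hup.trans ?_)
        · gcongr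
        · have := setLIntegral_gradSq_reflect_le (δ := δ) (R := R) hh
          refine mul_le_mul' le_rfl (mul_le_mul' le_rfl (mul_le_mul' le_rfl (le_trans ?_ hbound)))
          gcongr

end WallTotal

section Cutoff
variable {F : Type*} [NormedAddCommGroup F] [InnerProductSpace ℝ F] [FiniteDimensional ℝ F]
  [MeasurableSpace F] [BorelSpace F]

/-- A smooth function rising from `0` at `‖y‖ = r` to `1` at `‖y‖ = 2 * r`. -/
noncomputable def radialStep (r : ℝ) (y : F) : ℝ := Real.smoothTransition ((‖y‖ ^ 2 / r ^ 2 - 1) / 3)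

theorem contDiff_radialStep (r : ℝ) {n : ℕ∞} : ContDiff ℝ n (radialStep (F := F) r) :=
  Real.smoothTransition.contDiff.comp
    ((((contDiff_norm_sq ℝ).div_const _).sub contDiff_const).div_const _)

theorem radialStep_nonneg (r : ℝ) (y : F) : 0 ≤ radialStep r y := Real.smoothTransition.nonneg _

theorem radialStep_le_one (r : ℝ) (y : F) : radialStep r y ≤ 1 := Real.smoothTransition.le_one _

theorem radialStep_eq_zero {r : ℝ} (hr : 0 < r) {y : F} (hy : ‖y‖ ≤ r) : radialStep r y = 0 := by
  apply Real.smoothTransition.zero_of_nonpos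
  have : ‖y‖ ^ 2 / r ^ 2 ≤ 1 := by
    rw [div_le_one (by positivity)]
    exact pow_le_pow_left₀ (norm_nonneg _) hy 2
  linarith

theorem radialStep_eq_one {r : ℝ} (hr : 0 < r) {y : F} (hy : 2 * r ≤ ‖y‖) : radialStep r y = 1 := by
  apply Real.smoothTransition.one_of_one_le
  have : 4 ≤ ‖y‖ ^ 2 / r ^ 2 := by
    rw [le_div_iff₀ (by positivity)]
    nlinarith
  linarith

theorem fderiv_eq_zero_of_eq_one {E : Type*} [NormedAddCommGroup E] [NormedSpace ℝ E] {f : E → ℝ}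
    (h : ∀ x, f x ≤ 1) {x : E} (hx : f x = 1) : fderiv ℝ f x = 0 :=
  IsLocalMax.fderiv_eq_zero (Eventually.of_forall fun y => by rw [hx]; exact h y)

theorem fderiv_eq_zero_of_eq_zero {E : Type*} [NormedAddCommGroup E] [NormedSpace ℝ E] {f : E → ℝ}
    (h : ∀ x, 0 ≤ f x) {x : E} (hx : f x = 0) : fderiv ℝ f x = 0 :=
  IsLocalMin.fderiv_eq_zero (Eventually.of_forall fun y => by rw [hx]; exact h y)

theorem mem_shell_of_fderiv_radialStep_ne_zero {r : ℝ} (hr : 0 < r) {y : F}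
    (h : fderiv ℝ (radialStep r) y ≠ 0) : y ∈ shell F r (2 * r) := by
  constructor
  · by_contra! hc
    exact h (fderiv_eq_zero_of_eq_zero (radialStep_nonneg r) (radialStep_eq_zero hr hc.le))
  · by_contra! hc
    exact h (fderiv_eq_zero_of_eq_one (radialStep_le_one r) (radialStep_eq_one hr hc))

theorem exists_deriv_smoothTransition_le :
    ∃ L : ℝ, 0 ≤ L ∧ ∀ t, |deriv Real.smoothTransition t| ≤ L := by
  have hc : Continuous (deriv Real.smoothTransition) :=
    (Real.smoothTransition.contDiff (n := 1)).continuous_deriv le_rfl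
  obtain ⟨L, hL⟩ := (isCompact_Icc (a := (0 : ℝ)) (b := 1)).exists_bound_of_continuousOn
    hc.continuousOn
  refine ⟨L, (norm_nonneg _).trans (hL 0 (by simp)), fun t => ?_⟩
  have hL0 : 0 ≤ L := (norm_nonneg _).trans (hL 0 (by simp))
  by_cases ht : t ∈ Icc (0 : ℝ) 1
  · exact hL t ht
  · have : deriv Real.smoothTransition t = 0 := by
      rw [← fderiv_apply_one_eq_deriv]
      rcases lt_or_ge t 0 with h0 | h0
      · rw [fderiv_eq_zero_of_eq_zero Real.smoothTransition.nonneg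
          (Real.smoothTransition.zero_of_nonpos h0.le)]; rfl
      · rw [fderiv_eq_zero_of_eq_one Real.smoothTransition.le_one
          (Real.smoothTransition.one_of_one_le (by by_contra! hc; exact ht ⟨h0, hc.le⟩))]; rfl
    simpa [this] using hL0

theorem norm_fderiv_radialStep_le {L : ℝ} (hL : ∀ t, |deriv Real.smoothTransition t| ≤ L)
    {r : ℝ} (hr : 0 < r) (y : F) : ‖fderiv ℝ (radialStep r) y‖ ≤ 2 * L / r := by
  have hL0 : 0 ≤ L := (abs_nonneg _).trans (hL 0)
  by_cases h : fderiv ℝ (radialStep r) y = 0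
  · rw [h, norm_zero]; positivity
  have hy := (mem_shell_of_fderiv_radialStep_ne_zero hr h).2.le
  have h1 : HasFDerivAt (fun y : F => (‖y‖ ^ 2 / r ^ 2 - 1) / 3)
      ((1 / (3 * r ^ 2)) • (2 • innerSL ℝ y)) y := by
    have := ((((hasStrictFDerivAt_norm_sq y).hasFDerivAt.mul_const (1 / r ^ 2)).sub_const 1).mul_const
      (1 / 3))
    have e1 : (fun y : F => (‖y‖ ^ 2 / r ^ 2 - 1) / 3) =
        fun y => (‖y‖ ^ 2 * (1 / r ^ 2) - 1) * (1 / 3) := by funext z; ring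
    have e2 : (1 / (3 * r ^ 2)) • (2 • innerSL ℝ y) =
        (1 / 3 : ℝ) • (1 / r ^ 2) • (2 • innerSL ℝ y) := by
      rw [smul_smul]; congr 1; field_simp
    rw [e1, e2]
    exact this
  have h2 := ((Real.smoothTransition.contDiff (n := 1)).differentiable (by simp)
    ((‖y‖ ^ 2 / r ^ 2 - 1) / 3)).hasDerivAt
  have h3 : HasFDerivAt (radialStep r) _ y := h2.comp_hasFDerivAt y h1
  rw [h3.fderiv, norm_smul, norm_smul]
  have h4 : ‖(2 • innerSL ℝ y : F →L[ℝ] ℝ)‖ ≤ 4 * r := by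
    refine ContinuousLinearMap.opNorm_le_bound _ (by positivity) fun v => ?_
    have := abs_real_inner_le_norm y v
    simp only [_root_.smul_apply, innerSL_apply_apply, nsmul_eq_mul, Nat.cast_ofNat,
      norm_mul, Real.norm_ofNat, Real.norm_eq_abs]
    nlinarith [norm_nonneg v, norm_nonneg y]
  calc _ ≤ L * (‖(1 / (3 * r ^ 2))‖ * (4 * r)) :=
        mul_le_mul (hL _) (mul_le_mul_of_nonneg_left h4 (norm_nonneg _)) (by positivity) hL0
    _ = (4 / 3) * L / r := by
        rw [Real.norm_of_nonneg (by positivity)]; field_simp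
    _ ≤ _ := by gcongr; norm_num

set_option maxHeartbeats 1000000 in
/-- A logarithmic cutoff with small capacity relative to the boundary values and the energy. -/
theorem exists_cutoff (hF : 2 ≤ Module.finrank ℝ F) {R ρ : ℝ} (hρ : 0 < ρ) (hρR : ρ ≤ R) {η : ℝ}
    (hη : 0 < η) : ∃ r₀ : ℝ, 0 < r₀ ∧ r₀ ≤ ρ ∧ ∃ χ : F → ℝ, ContDiff ℝ (⊤ : ℕ∞) χ ∧
      (∀ y, 0 ≤ χ y) ∧ (∀ y, χ y ≤ 1) ∧ (∀ y, ‖y‖ ≤ r₀ → χ y = 0) ∧ (∀ y, ρ ≤ ‖y‖ → χ y = 1) ∧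
      ∀ δ, 0 < δ → δ ≤ r₀ → ∀ h : ℝ × F → ℝ, ContDiff ℝ 1 h →
        ∫⁻ y, colInt (sqVal h) y * ENNReal.ofReal (‖fderiv ℝ χ y‖ ^ 2) ≤ ENNReal.ofReal η *
          ((∫⁻ y in shell F δ R, sqVal h (0, y)) + ∫⁻ x in tubeDom F δ R, gradSq h x) := by
  obtain ⟨L, hL0, hL⟩ := exists_deriv_smoothTransition_le
  set A : ℝ := 16 / R ^ 2 + 8 * |Real.log (R / (2 * ρ))| + 8 with hA
  have hA0 : 0 < A := by positivity
  obtain ⟨N, hN0, hN⟩ := ((eventually_ge_atTop 1).and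
    (Real.tendsto_sum_range_one_div_nat_succ_atTop.eventually_ge_atTop
      (max 1 (4 * L ^ 2 * A / η)))).exists
  set S : ℝ := ∑ i ∈ Finset.range N, 1 / ((i : ℝ) + 1) with hS
  have hS0 : 0 < S := zero_lt_one.trans_le ((le_max_left _ _).trans hN)
  set r : ℕ → ℝ := fun i => ρ * (1 / 2) ^ (i + 1) with hr
  have hr0 : ∀ i, 0 < r i := fun i => by positivity
  have hr2 : ∀ i, 2 * r i = ρ * (1 / 2) ^ i := fun i => by simp only [hr, pow_succ]; ring
  have hranti : ∀ {i j : ℕ}, i < j → 2 * r j ≤ r i := fun {i j} hij => by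
    rw [hr2]
    exact mul_le_mul_of_nonneg_left (pow_le_pow_of_le_one (by norm_num) (by norm_num) hij) hρ.le
  have hrρ : ∀ i, 2 * r i ≤ ρ := fun i => by
    rw [hr2]; exact mul_le_of_le_one_right hρ.le (pow_le_one₀ (by norm_num) (by norm_num))
  set c : ℕ → ℝ := fun i => 1 / ((i : ℝ) + 1) / S with hc
  have hc0 : ∀ i, 0 ≤ c i := fun i => by positivity
  have hcsum : ∑ i ∈ Finset.range N, c i = 1 := by
    rw [← Finset.sum_div]; exact div_self hS0.ne'
  set χ : F → ℝ := fun y => ∑ i ∈ Finset.range N, c i * radialStep (r i) y with hχ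
  have hd : ∀ y, fderiv ℝ χ y = ∑ i ∈ Finset.range N, c i • fderiv ℝ (radialStep (r i)) y := by
    intro y
    refine (HasFDerivAt.fun_sum fun i _ => ?_).fderiv
    exact (((contDiff_radialStep (r i) (n := 1)).differentiable (by simp) y).hasFDerivAt).const_mul _
  refine ⟨r N, hr0 N, by linarith [hrρ N, hr0 N], χ, ?_, ?_, ?_, ?_, ?_, ?_⟩
  · exact ContDiff.sum fun i _ => contDiff_const.mul (contDiff_radialStep (r i) (n := ⊤))
  · exact fun y => Finset.sum_nonneg fun i _ => mul_nonneg (hc0 i) (radialStep_nonneg _ _)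
  · intro y
    rw [← hcsum]
    exact Finset.sum_le_sum fun i _ => mul_le_of_le_one_right (hc0 i) (radialStep_le_one _ _)
  · intro y hy
    refine Finset.sum_eq_zero fun i hi => ?_
    have := hranti (Finset.mem_range.1 hi)
    rw [radialStep_eq_zero (hr0 i) (by linarith [hr0 N]), mul_zero]
  · intro y hy
    simp only [hχ]
    rw [← hcsum]
    refine Finset.sum_congr rfl fun i hi => ?_
    rw [radialStep_eq_one (hr0 i) (by linarith [hrρ i]), mul_one]
  intro δ hδ hδr h hh
  set X := (∫⁻ y in shell F δ R, sqVal h (0, y)) + ∫⁻ x in tubeDom F δ R, gradSq h x with hX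
  have hmeas := measurable_colInt (measurable_sqVal hh.continuous)
  have hpt : ∀ y, colInt (sqVal h) y * ENNReal.ofReal (‖fderiv ℝ χ y‖ ^ 2) ≤
      ∑ i ∈ Finset.range N, ENNReal.ofReal ((c i * (2 * L / r i)) ^ 2) *
        (shell F (r i) (2 * r i)).indicator (colInt (sqVal h)) y := by
    intro y
    by_cases hy : fderiv ℝ χ y = 0
    · simp [hy]
    rw [hd] at hy
    obtain ⟨i, hi, hne⟩ := Finset.exists_ne_zero_of_sum_ne_zero hy
    have hne' : fderiv ℝ (radialStep (r i)) y ≠ 0 := fun h0 => hne (by rw [h0, smul_zero])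
    have hmem := mem_shell_of_fderiv_radialStep_ne_zero (hr0 i) hne'
    have hsingle : fderiv ℝ χ y = c i • fderiv ℝ (radialStep (r i)) y := by
      rw [hd]
      refine Finset.sum_eq_single_of_mem i hi fun j _ hji => ?_
      by_contra hne2
      have hmem2 := mem_shell_of_fderiv_radialStep_ne_zero (hr0 j)
        (fun h0 => hne2 (by rw [h0, smul_zero]))
      have h1 := hmem.1; have h2 := hmem.2; have h3 := hmem2.1; have h4 := hmem2.2
      rcases lt_or_gt_of_ne hji with hlt | hlt
      · have := hranti hlt; linarith
      · have := hranti hlt; linarith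
    refine le_trans ?_ (Finset.single_le_sum (f := fun i =>
      ENNReal.ofReal ((c i * (2 * L / r i)) ^ 2) *
        (shell F (r i) (2 * r i)).indicator (colInt (sqVal h)) y) (fun _ _ => bot_le) hi)
    rw [indicator_of_mem hmem, mul_comm, hsingle, norm_smul, Real.norm_of_nonneg (hc0 i)]
    exact mul_le_mul' (ENNReal.ofReal_le_ofReal (pow_le_pow_left₀
      (mul_nonneg (hc0 i) (norm_nonneg _)) (mul_le_mul_of_nonneg_left
        (norm_fderiv_radialStep_le hL (hr0 i) y) (hc0 i)) 2)) le_rfl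
  calc _ ≤ _ := lintegral_mono hpt
    _ = ∑ i ∈ Finset.range N, ENNReal.ofReal ((c i * (2 * L / r i)) ^ 2) *
        ∫⁻ y in shell F (r i) (2 * r i), colInt (sqVal h) y := by
        rw [lintegral_finsetSum' _ (fun i _ => ((hmeas.indicator
          (measurableSet_shell F _ _)).const_mul _).aemeasurable)]
        refine Finset.sum_congr rfl fun i _ => ?_
        rw [lintegral_const_mul _ (hmeas.indicator (measurableSet_shell F _ _)),
          lintegral_indicator (measurableSet_shell F _ _)]
    _ ≤ ∑ i ∈ Finset.range N, ENNReal.ofReal (4 * L ^ 2 * A / S ^ 2 * (1 / ((i : ℝ) + 1))) * X := by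
        refine Finset.sum_le_sum fun i hi => ?_
        have hδi : δ ≤ r i := by
          have := hranti (Finset.mem_range.1 hi); linarith [hr0 N]
        refine (mul_le_mul' le_rfl (setLIntegral_shell_sqVal_le hF hh hδ hδi
          ((hrρ i).trans hρR))).trans ?_
        rw [← mul_assoc, ← ENNReal.ofReal_mul (by positivity)]
        refine mul_le_mul' (ENNReal.ofReal_le_ofReal ?_) le_rfl
        have hlog : Real.log (R / (2 * r i)) ≤ |Real.log (R / (2 * ρ))| + (i + 1) := by
          have e : R / (2 * r i) = R / (2 * ρ) * 2 ^ (i + 1) := by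
            simp only [hr, one_div, inv_pow]; field_simp
          have hR0 : 0 < R := hρ.trans_le hρR
          rw [e, Real.log_mul (by positivity) (by positivity), Real.log_pow]
          have := le_abs_self (Real.log (R / (2 * ρ)))
          have h2 : Real.log 2 ≤ 1 := by linarith [Real.log_two_lt_d9]
          push_cast
          nlinarith
        have hs : shellConst R (r i) ≤ A * (i + 1) * r i ^ 2 := by
          unfold shellConst
          gcongr
          have : (1 : ℝ) ≤ i + 1 := by linarith [(Nat.cast_nonneg i : (0 : ℝ) ≤ i)]
          have h3 : 16 / R ^ 2 + 8 * |Real.log (R / (2 * ρ))| ≤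
              (16 / R ^ 2 + 8 * |Real.log (R / (2 * ρ))|) * (i + 1) :=
            le_mul_of_one_le_right (by positivity) this
          rw [hA]; linarith
        calc _ ≤ (c i * (2 * L / r i)) ^ 2 * (A * (i + 1) * r i ^ 2) := by gcongr
          _ = _ := by
            have := (hr0 i).ne'
            simp only [hc]; field_simp; ring
    _ = ENNReal.ofReal (4 * L ^ 2 * A / S) * X := by
        rw [← Finset.sum_mul, ← ENNReal.ofReal_sum_of_nonneg (fun i _ => by positivity),
          ← Finset.mul_sum]
        congr 2
        rw [← hS]; field_simp
    _ ≤ _ := by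
        refine mul_le_mul' (ENNReal.ofReal_le_ofReal ?_) le_rfl
        have := (le_max_right _ _).trans hN
        rw [div_le_iff₀ hS0]
        rw [div_le_iff₀ hη] at this
        linarith

end Cutoff

section RelClopens
variable {X : Type*} [TopologicalSpace X] {Z Z' A N K : Set X}

/-- The relatively clopen subsets of a set. -/
def relClopens (Z : Set X) : Set (Set X) :=
  {A | A ⊆ Z ∧ (∃ U, IsOpen U ∧ A = Z ∩ U) ∧ ∃ V, IsOpen V ∧ Z \ A = Z ∩ V}

theorem diff_mem_relClopens (hA : A ∈ relClopens Z) : Z \ A ∈ relClopens Z :=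
  ⟨sdiff_subset, hA.2.2, by rw [sdiff_sdiff_cancel_left hA.1]; exact hA.2.1⟩

theorem disjoint_or_subset_of_mem_relClopens (hA : A ∈ relClopens Z) {S : Set X} (hSZ : S ⊆ Z)
    (hS : IsPreconnected S) : Disjoint S A ∨ S ⊆ A := by
  obtain ⟨hAZ, ⟨U, hU, hAU⟩, V, hV, hAV⟩ := hA
  have hcov : S ⊆ U ∪ V := fun z hz => by
    by_cases hzA : z ∈ A
    · exact Or.inl (hAU ▸ hzA : z ∈ Z ∩ U).2
    · exact Or.inr (hAV ▸ (⟨hSZ hz, hzA⟩ : z ∈ Z \ A) : z ∈ Z ∩ V).2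
  have hdisj : S ∩ (U ∩ V) = ∅ := by
    rw [eq_empty_iff_forall_notMem]
    rintro z ⟨hz, hzU, hzV⟩
    have h1 : z ∈ A := by rw [hAU]; exact ⟨hSZ hz, hzU⟩
    have h2 : z ∈ Z \ A := by rw [hAV]; exact ⟨hSZ hz, hzV⟩
    exact h2.2 h1
  rcases isPreconnected_iff_subset_of_disjoint.1 hS U V hU hV hcov hdisj with h | h
  · right; rw [hAU]; exact fun z hz => ⟨hSZ hz, h hz⟩
  · left
    rw [Set.disjoint_left]
    intro z hz
    have : z ∈ Z \ A := by rw [hAV]; exact ⟨hSZ hz, h hz⟩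
    exact this.2

theorem isPreconnected_of_relClopens (h : ∀ A ∈ relClopens Z, A = ∅ ∨ A = Z) :
    IsPreconnected Z := by
  rw [isPreconnected_iff_subset_of_disjoint]
  intro U V hU hV hcov hdisj
  have hd : Z \ (Z ∩ U) = Z ∩ V := by
    ext z
    constructor
    · rintro ⟨hz, hzU⟩
      exact ⟨hz, (hcov hz).resolve_left fun h => hzU ⟨hz, h⟩⟩
    · rintro ⟨hz, hzV⟩
      exact ⟨hz, fun h => (eq_empty_iff_forall_notMem.1 hdisj z) ⟨hz, h.2, hzV⟩⟩
  rcases h (Z ∩ U) ⟨inter_subset_left, ⟨U, hU, rfl⟩, V, hV, hd⟩ with h | h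
  · right
    rw [h, sdiff_empty] at hd
    rw [hd]; exact inter_subset_right
  · left; rw [← h]; exact inter_subset_right

open Classical in
/-- Transfer of a relatively clopen set across a modification supported in `K ⊆ N`. -/
noncomputable def extendClopen (Z N K A : Set X) : Set X :=
  A \ K ∪ if (A ∩ N).Nonempty then Z ∩ N else ∅

theorem diff_mem_relClopens_of_inter_eq_empty (hN : IsOpen N) (hK : IsClosed K) (hKN : K ⊆ N)
    (hZ : Z \ K = Z' \ K)
    (hA : A ∈ relClopens Z') (hAN : A ∩ N = ∅) :
    A \ K ∈ relClopens Z := by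
  obtain ⟨hAZ, ⟨U, hU, hAU⟩, V, hV, hAV⟩ := hA
  have key : ∀ z, z ∉ K → (z ∈ Z ↔ z ∈ Z') := fun z hz =>
    ⟨fun h => (hZ ▸ (⟨h, hz⟩ : z ∈ Z \ K) : z ∈ Z' \ K).1,
      fun h => (hZ ▸ (⟨h, hz⟩ : z ∈ Z' \ K) : z ∈ Z \ K).1⟩
  have hA' : ∀ z, z ∈ A ↔ z ∈ Z' ∧ z ∈ U := fun z => by rw [hAU]; rfl
  have hV' : ∀ z, (z ∈ Z' ∧ z ∉ A) ↔ z ∈ Z' ∧ z ∈ V := fun z => by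
    have : z ∈ Z' \ A ↔ z ∈ Z' ∩ V := by rw [hAV]
    exact this
  have hAN' : ∀ z, z ∈ A → z ∉ N := fun z h h' => (eq_empty_iff_forall_notMem.1 hAN z) ⟨h, h'⟩
  refine ⟨fun z hz => (key z hz.2).2 (hAZ hz.1), ⟨U \ K, hU.sdiff hK, ?_⟩,
    (V \ K) ∪ N, (hV.sdiff hK).union hN, ?_⟩
  · ext z
    have := key z; have := hA' z
    simp only [Set.mem_sdiff, mem_inter_iff]; tauto
  · ext z
    have h1 := key z; have h2 := hV' z; have h3 := hAN' z; have h4 := @hKN z; have h5 := @hAZ z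
    simp only [Set.mem_sdiff, mem_inter_iff, mem_union]; tauto

theorem extendClopen_diff (hN : IsOpen N) (hK : IsClosed K) (hKN : K ⊆ N)
    (hZ : Z \ K = Z' \ K) (hpre : IsPreconnected (Z' ∩ N)) (hne' : (Z' ∩ N).Nonempty)
    (hA : A ∈ relClopens Z') :
    extendClopen Z N K (Z' \ A) = Z \ extendClopen Z N K A := by
  obtain ⟨w, hw, hwN⟩ := hne'
  have key : ∀ z, z ∉ K → (z ∈ Z ↔ z ∈ Z') := fun z hz =>
    ⟨fun h => (hZ ▸ (⟨h, hz⟩ : z ∈ Z \ K) : z ∈ Z' \ K).1,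
      fun h => (hZ ▸ (⟨h, hz⟩ : z ∈ Z' \ K) : z ∈ Z \ K).1⟩
  rcases disjoint_or_subset_of_mem_relClopens hA inter_subset_left hpre with h | h
  · have h1 : ¬ (A ∩ N).Nonempty := fun ⟨z, hz, hzN⟩ =>
      Set.disjoint_left.1 h ⟨hA.1 hz, hzN⟩ hz
    have h2 : ((Z' \ A) ∩ N).Nonempty :=
      ⟨w, ⟨hw, fun hc => h1 ⟨w, hc, hwN⟩⟩, hwN⟩
    rw [extendClopen, extendClopen, if_neg h1, if_pos h2]
    ext z
    have a1 := key z; have a2 := @hKN z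
    have a3 : z ∈ A → z ∉ N := fun h h' => h1 ⟨z, h, h'⟩
    simp only [Set.mem_sdiff, mem_inter_iff, mem_union, mem_empty_iff_false, or_false]; tauto
  · have h1 : (A ∩ N).Nonempty := ⟨w, h ⟨hw, hwN⟩, hwN⟩
    have h2 : ¬ ((Z' \ A) ∩ N).Nonempty := fun ⟨z, hz, hzN⟩ => hz.2 (h ⟨hz.1, hzN⟩)
    rw [extendClopen, extendClopen, if_pos h1, if_neg h2]
    ext z
    have a1 := key z; have a2 := @hKN z
    have a3 : z ∈ Z' → z ∈ N → z ∈ A := fun h' h'' => h ⟨h', h''⟩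
    simp only [Set.mem_sdiff, mem_inter_iff, mem_union, mem_empty_iff_false, or_false]; tauto

theorem extendClopen_mem_relClopens (hN : IsOpen N) (hK : IsClosed K) (hKN : K ⊆ N)
    (hZ : Z \ K = Z' \ K) (hpre : IsPreconnected (Z' ∩ N)) (hne' : (Z' ∩ N).Nonempty)
    (hA : A ∈ relClopens Z') :
    extendClopen Z N K A ∈ relClopens Z := by
  by_cases h : (A ∩ N).Nonempty
  · have h2 : (Z' \ A) ∩ N = ∅ := by
      rcases disjoint_or_subset_of_mem_relClopens hA inter_subset_left hpre with h' | h'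
      · obtain ⟨z, hz, hzN⟩ := h
        exact absurd hz (Set.disjoint_left.1 h' ⟨hA.1 hz, hzN⟩)
      · rw [eq_empty_iff_forall_notMem]
        exact fun z hz => hz.1.2 (h' ⟨hz.1.1, hz.2⟩)
    have h3 := diff_mem_relClopens_of_inter_eq_empty hN hK hKN hZ (diff_mem_relClopens hA) h2
    have h4 := extendClopen_diff hN hK hKN hZ hpre hne' (diff_mem_relClopens hA)
    rw [sdiff_sdiff_cancel_left hA.1] at h4
    rw [h4]
    apply diff_mem_relClopens
    rw [extendClopen, if_neg (by rw [h2]; simp), union_empty]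
    exact h3
  · rw [extendClopen, if_neg h, union_empty]
    exact diff_mem_relClopens_of_inter_eq_empty hN hK hKN hZ hA (not_nonempty_iff_eq_empty.1 h)

theorem injOn_extendClopen (hN : IsOpen N) (hK : IsClosed K) (hKN : K ⊆ N)
    (hZ : Z \ K = Z' \ K) (hpre : IsPreconnected (Z' ∩ N)) (hne' : (Z' ∩ N).Nonempty)
    (hne : (Z ∩ N).Nonempty) :
    InjOn (extendClopen Z N K) (relClopens Z') := by
  obtain ⟨w, hw, hwN⟩ := hne
  have claim : ∀ A ∈ relClopens Z', w ∈ extendClopen Z N K A ↔ (A ∩ N).Nonempty := by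
    intro A hA
    by_cases h : (A ∩ N).Nonempty
    · rw [extendClopen, if_pos h]; exact ⟨fun _ => h, fun _ => Or.inr ⟨hw, hwN⟩⟩
    · rw [extendClopen, if_neg h]
      simp only [union_empty, h, iff_false]
      exact fun hc => h ⟨w, hc.1, hwN⟩
  have main : ∀ A ∈ relClopens Z', ∀ B ∈ relClopens Z',
      extendClopen Z N K A = extendClopen Z N K B → A ⊆ B := by
    intro A hA B hB hAB z hz
    have hiff : (A ∩ N).Nonempty ↔ (B ∩ N).Nonempty := by
      rw [← claim A hA, ← claim B hB, hAB]
    by_cases hzN : z ∈ N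
    · rcases disjoint_or_subset_of_mem_relClopens hB inter_subset_left hpre with h | h
      · obtain ⟨v, hv, hvN⟩ := hiff.1 ⟨z, hz, hzN⟩
        exact absurd hv (Set.disjoint_left.1 h ⟨hB.1 hv, hvN⟩)
      · exact h ⟨hA.1 hz, hzN⟩
    · have h1 : z ∈ extendClopen Z N K A := Or.inl ⟨hz, fun h => hzN (hKN h)⟩
      rw [hAB] at h1
      rcases h1 with h1 | h1
      · exact h1.1
      · split_ifs at h1
        · exact absurd h1.2 hzN
        · exact absurd h1 (notMem_empty z)
  exact fun A hA B hB h => (main A hA B hB h).antisymm (main B hB A hA h.symm)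

/-- Joining two pieces of a set lowers the number of its relatively clopen subsets. -/
theorem ncard_relClopens_lt (hN : IsOpen N) (hK : IsClosed K) (hKN : K ⊆ N)
    (hZ : Z \ K = Z' \ K) (hpre : IsPreconnected (Z' ∩ N)) (hne' : (Z' ∩ N).Nonempty)
    (hfin : (relClopens Z).Finite) {C : Set X} (hC : C ∈ relClopens Z)
    {p q : X} (hp : p ∈ C) (hpN : p ∈ N) (hq : q ∈ Z \ C) (hqN : q ∈ N) :
    (relClopens Z').Finite ∧ (relClopens Z').ncard < (relClopens Z).ncard := by
  have hinj := injOn_extendClopen hN hK hKN hZ hpre hne' ⟨p, hC.1 hp, hpN⟩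
  have hmaps : MapsTo (extendClopen Z N K) (relClopens Z') (relClopens Z) := fun A hA =>
    extendClopen_mem_relClopens hN hK hKN hZ hpre hne' hA
  refine ⟨Finite.of_injOn hmaps hinj hfin, ?_⟩
  rw [← hinj.ncard_image]
  refine ncard_lt_ncard ⟨hmaps.image_subset, fun hsub => ?_⟩ hfin
  obtain ⟨A, hA, hAC⟩ := hsub hC
  by_cases h : (A ∩ N).Nonempty
  · rw [extendClopen, if_pos h] at hAC
    exact hq.2 (hAC ▸ Or.inr ⟨hq.1, hqN⟩)
  · rw [extendClopen, if_neg h, union_empty] at hAC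
    rw [← hAC] at hp
    exact h ⟨p, hp.1, hpN⟩

theorem isPreconnected_of_extend (hN : IsOpen N) (hK : IsClosed K) (hKN : K ⊆ N)
    (hZ : Z \ K = Z' \ K) (hpre : IsPreconnected (Z' ∩ N)) (hne' : (Z' ∩ N).Nonempty)
    (hne : (Z ∩ N).Nonempty) (h : IsPreconnected Z) :
    IsPreconnected Z' := by
  refine isPreconnected_of_relClopens fun A hA => ?_
  have hinj := injOn_extendClopen hN hK hKN hZ hpre hne' hne
  have hempty : (∅ : Set X) ∈ relClopens Z' :=
    ⟨empty_subset _, ⟨∅, isOpen_empty, by simp⟩, univ, isOpen_univ, by simp⟩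
  have hE0 : extendClopen Z N K ∅ = ∅ := by
    rw [extendClopen, if_neg (by simp)]; simp
  have hE1 : extendClopen Z N K Z' = Z := by
    have := extendClopen_diff hN hK hKN hZ hpre hne' hempty
    rwa [hE0, sdiff_empty, sdiff_empty] at this
  have hZ'Z' : Z' ∈ relClopens Z' := by simpa using diff_mem_relClopens hempty
  have hm := extendClopen_mem_relClopens hN hK hKN hZ hpre hne' hA
  rcases disjoint_or_subset_of_mem_relClopens hm subset_rfl h with h1 | h1
  · left
    refine hinj hA hempty ?_
    rw [hE0]
    exact disjoint_self.1 (h1.mono_left hm.1)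
  · right
    refine hinj hA hZ'Z' ?_
    rw [hE1]
    exact hm.1.antisymm h1

end RelClopens

section Chart
variable {E F : Type*} [NormedAddCommGroup E] [InnerProductSpace ℝ E]
  [NormedAddCommGroup F] [InnerProductSpace ℝ F]

theorem mem_closure_neg_of_fderiv_ne_zero {V : Type*} [NormedAddCommGroup V] [NormedSpace ℝ V]
    {g : V → ℝ} {x : V} (hx : g x = 0) (hd : fderiv ℝ g x ≠ 0) : x ∈ closure {y | g y < 0} := by
  by_contra hc
  refine hd (IsLocalMin.fderiv_eq_zero ?_)
  filter_upwards [isClosed_closure.isOpen_compl.mem_nhds hc] with y hy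
  rw [hx]
  by_contra! h
  exact hy (subset_closure h)

theorem frontier_neg_eq {V : Type*} [NormedAddCommGroup V] [NormedSpace ℝ V]
    {g : V → ℝ} (hg : Continuous g) (hd : ∀ x, g x = 0 → fderiv ℝ g x ≠ 0) :
    frontier {y | g y < 0} = {y | g y = 0} := by
  refine (frontier_lt_subset_eq hg continuous_const).antisymm fun x hx => ?_
  rw [(isOpen_lt hg continuous_const).frontier_eq]
  exact ⟨mem_closure_neg_of_fderiv_ne_zero hx (hd x hx), fun h => (ne_of_lt h) hx⟩

theorem frontier_inter_congr {X : Type*} [TopologicalSpace X] {A B U : Set X} (hU : IsOpen U)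
    (h : A ∩ U = B ∩ U) : frontier A ∩ U = frontier B ∩ U := by
  rw [← frontier_inter_open_inter hU, h, frontier_inter_open_inter hU]

/-- A smooth chart straightening a tube that joins two points of the frontier of `Ω` through
`Ω`. -/
structure TubeChart (F : Type*) [NormedAddCommGroup F] [InnerProductSpace ℝ F] (Ω : Set E) where
  toFun : (ℝ × F) ≃ₜ E
  contDiff_toFun : ContDiff ℝ (⊤ : ℕ∞) toFun
  contDiff_symm : ContDiff ℝ (⊤ : ℕ∞) toFun.symm
  margin : ℝ
  margin_pos : 0 < margin
  radius : ℝ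
  radius_pos : 0 < radius
  K : ℝ≥0
  lipschitz : LipschitzOnWith K toFun (Ioo (-margin) (1 + margin) ×ˢ ball 0 radius)
  antilipschitz : LipschitzOnWith K toFun.symm
    (toFun '' (Ioo (-margin) (1 + margin) ×ˢ ball 0 radius))
  mem_iff : ∀ x ∈ Ioo (-margin) (1 + margin) ×ˢ ball (0 : F) radius,
    toFun x ∈ Ω ↔ 0 < x.1 ∧ x.1 < 1

namespace TubeChart
variable {Ω : Set E} (T : TubeChart F Ω) {δ : ℝ}

/-- The domain of the chart. -/
def dom : Set (ℝ × F) := Ioo (-T.margin) (1 + T.margin) ×ˢ ball 0 T.radius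

/-- The image of the chart. -/
def img : Set E := T.toFun '' T.dom

/-- The tunnel, in the model. -/
def tunnel (F : Type*) [NormedAddCommGroup F] [InnerProductSpace ℝ F] (δ : ℝ) : Set (ℝ × F) :=
  {x | 0 ≤ tubeFun δ x ∧ x.1 ∈ Icc (0 : ℝ) 1 ∧ ‖x.2‖ ≤ δ}

/-- `Ω` with the tunnel removed. -/
def cut (δ : ℝ) : Set E := Ω \ T.toFun '' tunnel F δ

theorem isOpen_dom : IsOpen T.dom := isOpen_Ioo.prod isOpen_ball

theorem isOpen_img : IsOpen T.img := T.toFun.isOpenMap _ T.isOpen_dom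

theorem isClosed_tunnel : IsClosed (tunnel F δ) :=
  (isClosed_le continuous_const (contDiff_tubeFun δ).continuous).inter
    ((isClosed_Icc.preimage continuous_fst).inter
      (isClosed_le continuous_snd.norm continuous_const))

theorem isClosed_image_tunnel : IsClosed (T.toFun '' tunnel F δ) :=
  T.toFun.isClosedMap _ isClosed_tunnel

theorem mem_dom {x : ℝ × F} (h1 : x.1 ∈ Icc (0 : ℝ) 1) (h2 : ‖x.2‖ < T.radius) : x ∈ T.dom :=
  ⟨⟨by linarith [h1.1, T.margin_pos], by linarith [h1.2, T.margin_pos]⟩, by simpa using h2⟩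

theorem tunnel_subset (hδ : δ < T.radius) : tunnel F δ ⊆ T.dom := fun _ hx =>
  T.mem_dom hx.2.1 (hx.2.2.trans_lt hδ)

theorem image_tunnel_subset (hδ : δ < T.radius) : T.toFun '' tunnel F δ ⊆ T.img :=
  image_mono (T.tunnel_subset hδ)

theorem cut_subset : T.cut δ ⊆ Ω := sdiff_subset

theorem cut_diff : T.cut δ \ T.toFun '' tunnel F δ = Ω \ T.toFun '' tunnel F δ := by
  rw [cut, sdiff_sdiff, union_self]

theorem isOpen_cut (ho : IsOpen Ω) : IsOpen (T.cut δ) := ho.sdiff T.isClosed_image_tunnel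

theorem mem_cut_iff (hδ : 0 < δ) {x : ℝ × F} (hx : x ∈ T.dom) :
    T.toFun x ∈ T.cut δ ↔ tubeFun δ x < 0 := by
  rw [cut, Set.mem_sdiff, T.toFun.injective.mem_set_image, T.mem_iff x hx]
  constructor
  · rintro ⟨⟨h0, h1⟩, ht⟩
    by_contra! hc
    refine ht ⟨hc, ⟨h0.le, h1.le⟩, ?_⟩
    by_contra! hδx
    exact hc.not_gt (tubeFun_neg_of_le hδ hδx.le h0 h1)
  · intro h
    exact ⟨⟨pos_of_tubeFun_neg h, lt_one_of_tubeFun_neg h⟩, fun ht => ht.1.not_gt h⟩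

theorem mem_frontier_cut_iff (hδ : 0 < δ) {x : ℝ × F} (hx : x ∈ T.dom) :
    T.toFun x ∈ frontier (T.cut δ) ↔ tubeFun δ x = 0 := by
  have h1 : (T.toFun ⁻¹' T.cut δ) ∩ T.dom = {x | tubeFun δ x < 0} ∩ T.dom := by
    ext y
    simp only [mem_inter_iff, mem_preimage, mem_ofPred_eq]
    exact and_congr_left fun hy => T.mem_cut_iff hδ hy
  have h2 := frontier_inter_congr T.isOpen_dom h1
  rw [← T.toFun.preimage_frontier, frontier_neg_eq (contDiff_tubeFun δ).continuous
    fun x hx => fderiv_tubeFun_ne_zero hδ hx] at h2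
  have h3 : x ∈ T.toFun ⁻¹' frontier (T.cut δ) ∩ T.dom ↔ x ∈ {y | tubeFun δ y = 0} ∩ T.dom := by
    rw [h2]
  simpa [hx] using h3

theorem mem_frontier_iff {x : ℝ × F} (hx : x ∈ T.dom) :
    T.toFun x ∈ frontier Ω ↔ x.1 = 0 ∨ x.1 = 1 := by
  have h1 : (T.toFun ⁻¹' Ω) ∩ T.dom = (Prod.fst ⁻¹' Ioo (0 : ℝ) 1) ∩ T.dom := by
    ext y
    simp only [mem_inter_iff, mem_preimage]
    exact and_congr_left fun hy => T.mem_iff y hy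
  have h2 := frontier_inter_congr T.isOpen_dom h1
  rw [← T.toFun.preimage_frontier, ← isOpenMap_fst.preimage_frontier_eq_frontier_preimage
    continuous_fst, frontier_Ioo zero_lt_one] at h2
  have h3 : x ∈ T.toFun ⁻¹' frontier Ω ∩ T.dom ↔ x ∈ Prod.fst ⁻¹' {0, 1} ∩ T.dom := by
    rw [h2]
  simpa [hx] using h3

theorem frontier_diff_eq :
    frontier Ω \ T.toFun '' tunnel F δ = frontier (T.cut δ) \ T.toFun '' tunnel F δ := by
  have h : Ω ∩ (T.toFun '' tunnel F δ)ᶜ = T.cut δ ∩ (T.toFun '' tunnel F δ)ᶜ :=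
    T.cut_diff.symm
  exact frontier_inter_congr T.isClosed_image_tunnel.isOpen_compl h

theorem one_lt_rank [FiniteDimensional ℝ F] (hF : 2 ≤ Module.finrank ℝ F) :
    1 < Module.rank ℝ F := by
  rw [← Module.finrank_eq_rank]; exact_mod_cast hF

theorem cut_inter_img (hδ : 0 < δ) :
    T.cut δ ∩ T.img = T.toFun '' {x | tubeFun δ x < 0 ∧ ‖x.2‖ < T.radius} := by
  ext z
  constructor
  · rintro ⟨hz, x, hx, rfl⟩
    exact ⟨x, ⟨(T.mem_cut_iff hδ hx).1 hz, by simpa using hx.2⟩, rfl⟩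
  · rintro ⟨x, ⟨h1, h2⟩, rfl⟩
    have hx : x ∈ T.dom :=
      T.mem_dom ⟨nonneg_of_tubeFun_nonpos h1.le, le_one_of_tubeFun_nonpos h1.le⟩ h2
    exact ⟨(T.mem_cut_iff hδ hx).2 h1, x, hx, rfl⟩

theorem frontier_cut_inter_img (hδ : 0 < δ) :
    frontier (T.cut δ) ∩ T.img = T.toFun '' {x | tubeFun δ x = 0 ∧ ‖x.2‖ < T.radius} := by
  ext z
  constructor
  · rintro ⟨hz, x, hx, rfl⟩
    exact ⟨x, ⟨(T.mem_frontier_cut_iff hδ hx).1 hz, by simpa using hx.2⟩, rfl⟩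
  · rintro ⟨x, ⟨h1, h2⟩, rfl⟩
    have hx : x ∈ T.dom :=
      T.mem_dom ⟨nonneg_of_tubeFun_nonpos h1.le, le_one_of_tubeFun_nonpos h1.le⟩ h2
    exact ⟨(T.mem_frontier_cut_iff hδ hx).2 h1, x, hx, rfl⟩

section Finite
variable [FiniteDimensional ℝ F]

theorem exists_norm_between (hF : 2 ≤ Module.finrank ℝ F) (hδ : 0 < δ) (hδR : δ < T.radius) :
    ∃ y : F, δ ≤ ‖y‖ ∧ ‖y‖ < T.radius := by
  obtain ⟨y, hy⟩ := exists_norm_eq_of_one_lt_rank (one_lt_rank hF) hδ.le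
  exact ⟨y, hy.ge, by linarith⟩

theorem isConnected_cut (hF : 2 ≤ Module.finrank ℝ F) (hδ : 0 < δ) (hδR : δ < T.radius)
    (hΩ : IsConnected Ω) : IsConnected (T.cut δ) := by
  obtain ⟨y, hy1, hy2⟩ := T.exists_norm_between hF hδ hδR
  have hneg := tubeFun_neg_of_le (τ := 1 / 2) hδ hy1 (by norm_num) (by norm_num)
  have hdom : ((1 / 2 : ℝ), y) ∈ T.dom := T.mem_dom (by norm_num) hy2
  have hcut := (T.mem_cut_iff hδ hdom).2 hneg
  refine ⟨⟨_, hcut⟩, ?_⟩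
  refine isPreconnected_of_extend (Z := Ω) T.isOpen_img T.isClosed_image_tunnel
    (T.image_tunnel_subset hδR) T.cut_diff.symm ?_ ⟨_, hcut, _, hdom, rfl⟩
    ⟨_, T.cut_subset hcut, _, hdom, rfl⟩ hΩ.isPreconnected
  rw [T.cut_inter_img hδ]
  exact (isPreconnected_tubeFun_neg (one_lt_rank hF) hδ hδR).image _ T.toFun.continuous.continuousOn

theorem relClopens_frontier_cut (hF : 2 ≤ Module.finrank ℝ F) (hδ : 0 < δ) (hδR : δ < T.radius)
    (hfin : (relClopens (frontier Ω)).Finite) {C : Set E} (hC : C ∈ relClopens (frontier Ω))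
    (hp : T.toFun (0, 0) ∈ C) (hq : T.toFun (1, 0) ∉ C) :
    (frontier (T.cut δ)).Nonempty ∧ (relClopens (frontier (T.cut δ))).Finite ∧
      (relClopens (frontier (T.cut δ))).ncard < (relClopens (frontier Ω)).ncard := by
  obtain ⟨y, hy1, hy2⟩ := T.exists_norm_between hF hδ hδR
  have hzero := (tubeFun_eq_zero_iff_of_le (τ := 0) hδ hy1).2 (Or.inl rfl)
  have hdom : ((0 : ℝ), y) ∈ T.dom := T.mem_dom (by norm_num) hy2
  have hcut := (T.mem_frontier_cut_iff hδ hdom).2 hzero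
  have hd0 : ((0 : ℝ), (0 : F)) ∈ T.dom := T.mem_dom (by norm_num) (by simpa using T.radius_pos)
  have hd1 : ((1 : ℝ), (0 : F)) ∈ T.dom := T.mem_dom (by norm_num) (by simpa using T.radius_pos)
  refine ⟨⟨_, hcut⟩, ncard_relClopens_lt T.isOpen_img T.isClosed_image_tunnel
    (T.image_tunnel_subset hδR) T.frontier_diff_eq ?_ ⟨_, hcut, _, hdom, rfl⟩ hfin hC hp
    ⟨_, hd0, rfl⟩ ⟨(T.mem_frontier_iff hd1).2 (Or.inr rfl), hq⟩ ⟨_, hd1, rfl⟩⟩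
  rw [T.frontier_cut_inter_img hδ]
  exact (isPreconnected_tubeFun_zero (one_lt_rank hF) hδ hδR).image _
    T.toFun.continuous.continuousOn

end Finite
end TubeChart

theorem norm_gradient_eq {n : ℕ} (f : EuclideanSpace ℝ (Fin n) → ℝ) (x : EuclideanSpace ℝ (Fin n)) :
    ‖gradient f x‖ = ‖fderiv ℝ f x‖ := by simp [gradient]

theorem TubeChart.hasSmoothBoundary_cut {n : ℕ} {Ω : Set (EuclideanSpace ℝ (Fin n))}
    (T : TubeChart F Ω) {δ : ℝ} (hδ : 0 < δ) (hδR : δ < T.radius) (hsb : HasSmoothBoundary Ω) :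
    HasSmoothBoundary (T.cut δ) := by
  intro z hz
  by_cases hzi : z ∈ T.img
  · set g : EuclideanSpace ℝ (Fin n) → ℝ := tubeFun δ ∘ T.toFun.symm with hg
    have hgd : ContDiff ℝ (⊤ : ℕ∞) g := (contDiff_tubeFun δ).comp T.contDiff_symm
    obtain ⟨x, hx, rfl⟩ := hzi
    have hx0 := (T.mem_frontier_cut_iff hδ hx).1 hz
    have hcont : Continuous (fderiv ℝ g) := hgd.continuous_fderiv (by simp)
    refine ⟨T.img ∩ {z | fderiv ℝ g z ≠ 0}, T.isOpen_img.inter (isOpen_ne.preimage hcont),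
      ⟨⟨x, hx, rfl⟩, ?_⟩, g, hgd, ?_, ?_, ?_⟩
    · intro h0
      refine fderiv_tubeFun_ne_zero hδ hx0 ?_
      have e : tubeFun δ = g ∘ T.toFun := by funext y; simp [hg]
      have h1 : HasFDerivAt g (fderiv ℝ g (T.toFun x)) (T.toFun x) :=
        (hgd.differentiable (by simp) _).hasFDerivAt
      have h2 := (T.contDiff_toFun.differentiable (by simp) x).hasFDerivAt
      rw [e, (h1.comp x h2).fderiv]
      have h0' : fderiv ℝ g (T.toFun x) = 0 := h0
      rw [h0', ContinuousLinearMap.zero_comp]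
    · intro y hy h0
      have := norm_gradient_eq g y
      rw [h0, norm_zero] at this
      exact hy.2 (norm_eq_zero.1 this.symm)
    · ext y
      simp only [mem_inter_iff, mem_ofPred_eq]
      refine and_congr_left fun hy => ?_
      obtain ⟨w, hw, rfl⟩ := hy.1
      rw [T.mem_cut_iff hδ hw]; simp [hg]
    · ext y
      simp only [mem_inter_iff, mem_ofPred_eq]
      refine and_congr_left fun hy => ?_
      obtain ⟨w, hw, rfl⟩ := hy.1
      rw [T.mem_frontier_cut_iff hδ hw]; simp [hg]
  · have hzK : z ∉ T.toFun '' TubeChart.tunnel F δ := fun h => hzi (T.image_tunnel_subset hδR h)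
    have hzΩ : z ∈ frontier Ω \ T.toFun '' TubeChart.tunnel F δ := by
      rw [T.frontier_diff_eq]; exact ⟨hz, hzK⟩
    obtain ⟨U, hU, hzU, g, hg, hgrad, h1, h2⟩ := hsb z hzΩ.1
    refine ⟨U \ T.toFun '' TubeChart.tunnel F δ, hU.sdiff T.isClosed_image_tunnel, ⟨hzU, hzK⟩, g, hg,
      fun y hy => hgrad y hy.1, ?_, ?_⟩
    · rw [← inter_sdiff_assoc, ← inter_sdiff_assoc, ← h1, inter_sdiff_right_comm, T.cut_diff,
        inter_sdiff_right_comm]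
    · rw [← inter_sdiff_assoc, ← inter_sdiff_assoc, ← h2, inter_sdiff_right_comm,
        ← T.frontier_diff_eq, inter_sdiff_right_comm]

end Chart

section Comparison

theorem exists_hausdorffMeasure_eq_smul (V : Type*) [NormedAddCommGroup V] [NormedSpace ℝ V]
    [FiniteDimensional ℝ V] [MeasurableSpace V] [BorelSpace V] (μ : Measure V)
    [μ.IsAddHaarMeasure] : ∃ c : ℝ≥0∞, c ≠ 0 ∧ c ≠ ⊤ ∧
      (μH[(Module.finrank ℝ V : ℝ)] : Measure V) = c • μ := by
  have h := Measure.isAddLeftInvariant_eq_smul (μH[(Module.finrank ℝ V : ℝ)] : Measure V) μ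
  exact ⟨_, by exact_mod_cast (Measure.addHaarScalarFactor_pos_of_isAddHaarMeasure _ _).ne',
    ENNReal.coe_ne_top, h⟩

/-- Change of variables inequality for Lebesgue measures under an expanding map. -/
theorem exists_lintegral_comp_le (V W : Type*) [NormedAddCommGroup V] [NormedSpace ℝ V]
    [FiniteDimensional ℝ V] [MeasurableSpace V] [BorelSpace V] [NormedAddCommGroup W]
    [NormedSpace ℝ W] [FiniteDimensional ℝ W] [MeasurableSpace W] [BorelSpace W]
    (μ : Measure V) [μ.IsAddHaarMeasure] (ν : Measure W) [ν.IsAddHaarMeasure]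
    (hVW : Module.finrank ℝ V = Module.finrank ℝ W) (C : ℝ≥0) :
    ∃ c : ℝ≥0∞, c ≠ ⊤ ∧ ∀ (B : Set V), MeasurableSet B → ∀ P : V → W, ContinuousOn P B →
      (∀ x ∈ B, ∀ x' ∈ B, edist x x' ≤ C * edist (P x) (P x')) → ∀ H : W → ℝ≥0∞, Measurable H →
      ∫⁻ x in B, H (P x) ∂μ ≤ c * ∫⁻ y, H y ∂ν := by
  obtain ⟨a, ha0, ha1, ha⟩ := exists_hausdorffMeasure_eq_smul V μ
  obtain ⟨b, hb0, hb1, hb⟩ := exists_hausdorffMeasure_eq_smul W ν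
  refine ⟨a⁻¹ * ((C : ℝ≥0∞) ^ (Module.finrank ℝ V : ℝ) * b), ?_, ?_⟩
  · exact ENNReal.mul_ne_top (ENNReal.inv_ne_top.2 ha0) (ENNReal.mul_ne_top
      (ENNReal.rpow_ne_top_of_nonneg (by positivity) ENNReal.coe_ne_top) hb1)
  · intro B hB P hP hC H hH
    have := lintegral_comp_le_of_antilipschitzOn (d := Module.finrank ℝ V) (by positivity) hB hP hC hH
    rw [ha, hVW, hb, Measure.restrict_smul, lintegral_smul_measure, lintegral_smul_measure] at this
    simp only [smul_eq_mul] at this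
    calc ∫⁻ x in B, H (P x) ∂μ = a⁻¹ * (a * ∫⁻ x in B, H (P x) ∂μ) := by
          rw [← mul_assoc, ENNReal.inv_mul_cancel ha0 ha1, one_mul]
      _ ≤ _ := by
          rw [hVW, mul_assoc, mul_assoc]
          exact mul_le_mul' le_rfl this

theorem tendsto_wallConst (R : ℝ) (hR : 0 < R) : Tendsto (wallConst R) (𝓝[>] 0) (𝓝 0) := by
  have hlog : Tendsto (fun x : ℝ => Real.log x * x) (𝓝[>] 0) (𝓝 0) := by
    simpa using tendsto_log_mul_rpow_nhdsGT_zero zero_lt_one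
  have hid : Tendsto (fun x : ℝ => x) (𝓝[>] 0) (𝓝 0) := tendsto_nhdsWithin_of_tendsto_nhds tendsto_id
  have h1 : Tendsto (fun x : ℝ => (160 / R ^ 2 + 80 * Real.log (R / 2) - 64 * Real.log 2 + 4) * x -
      80 * (Real.log x * x)) (𝓝[>] 0) (𝓝 0) := by
    have := (hid.const_mul (160 / R ^ 2 + 80 * Real.log (R / 2) - 64 * Real.log 2 + 4)).sub
      (hlog.const_mul 80)
    simpa using this
  refine h1.congr' ?_
  filter_upwards [self_mem_nhdsWithin] with x hx
  have hx : 0 < x := hx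
  have e1 : Real.log (R / (2 * x)) = Real.log (R / 2) - Real.log x := by
    rw [← div_div, Real.log_div (by positivity) (by positivity)]
  have e2 : Real.log (R / (2 * (2 * x))) = Real.log (R / 2) - Real.log 2 - Real.log x := by
    rw [← div_div, Real.log_div (by positivity) (by positivity), Real.log_mul (by norm_num) hx.ne']
    ring
  rw [wallConst, shellConst, shellConst, e1, e2]
  field_simp
  ring

end Comparison

section Removal
variable {E F : Type*} [NormedAddCommGroup E] [InnerProductSpace ℝ E] [FiniteDimensional ℝ E]
  [MeasurableSpace E] [BorelSpace E]
  [NormedAddCommGroup F] [InnerProductSpace ℝ F] [FiniteDimensional ℝ F]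
  [MeasurableSpace F] [BorelSpace F]

/-- Dirichlet energy plus the squared norm of the boundary values. -/
noncomputable def steklovEnergy (d : ℝ) (Ω : Set E) (f : E → ℝ) : ℝ≥0∞ :=
  (∫⁻ z in Ω, gradSq f z) + ∫⁻ z in frontier Ω, sqVal f z ∂μH[d]

/-- `χ` cuts off functions on `Ω'` to functions on `Ω`, at a cost controlled by `η`. -/
structure IsSmallRemoval (d η : ℝ) (Ω Ω' : Set E) (χ : E → ℝ) : Prop where
  subset : Ω' ⊆ Ω
  contDiff : ContDiff ℝ (⊤ : ℕ∞) χ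
  nonneg : ∀ z, 0 ≤ χ z
  le_one : ∀ z, χ z ≤ 1
  frontier_iff : ∀ z, χ z ≠ 0 → (z ∈ frontier Ω ↔ z ∈ frontier Ω')
  mem : ∀ z ∈ Ω, χ z ≠ 0 → z ∈ Ω'
  volume_le : volume (Ω \ Ω') ≤ ENNReal.ofReal η
  area_le : μH[d] (frontier Ω ∩ {z | χ z ≠ 1}) ≤ ENNReal.ofReal η
  area_le' : μH[d] (frontier Ω' ∩ {z | χ z ≠ 1}) ≤ ENNReal.ofReal η
  trace_le : ∀ f : E → ℝ, ContDiff ℝ (⊤ : ℕ∞) f →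
    ∫⁻ z in frontier Ω' ∩ {z | χ z ≠ 1}, sqVal f z ∂μH[d] ≤
      ENNReal.ofReal η * steklovEnergy d Ω' f
  capacity_le : ∀ f : E → ℝ, ContDiff ℝ (⊤ : ℕ∞) f →
    ∫⁻ z in Ω, sqVal f z * gradSq χ z ≤ ENNReal.ofReal η * steklovEnergy d Ω' f

instance isAddHaarMeasure_volume_prod : (volume : Measure (ℝ × F)).IsAddHaarMeasure := by
  rw [Measure.volume_eq_prod]; infer_instance

theorem tendsto_volume_ball (hF : 2 ≤ Module.finrank ℝ F) :
    Tendsto (fun ℓ : ℝ => volume (ball (0 : F) (2 * ℓ))) (𝓝[>] 0) (𝓝 0) := by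
  have h1 : Tendsto (fun ℓ : ℝ => ENNReal.ofReal ((2 * ℓ) ^ Module.finrank ℝ F) *
      volume (ball (0 : F) 1)) (𝓝[>] 0) (𝓝 (ENNReal.ofReal ((2 * 0) ^ Module.finrank ℝ F) *
        volume (ball (0 : F) 1))) := by
    refine ENNReal.Tendsto.mul_const (ENNReal.tendsto_ofReal ?_) (Or.inr measure_ball_lt_top.ne)
    exact tendsto_nhdsWithin_of_tendsto_nhds
      (Continuous.tendsto (by fun_prop : Continuous fun ℓ : ℝ => (2 * ℓ) ^ Module.finrank ℝ F) 0)
  have e : (2 * 0 : ℝ) ^ Module.finrank ℝ F = 0 := by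
    rw [mul_zero]; exact zero_pow (by omega)
  rw [e, ENNReal.ofReal_zero, zero_mul] at h1
  refine h1.congr' ?_
  filter_upwards [self_mem_nhdsWithin] with ℓ hℓ
  exact (Measure.addHaar_ball_of_pos _ _ (by have : 0 < ℓ := hℓ; positivity)).symm

namespace TubeChart
variable {Ω : Set E} (T : TubeChart F Ω)

/-- The part of the image of the chart at distance less than `ρ` from the axis. -/
def core (ρ : ℝ) : Set E := T.toFun '' {x | x ∈ T.dom ∧ ‖x.2‖ < ρ}

theorem isOpen_core (ρ : ℝ) : IsOpen (T.core ρ) :=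
  T.toFun.isOpenMap _ (T.isOpen_dom.inter (isOpen_lt continuous_snd.norm continuous_const))

theorem core_subset (ρ : ℝ) : T.core ρ ⊆ T.img := image_mono fun _ hx => hx.1

theorem edist_toFun_le {x x' : ℝ × F} (hx : x ∈ T.dom) (hx' : x' ∈ T.dom) :
    edist x x' ≤ T.K * edist (T.toFun x) (T.toFun x') := by
  simpa using T.antilipschitz ⟨x, hx, rfl⟩ ⟨x', hx', rfl⟩

theorem edist_symm_le {z z' : E} (hz : z ∈ T.img) (hz' : z' ∈ T.img) :
    edist z z' ≤ T.K * edist (T.toFun.symm z) (T.toFun.symm z') := by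
  obtain ⟨x, hx, rfl⟩ := hz
  obtain ⟨x', hx', rfl⟩ := hz'
  simpa using T.lipschitz hx hx'

theorem gradSq_comp_le {f : E → ℝ} (hf : ContDiff ℝ (⊤ : ℕ∞) f) {x : ℝ × F} (hx : x ∈ T.dom) :
    gradSq (f ∘ T.toFun) x ≤ (T.K : ℝ≥0∞) ^ 2 * gradSq f (T.toFun x) := by
  have h1 := norm_fderiv_le_of_lipschitzOn ℝ (T.isOpen_dom.mem_nhds hx) T.lipschitz
  have h2 : HasFDerivAt f (fderiv ℝ f (T.toFun x)) (T.toFun x) :=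
    (hf.differentiable (by simp) _).hasFDerivAt
  have h3 := (T.contDiff_toFun.differentiable (by simp) x).hasFDerivAt
  rw [gradSq, gradSq, (h2.comp x h3).fderiv, ← ENNReal.ofReal_coe_nnreal,
    ← ENNReal.ofReal_pow (NNReal.coe_nonneg _), ← ENNReal.ofReal_mul (by positivity)]
  refine ENNReal.ofReal_le_ofReal ?_
  rw [← mul_pow]
  refine pow_le_pow_left₀ (norm_nonneg _) ?_ 2
  calc _ ≤ _ := ContinuousLinearMap.opNorm_comp_le _ _
    _ ≤ _ := by rw [mul_comm]; gcongr

theorem tubeDom_subset {δ : ℝ} : tubeDom F δ T.radius ⊆ T.dom := fun _ hx =>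
  T.mem_dom ⟨nonneg_of_tubeFun_nonpos hx.1.le, le_one_of_tubeFun_nonpos hx.1.le⟩ hx.2

theorem measurableSet_image {S : Set (ℝ × F)} (hS : MeasurableSet S) :
    MeasurableSet (T.toFun '' S) :=
  T.toFun.measurableEmbedding.measurableSet_image.2 hS

theorem exists_energy_transfer (hEF : Module.finrank ℝ E = Module.finrank ℝ F + 1)
    (hΩ : IsOpen Ω) :
    ∃ C : ℝ≥0∞, C ≠ ⊤ ∧ ∀ δ, 0 < δ → ∀ f : E → ℝ, ContDiff ℝ (⊤ : ℕ∞) f →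
      (∫⁻ y in shell F δ T.radius, sqVal (f ∘ T.toFun) (0, y)) +
        (∫⁻ x in tubeDom F δ T.radius, gradSq (f ∘ T.toFun) x) ≤
      C * steklovEnergy (Module.finrank ℝ F) (T.cut δ) f := by
  obtain ⟨a, ha0, ha1, ha⟩ := exists_hausdorffMeasure_eq_smul F volume
  have hfr : Module.finrank ℝ (ℝ × F) = Module.finrank ℝ E := by
    rw [Module.finrank_prod, Module.finrank_self, hEF, add_comm]
  obtain ⟨c, hc, hcomp⟩ := exists_lintegral_comp_le (ℝ × F) E volume volume hfr T.K
  refine ⟨a⁻¹ * (T.K : ℝ≥0∞) ^ (Module.finrank ℝ F : ℝ) + (T.K : ℝ≥0∞) ^ 2 * c, ?_, ?_⟩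
  · exact ENNReal.add_ne_top.2 ⟨ENNReal.mul_ne_top (ENNReal.inv_ne_top.2 ha0)
      (ENNReal.rpow_ne_top_of_nonneg (by positivity) ENNReal.coe_ne_top),
      ENNReal.mul_ne_top (ENNReal.pow_ne_top ENNReal.coe_ne_top) hc⟩
  intro δ hδ f hf
  have hend : ∀ y ∈ shell F δ T.radius, ((0 : ℝ), y) ∈ T.dom := fun y hy =>
    T.mem_dom (by norm_num) hy.2
  have h1 : ∫⁻ y in shell F δ T.radius, sqVal (f ∘ T.toFun) (0, y) ≤
      a⁻¹ * ((T.K : ℝ≥0∞) ^ (Module.finrank ℝ F : ℝ) *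
        ∫⁻ z in frontier (T.cut δ), sqVal f z ∂μH[(Module.finrank ℝ F : ℝ)]) := by
    have hH : Measurable ((frontier (T.cut δ)).indicator (sqVal f)) :=
      (measurable_sqVal hf.continuous).indicator isClosed_frontier.measurableSet
    have := lintegral_comp_le_of_antilipschitzOn (d := Module.finrank ℝ F) (by positivity)
      (measurableSet_shell F δ T.radius) (P := fun y => T.toFun (0, y))
      (by fun_prop) (C := T.K) (fun y hy y' hy' => by
        have := T.edist_toFun_le (hend y hy) (hend y' hy')
        simpa [Prod.edist_eq] using this) hH
    rw [lintegral_indicator isClosed_frontier.measurableSet, ha, Measure.restrict_smul,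
      lintegral_smul_measure, smul_eq_mul] at this
    calc _ = a⁻¹ * (a * ∫⁻ y in shell F δ T.radius, (frontier (T.cut δ)).indicator (sqVal f)
          (T.toFun (0, y))) := by
          rw [← mul_assoc, ENNReal.inv_mul_cancel ha0 ha1, one_mul]
          refine setLIntegral_congr_fun (measurableSet_shell F δ T.radius) fun y hy => ?_
          have hmem : T.toFun (0, y) ∈ frontier (T.cut δ) :=
            (T.mem_frontier_cut_iff hδ (hend y hy)).2
              ((tubeFun_eq_zero_iff_of_le hδ hy.1).2 (Or.inl rfl))
          simp only [indicator_of_mem hmem]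
          rfl
      _ ≤ _ := mul_le_mul' le_rfl this
  have h2 : ∫⁻ x in tubeDom F δ T.radius, gradSq (f ∘ T.toFun) x ≤
      (T.K : ℝ≥0∞) ^ 2 * (c * ∫⁻ z in T.cut δ, gradSq f z) := by
    have hm := (T.isOpen_cut (δ := δ) hΩ).measurableSet
    have hH : Measurable ((T.cut δ).indicator (gradSq f)) :=
      (measurable_gradSq (hf.of_le (by simp))).indicator hm
    have := hcomp (tubeDom F δ T.radius) (measurableSet_tubeDom F δ T.radius) T.toFun
      T.toFun.continuous.continuousOn
      (fun x hx x' hx' => T.edist_toFun_le (T.tubeDom_subset hx) (T.tubeDom_subset hx')) _ hH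
    rw [lintegral_indicator hm] at this
    calc _ ≤ ∫⁻ x in tubeDom F δ T.radius, (T.K : ℝ≥0∞) ^ 2 *
          (T.cut δ).indicator (gradSq f) (T.toFun x) := by
          refine setLIntegral_mono' (measurableSet_tubeDom F δ T.radius) fun x hx => ?_
          rw [indicator_of_mem ((T.mem_cut_iff hδ (T.tubeDom_subset hx)).2 hx.1)]
          exact T.gradSq_comp_le hf (T.tubeDom_subset hx)
      _ = (T.K : ℝ≥0∞) ^ 2 * ∫⁻ x in tubeDom F δ T.radius,
          (T.cut δ).indicator (gradSq f) (T.toFun x) :=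
          lintegral_const_mul _ (hH.comp T.toFun.continuous.measurable)
      _ ≤ _ := mul_le_mul' le_rfl this
  calc _ ≤ _ := add_le_add h1 h2
    _ ≤ _ := by
      rw [steklovEnergy, add_mul, ← mul_assoc, ← mul_assoc]
      exact add_le_add (mul_le_mul' le_rfl le_add_self) (mul_le_mul' le_rfl le_self_add)

theorem exists_wall_transfer (hF : 2 ≤ Module.finrank ℝ F) :
    ∃ C : ℝ≥0∞, C ≠ ⊤ ∧ ∀ δ ℓ, 0 < δ → δ ≤ ℓ → ℓ ≤ 1 / 8 → 4 * ℓ ≤ T.radius →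
      ∀ f : E → ℝ, ContDiff ℝ (⊤ : ℕ∞) f →
      ∫⁻ z in frontier (T.cut δ) ∩ T.core (2 * ℓ), sqVal f z ∂μH[(Module.finrank ℝ F : ℝ)] ≤
      C * (ENNReal.ofReal (wallConst T.radius ℓ) *
        ((∫⁻ y in shell F δ T.radius, sqVal (f ∘ T.toFun) (0, y)) +
        (∫⁻ x in tubeDom F δ T.radius, gradSq (f ∘ T.toFun) x))) := by
  obtain ⟨a, ha0, ha1, ha⟩ := exists_hausdorffMeasure_eq_smul F volume
  obtain ⟨t, ht1, ht⟩ := exists_finset_directions F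
  refine ⟨2 * (t.card * (((T.K * 4 : ℝ≥0) : ℝ≥0∞) ^ (Module.finrank ℝ F : ℝ) * a)), ?_, ?_⟩
  · exact ENNReal.mul_ne_top (by simp) (ENNReal.mul_ne_top (by simp) (ENNReal.mul_ne_top
      (ENNReal.rpow_ne_top_of_nonneg (by positivity) ENNReal.coe_ne_top) ha1))
  intro δ ℓ hδ hδℓ hℓ hℓR f hf
  have hmem : ∀ z ∈ frontier (T.cut δ) ∩ T.core (2 * ℓ), z ∈ T.img := fun z hz =>
    T.core_subset _ hz.2
  have := setLIntegral_wall_le hF (by positivity) ha ht1 ht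
    (h := f ∘ T.toFun) ((hf.comp T.contDiff_toFun).of_le (by simp)) hδ hδℓ hℓ hℓR
    (Θ := T.toFun.symm) T.toFun.symm.continuous
    (B := frontier (T.cut δ) ∩ T.core (2 * ℓ))
    (isClosed_frontier.measurableSet.inter (T.isOpen_core _).measurableSet) (K := T.K)
    (fun z hz z' hz' => T.edist_symm_le (hmem z hz) (hmem z' hz'))
    (fun z hz => by
      obtain ⟨x, hx, rfl⟩ := hmem z hz
      simpa using (T.mem_frontier_cut_iff hδ hx).1 hz.1)
    (fun z hz => by
      obtain ⟨x, hx, rfl⟩ := hz.2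
      simpa using hx.2)
  have e : ∀ z, sqVal (f ∘ T.toFun) (T.toFun.symm z) = sqVal f z := fun z => by simp [sqVal]
  simp only [e] at this
  refine this.trans_eq ?_
  simp only [mul_assoc]

end TubeChart
end Removal

section Removal
variable {E F : Type*} [NormedAddCommGroup E] [InnerProductSpace ℝ E] [FiniteDimensional ℝ E]
  [MeasurableSpace E] [BorelSpace E]
  [NormedAddCommGroup F] [InnerProductSpace ℝ F] [FiniteDimensional ℝ F]
  [MeasurableSpace F] [BorelSpace F]

namespace TubeChart
variable {Ω : Set E} (T : TubeChart F Ω)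

theorem exists_volume_transfer (hEF : Module.finrank ℝ E = Module.finrank ℝ F + 1) :
    ∃ C : ℝ≥0∞, C ≠ ⊤ ∧ ∀ δ ρ, δ < ρ → ρ ≤ T.radius →
      volume (Ω \ T.cut δ) ≤ C * volume (ball (0 : F) ρ) := by
  have hfr : Module.finrank ℝ E = Module.finrank ℝ (ℝ × F) := by
    rw [Module.finrank_prod, Module.finrank_self, hEF, add_comm]
  obtain ⟨c, hc, hcomp⟩ := exists_lintegral_comp_le E (ℝ × F) volume volume hfr T.K
  refine ⟨c, hc, fun δ ρ hδ hρ => ?_⟩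
  set S : Set (ℝ × F) := Icc 0 1 ×ˢ ball 0 ρ with hS
  have hSm : MeasurableSet S := measurableSet_Icc.prod measurableSet_ball
  have hSd : S ⊆ T.dom := fun x hx => T.mem_dom hx.1 (by
    have := hx.2; rw [mem_ball_zero_iff] at this; linarith)
  have hsub : Ω \ T.cut δ ⊆ T.toFun '' S := by
    rw [cut, sdiff_sdiff_right_self]
    rintro z ⟨_, x, hx, rfl⟩
    exact ⟨x, ⟨hx.2.1, by rw [mem_ball_zero_iff]; linarith [hx.2.2]⟩, rfl⟩
  have h1 := hcomp (T.toFun '' S) (T.measurableSet_image hSm) T.toFun.symm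
    T.toFun.symm.continuous.continuousOn
    (fun z hz z' hz' => T.edist_symm_le (image_mono hSd hz) (image_mono hSd hz'))
    (S.indicator 1) (measurable_one.indicator hSm)
  calc volume (Ω \ T.cut δ) ≤ volume (T.toFun '' S) := measure_mono hsub
    _ = ∫⁻ z in T.toFun '' S, S.indicator 1 (T.toFun.symm z) := by
        rw [← setLIntegral_one]
        refine setLIntegral_congr_fun (T.measurableSet_image hSm) fun z hz => ?_
        obtain ⟨x, hx, rfl⟩ := hz
        simp [indicator_of_mem hx]
    _ ≤ _ := h1
    _ = _ := by
        rw [lintegral_indicator_one hSm, hS, Measure.volume_eq_prod, Measure.prod_prod]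
        simp

theorem exists_area_transfer :
    ∃ C : ℝ≥0∞, C ≠ ⊤ ∧ ∀ ρ, ρ ≤ T.radius →
      μH[(Module.finrank ℝ F : ℝ)] (frontier Ω ∩ T.core ρ) ≤ C * volume (ball (0 : F) ρ) := by
  obtain ⟨a, ha0, ha1, ha⟩ := exists_hausdorffMeasure_eq_smul F volume
  refine ⟨2 * ((T.K : ℝ≥0∞) ^ (Module.finrank ℝ F : ℝ) * a), ENNReal.mul_ne_top (by simp)
    (ENNReal.mul_ne_top (ENNReal.rpow_ne_top_of_nonneg (by positivity) ENNReal.coe_ne_top) ha1),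
    fun ρ hρ => ?_⟩
  have hsub : frontier Ω ∩ T.core ρ ⊆ (fun y => T.toFun (0, y)) '' ball 0 ρ ∪
      (fun y => T.toFun (1, y)) '' ball 0 ρ := by
    rintro z ⟨hz, ⟨τ, y⟩, ⟨hx, hy⟩, rfl⟩
    rcases (T.mem_frontier_iff hx).1 hz with h | h
    · left; exact ⟨y, by simpa using hy, by rw [← h]⟩
    · right; exact ⟨y, by simpa using hy, by rw [← h]⟩
  have hone : ∀ τ ∈ Icc (0 : ℝ) 1, μH[(Module.finrank ℝ F : ℝ)]
      ((fun y => T.toFun (τ, y)) '' ball 0 ρ) ≤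
      (T.K : ℝ≥0∞) ^ (Module.finrank ℝ F : ℝ) * a * volume (ball (0 : F) ρ) := by
    intro τ hτ
    have hL : LipschitzOnWith T.K (fun y => T.toFun (τ, y)) (ball 0 ρ) := by
      intro y hy y' hy'
      rw [mem_ball_zero_iff] at hy hy'
      have := T.lipschitz (T.mem_dom (x := (τ, y)) hτ (by simpa using hy.trans_le hρ))
        (T.mem_dom (x := (τ, y')) hτ (by simpa using hy'.trans_le hρ))
      simpa [Prod.edist_eq] using this
    refine (hL.hausdorffMeasure_image_le (by positivity)).trans_eq ?_
    rw [ha, Measure.smul_apply, smul_eq_mul, mul_assoc]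
  calc _ ≤ _ := measure_mono hsub
    _ ≤ _ := measure_union_le _ _
    _ ≤ _ := add_le_add (hone 0 (by simp)) (hone 1 (by simp))
    _ = _ := by rw [← two_mul]; simp only [mul_assoc]

/-- The cutoff near the tunnel, transported from the model. -/
noncomputable def cutoff (χ : F → ℝ) (z : E) : ℝ :=
  1 - (1 - χ (T.toFun.symm z).2) *
    (⟨1 / 2, 1 / 2 + T.margin, by norm_num, by linarith [T.margin_pos]⟩ :
      ContDiffBump (1 / 2 : ℝ)) (T.toFun.symm z).1

variable {T}

theorem contDiff_cutoff {χ : F → ℝ} (hχ : ContDiff ℝ (⊤ : ℕ∞) χ) :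
    ContDiff ℝ (⊤ : ℕ∞) (T.cutoff χ) :=
  contDiff_const.sub ((contDiff_const.sub (hχ.comp (contDiff_snd.comp T.contDiff_symm))).mul
    ((ContDiffBump.contDiff _).comp (contDiff_fst.comp T.contDiff_symm)))

theorem cutoff_nonneg {χ : F → ℝ} (h0 : ∀ y, 0 ≤ χ y) (z : E) : 0 ≤ T.cutoff χ z := by
  have h2 := (⟨1 / 2, 1 / 2 + T.margin, by norm_num, by linarith [T.margin_pos]⟩ :
    ContDiffBump (1 / 2 : ℝ)).le_one (x := (T.toFun.symm z).1)
  have h3 := (⟨1 / 2, 1 / 2 + T.margin, by norm_num, by linarith [T.margin_pos]⟩ :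
    ContDiffBump (1 / 2 : ℝ)).nonneg (x := (T.toFun.symm z).1)
  have := h0 (T.toFun.symm z).2
  unfold cutoff
  nlinarith

theorem cutoff_le_one {χ : F → ℝ} (h1 : ∀ y, χ y ≤ 1) (z : E) : T.cutoff χ z ≤ 1 := by
  have h3 := (⟨1 / 2, 1 / 2 + T.margin, by norm_num, by linarith [T.margin_pos]⟩ :
    ContDiffBump (1 / 2 : ℝ)).nonneg (x := (T.toFun.symm z).1)
  have := h1 (T.toFun.symm z).2
  unfold cutoff
  nlinarith

theorem cutoff_eq_of_mem {χ : F → ℝ} {z : E} (hz : (T.toFun.symm z).1 ∈ Icc (0 : ℝ) 1) :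
    T.cutoff χ z = χ (T.toFun.symm z).2 := by
  rw [cutoff, ContDiffBump.one_of_mem_closedBall]
  · ring
  · rw [Real.closedBall_eq_Icc]; norm_num; exact hz

theorem mem_core_of_cutoff_ne_one {χ : F → ℝ} {ρ : ℝ} (h1 : ∀ y, ρ ≤ ‖y‖ → χ y = 1)
    (hρ : ρ ≤ T.radius) {z : E} (hz : T.cutoff χ z ≠ 1) : z ∈ T.core ρ := by
  have hy : ‖(T.toFun.symm z).2‖ < ρ := by
    by_contra! hc
    exact hz (by rw [cutoff, h1 _ hc]; ring)
  have hτ : (T.toFun.symm z).1 ∈ Ioo (-T.margin) (1 + T.margin) := by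
    by_contra hc
    refine hz ?_
    rw [cutoff, ContDiffBump.zero_of_le_dist]
    · ring
    · by_contra! hlt
      rw [Real.dist_eq, abs_lt] at hlt
      exact hc ⟨by linarith [hlt.1], by linarith [hlt.2]⟩
  exact ⟨T.toFun.symm z, ⟨⟨hτ, by rw [mem_ball_zero_iff]; linarith⟩, hy⟩, by simp⟩

theorem gradSq_cutoff_le {χ : F → ℝ} (hχ : ContDiff ℝ (⊤ : ℕ∞) χ) {z : E} (hz : z ∈ T.img)
    (hzΩ : z ∈ Ω) : gradSq (T.cutoff χ) z ≤ (T.K : ℝ≥0∞) ^ 2 * gradSq χ (T.toFun.symm z).2 := by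
  have h1 := norm_fderiv_le_of_lipschitzOn ℝ (T.isOpen_img.mem_nhds hz) T.antilipschitz
  have h2 := (hχ.differentiable (by simp) (T.toFun.symm z).2).hasFDerivAt
  have h3 := (T.contDiff_symm.differentiable (by simp) z).hasFDerivAt
  have h4 : HasFDerivAt (fun z => χ (T.toFun.symm z).2)
      ((fderiv ℝ χ (T.toFun.symm z).2).comp
        ((ContinuousLinearMap.snd ℝ ℝ F).comp (fderiv ℝ T.toFun.symm z))) z :=
    h2.comp z (hasFDerivAt_snd.comp z h3)
  have h5 : T.cutoff χ =ᶠ[𝓝 z] fun z => χ (T.toFun.symm z).2 := by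
    have hpos : (T.toFun.symm z).1 ∈ Ioo (0 : ℝ) 1 := by
      obtain ⟨x, hx, rfl⟩ := hz
      simpa using (T.mem_iff x hx).1 hzΩ
    have hcont : Continuous fun z => (T.toFun.symm z).1 :=
      continuous_fst.comp T.toFun.symm.continuous
    filter_upwards [hcont.continuousAt.preimage_mem_nhds (isOpen_Ioo.mem_nhds hpos)] with w hw
    exact cutoff_eq_of_mem (Ioo_subset_Icc_self hw)
  rw [gradSq, gradSq, h5.fderiv_eq, h4.fderiv, ← ENNReal.ofReal_coe_nnreal,
    ← ENNReal.ofReal_pow (NNReal.coe_nonneg _), ← ENNReal.ofReal_mul (by positivity)]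
  refine ENNReal.ofReal_le_ofReal ?_
  rw [← mul_pow]
  refine pow_le_pow_left₀ (norm_nonneg _) ?_ 2
  calc _ ≤ ‖fderiv ℝ χ (T.toFun.symm z).2‖ *
        (‖ContinuousLinearMap.snd ℝ ℝ F‖ * ‖fderiv ℝ T.toFun.symm z‖) :=
        (ContinuousLinearMap.opNorm_comp_le _ _).trans
          (mul_le_mul_of_nonneg_left (ContinuousLinearMap.opNorm_comp_le _ _) (norm_nonneg _))
    _ ≤ ‖fderiv ℝ χ (T.toFun.symm z).2‖ * (1 * T.K) := by
        gcongr
        exact ContinuousLinearMap.norm_snd_le ℝ ℝ F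
    _ = _ := by ring

variable (T)

theorem exists_capacity_transfer (hEF : Module.finrank ℝ E = Module.finrank ℝ F + 1)
    (hΩ : IsOpen Ω) :
    ∃ C : ℝ≥0∞, C ≠ ⊤ ∧ ∀ (χ : F → ℝ), ContDiff ℝ (⊤ : ℕ∞) χ → (∀ y, χ y ≤ 1) →
      (∀ y, T.radius ≤ ‖y‖ → χ y = 1) → ∀ f : E → ℝ, ContDiff ℝ (⊤ : ℕ∞) f →
      ∫⁻ z in Ω, sqVal f z * gradSq (T.cutoff χ) z ≤
        C * ∫⁻ y, colInt (sqVal (f ∘ T.toFun)) y * ENNReal.ofReal (‖fderiv ℝ χ y‖ ^ 2) := by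
  have hfr : Module.finrank ℝ E = Module.finrank ℝ (ℝ × F) := by
    rw [Module.finrank_prod, Module.finrank_self, hEF, add_comm]
  obtain ⟨c, hc, hcomp⟩ := exists_lintegral_comp_le E (ℝ × F) volume volume hfr T.K
  refine ⟨(T.K : ℝ≥0∞) ^ 2 * c, ENNReal.mul_ne_top (ENNReal.pow_ne_top ENNReal.coe_ne_top) hc,
    fun χ hχ hχ1 hχR f hf => ?_⟩
  have hB : MeasurableSet (Ω ∩ T.img) := hΩ.measurableSet.inter T.isOpen_img.measurableSet
  set V : ℝ × F → ℝ≥0∞ := fun x => sqVal (f ∘ T.toFun) x * gradSq χ x.2 with hV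
  have hsq : Measurable (sqVal (f ∘ T.toFun)) :=
    measurable_sqVal (hf.continuous.comp T.toFun.continuous)
  have hgr : Measurable (gradSq χ) := measurable_gradSq (hχ.of_le (by simp))
  have hVm : Measurable V := hsq.mul (hgr.comp measurable_snd)
  set S : Set (ℝ × F) := Ioo 0 1 ×ˢ univ
  have hS : MeasurableSet S := measurableSet_Ioo.prod MeasurableSet.univ
  have h1 := hcomp (Ω ∩ T.img) hB T.toFun.symm T.toFun.symm.continuous.continuousOn
    (fun z hz z' hz' => T.edist_symm_le hz.2 hz'.2) (S.indicator V) (hVm.indicator hS)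
  have hzero : ∀ z, z ∉ T.img → gradSq (T.cutoff χ) z = 0 := by
    intro z hz
    have : T.cutoff χ z = 1 := by
      by_contra hne
      exact hz (T.core_subset _ (mem_core_of_cutoff_ne_one hχR le_rfl hne))
    rw [gradSq, fderiv_eq_zero_of_eq_one (cutoff_le_one hχ1) this]; simp
  calc ∫⁻ z in Ω, sqVal f z * gradSq (T.cutoff χ) z
      ≤ ∫⁻ z in Ω ∩ T.img, sqVal f z * gradSq (T.cutoff χ) z := by
        rw [← lintegral_indicator hΩ.measurableSet, ← lintegral_indicator hB]
        refine lintegral_mono fun z => ?_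
        by_cases hz : z ∈ T.img
        · by_cases hz' : z ∈ Ω
          · rw [indicator_of_mem hz', indicator_of_mem (show z ∈ Ω ∩ T.img from ⟨hz', hz⟩)]
          · rw [indicator_of_notMem hz']; exact bot_le
        · refine le_trans (indicator_le_self _ _ _) ?_
          rw [hzero z hz, mul_zero]; exact bot_le
    _ ≤ ∫⁻ z in Ω ∩ T.img, (T.K : ℝ≥0∞) ^ 2 * S.indicator V (T.toFun.symm z) := by
        refine setLIntegral_mono' hB fun z hz => ?_
        have hmem : T.toFun.symm z ∈ S := by
          obtain ⟨x, hx, rfl⟩ := hz.2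
          have := (T.mem_iff x hx).1 hz.1
          exact ⟨by simpa using this, mem_univ _⟩
        rw [indicator_of_mem hmem, hV]
        have e : sqVal (f ∘ T.toFun) (T.toFun.symm z) = sqVal f z := by simp [sqVal]
        simp only [e]
        rw [mul_left_comm]
        exact mul_le_mul' le_rfl (gradSq_cutoff_le hχ hz.2 hz.1)
    _ = (T.K : ℝ≥0∞) ^ 2 * ∫⁻ z in Ω ∩ T.img, S.indicator V (T.toFun.symm z) :=
        lintegral_const_mul _ ((hVm.indicator hS).comp T.toFun.symm.continuous.measurable)
    _ ≤ (T.K : ℝ≥0∞) ^ 2 * (c * ∫⁻ x, S.indicator V x) := mul_le_mul' le_rfl h1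
    _ = (T.K : ℝ≥0∞) ^ 2 * c * ∫⁻ y, colInt V y := by
        rw [lintegral_indicator hS, mul_assoc, ← setLIntegral_colInt hVm MeasurableSet.univ,
          setLIntegral_univ]
    _ = _ := by
        congr 2
        funext y
        rw [colInt, colInt, hV]
        exact lintegral_mul_const (ENNReal.ofReal (‖fderiv ℝ χ y‖ ^ 2))
          (f := fun τ => sqVal (f ∘ T.toFun) (τ, y)) (hsq.comp measurable_prodMk_right)

end TubeChart
end Removal

theorem exists_pos_mul_ofReal_le {C : ℝ≥0∞} (hC : C ≠ ⊤) {η : ℝ} (hη : 0 < η) :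
    ∃ η' : ℝ, 0 < η' ∧ C * ENNReal.ofReal η' ≤ ENNReal.ofReal η := by
  refine ⟨η / (C.toReal + 1), by positivity, ?_⟩
  rw [← ENNReal.ofReal_toReal hC, ← ENNReal.ofReal_mul (by positivity)]
  apply ENNReal.ofReal_le_ofReal
  rw [ENNReal.toReal_ofReal (by positivity), mul_div_assoc', div_le_iff₀ (by positivity)]
  nlinarith [ENNReal.toReal_nonneg (a := C)]

section Removal
variable {E F : Type*} [NormedAddCommGroup E] [InnerProductSpace ℝ E] [FiniteDimensional ℝ E]
  [MeasurableSpace E] [BorelSpace E]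
  [NormedAddCommGroup F] [InnerProductSpace ℝ F] [FiniteDimensional ℝ F]
  [MeasurableSpace F] [BorelSpace F]
variable {Ω : Set E} (T : TubeChart F Ω)

/-- Removing a thin enough tunnel is an arbitrarily small removal. -/
theorem TubeChart.exists_isSmallRemoval (hF : 2 ≤ Module.finrank ℝ F)
    (hEF : Module.finrank ℝ E = Module.finrank ℝ F + 1) (hΩ : IsOpen Ω) {η : ℝ} (hη : 0 < η) :
    ∃ δ, 0 < δ ∧ δ < T.radius ∧
      ∃ χ : E → ℝ, IsSmallRemoval (Module.finrank ℝ F) η Ω (T.cut δ) χ := by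
  obtain ⟨C₁, hC₁, h₁⟩ := T.exists_energy_transfer hEF hΩ
  obtain ⟨C₂, hC₂, h₂⟩ := T.exists_wall_transfer hF
  obtain ⟨C₃, hC₃, h₃⟩ := T.exists_volume_transfer hEF
  obtain ⟨C₄, hC₄, h₄⟩ := T.exists_area_transfer
  obtain ⟨C₅, hC₅, h₅⟩ := T.exists_capacity_transfer hEF hΩ
  obtain ⟨η', hη', hηη'⟩ := exists_pos_mul_ofReal_le (ENNReal.mul_ne_top hC₅ hC₁) hη
  have hR := T.radius_pos
  have hpos : 0 < ENNReal.ofReal η := ENNReal.ofReal_pos.2 hη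
  have tend : ∀ {C : ℝ≥0∞} {u : ℝ → ℝ≥0∞}, C ≠ ⊤ → Tendsto u (𝓝[>] 0) (𝓝 0) →
      ∀ᶠ ℓ in 𝓝[>] (0 : ℝ), C * u ℓ ≤ ENNReal.ofReal η := by
    intro C u hC hu
    have := ENNReal.Tendsto.const_mul hu (Or.inr hC)
    rw [mul_zero] at this
    exact (this.eventually_lt_const hpos).mono fun _ h => h.le
  have hwall : Tendsto (fun ℓ => ENNReal.ofReal (wallConst T.radius ℓ)) (𝓝[>] 0) (𝓝 0) := by
    simpa using ENNReal.tendsto_ofReal (tendsto_wallConst T.radius hR)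
  have hball := tendsto_volume_ball (F := F) hF
  have hev := (tend (ENNReal.mul_ne_top hC₂ hC₁) hwall).and
    ((tend (ENNReal.mul_ne_top hC₂ (measure_ball_lt_top (μ := (volume : Measure F)) (x := 0)
      (r := T.radius)).ne) hwall).and
    ((tend hC₃ hball).and ((tend hC₄ hball).and
      (Ioo_mem_nhdsGT (lt_min (by norm_num : (0 : ℝ) < 1 / 8) (by positivity : 0 < T.radius / 4))))))
  obtain ⟨ℓ, hw1, hw2, hv, ha, hℓ0, hℓ1⟩ := hev.exists
  have hℓ8 : ℓ ≤ 1 / 8 := hℓ1.le.trans (min_le_left _ _)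
  have hℓR : 4 * ℓ ≤ T.radius := by linarith [hℓ1.le.trans (min_le_right _ _)]
  obtain ⟨r₀, hr0, hrρ, χ, hχ, hχ0, hχ1, hχz, hχo, hχc⟩ :=
    exists_cutoff hF (by positivity : 0 < 2 * ℓ) (by linarith : 2 * ℓ ≤ T.radius) hη'
  have hδ : 0 < min r₀ ℓ := lt_min hr0 hℓ0
  have hδR : min r₀ ℓ < T.radius := (min_le_right _ _).trans_lt (by linarith)
  have htunnel : ∀ z, T.cutoff χ z ≠ 0 → z ∉ T.toFun '' TubeChart.tunnel F (min r₀ ℓ) := by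
    rintro z hz ⟨x, hx, rfl⟩
    refine hz ?_
    rw [TubeChart.cutoff_eq_of_mem (by simpa using hx.2.1)]
    exact hχz _ (by simpa using hx.2.2.trans (min_le_left _ _))
  have hcore : {z | T.cutoff χ z ≠ 1} ⊆ T.core (2 * ℓ) := fun z hz =>
    TubeChart.mem_core_of_cutoff_ne_one hχo (by linarith) hz
  refine ⟨_, hδ, hδR, T.cutoff χ, ⟨T.cut_subset, TubeChart.contDiff_cutoff hχ,
    TubeChart.cutoff_nonneg hχ0, TubeChart.cutoff_le_one hχ1, fun z hz => ?_,
    fun z hz hz' => ⟨hz, htunnel z hz'⟩,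
    (h₃ _ _ ((min_le_right _ _).trans_lt (by linarith)) (by linarith)).trans hv,
    ((measure_mono (inter_subset_inter_right _ hcore)).trans (h₄ _ (by linarith))).trans ha,
    ?_, fun f hf => ?_, fun f hf => ?_⟩⟩
  · have h := htunnel z hz
    have := Set.ext_iff.1 (T.frontier_diff_eq (δ := min r₀ ℓ)) z
    simpa [Set.mem_sdiff, h, -mem_image] using this
  · have hX := h₂ _ ℓ hδ (min_le_right _ _) hℓ8 hℓR (fun _ => 1) contDiff_const
    have e1 : ∀ z, sqVal (fun _ : E => (1 : ℝ)) z = 1 := fun z => by simp [sqVal]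
    have e2 : ∀ y, sqVal ((fun _ : E => (1 : ℝ)) ∘ T.toFun) (0, y) = 1 := fun z => by simp [sqVal]
    have e3 : ∀ x, gradSq ((fun _ : E => (1 : ℝ)) ∘ T.toFun) x = 0 := fun x => by
      have : ((fun _ : E => (1 : ℝ)) ∘ T.toFun) = fun _ => 1 := rfl
      rw [gradSq, this]; simp
    simp only [e1, e2, e3, setLIntegral_one, lintegral_zero, add_zero] at hX
    refine (measure_mono (inter_subset_inter_right _ hcore)).trans (hX.trans (le_trans ?_ hw2))
    rw [mul_assoc, mul_comm (volume _)]
    exact mul_le_mul' le_rfl (mul_le_mul' le_rfl (measure_mono fun y hy => by simpa using hy.2))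
  · refine (lintegral_mono_set (inter_subset_inter_right _ hcore)).trans
      ((h₂ _ ℓ hδ (min_le_right _ _) hℓ8 hℓR f hf).trans ?_)
    refine (mul_le_mul' le_rfl (mul_le_mul' le_rfl (h₁ _ hδ f hf))).trans ?_
    calc _ = (C₂ * C₁ * ENNReal.ofReal (wallConst T.radius ℓ)) *
          steklovEnergy (Module.finrank ℝ F) (T.cut (min r₀ ℓ)) f := by ring
      _ ≤ _ := mul_le_mul' hw1 le_rfl
  · refine (h₅ χ hχ hχ1 (fun y hy => hχo y (by linarith)) f hf).trans ?_
    refine (mul_le_mul' le_rfl (hχc _ hδ (min_le_left _ _) _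
      ((hf.comp T.contDiff_toFun).of_le (by simp)))).trans ?_
    refine (mul_le_mul' le_rfl (mul_le_mul' le_rfl (h₁ _ hδ f hf))).trans ?_
    calc _ = (C₅ * C₁ * ENNReal.ofReal η') *
          steklovEnergy (Module.finrank ℝ F) (T.cut (min r₀ ℓ)) f := by ring
      _ ≤ _ := mul_le_mul' hηη' le_rfl

end Removal

theorem integrableOn_of_continuous {E : Type*} [NormedAddCommGroup E] [ProperSpace E]
    [MeasurableSpace E] [BorelSpace E] {μ : Measure E} {S : Set E}
    (hb : Bornology.IsBounded S) (hS : MeasurableSet S) (hμ : μ S ≠ ⊤) {f : E → ℝ}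
    (hf : Continuous f) : IntegrableOn f S μ := by
  obtain ⟨M, hM⟩ := hb.isCompact_closure.exists_bound_of_continuousOn hf.continuousOn
  exact Measure.integrableOn_of_bounded hμ hf.aestronglyMeasurable
    ((ae_restrict_iff' hS).2 (ae_of_all _ fun x hx => hM x (subset_closure hx)))

section Quotients
variable {n : ℕ} {Ω Ω' : Set (EuclideanSpace ℝ (Fin n))}

/-- The Rayleigh quotients whose infimum is the first nonzero Steklov eigenvalue. -/
def steklovQuotients (Ω : Set (EuclideanSpace ℝ (Fin n))) : Set ℝ :=
  { q : ℝ | ∃ f : EuclideanSpace ℝ (Fin n) → ℝ, ContDiff ℝ (⊤ : ℕ∞) f ∧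
    (∫ x in frontier Ω, f x ∂(μH[(n : ℝ) - 1])) = 0 ∧
    (0 < ∫ x in frontier Ω, (f x) ^ 2 ∂(μH[(n : ℝ) - 1])) ∧
    q = (∫ x in Ω, ‖gradient f x‖ ^ 2) /
        (∫ x in frontier Ω, (f x) ^ 2 ∂(μH[(n : ℝ) - 1])) }

theorem stekSigma1_eq : stekSigma1 Ω = sInf (steklovQuotients Ω) := rfl

theorem nonneg_of_mem_steklovQuotients {q : ℝ} (hq : q ∈ steklovQuotients Ω) : 0 ≤ q := by
  obtain ⟨f, -, -, hD, rfl⟩ := hq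
  exact div_nonneg (integral_nonneg fun _ => by positivity) hD.le

theorem stekSigma1_nonneg : 0 ≤ stekSigma1 Ω :=
  Real.sInf_nonneg fun _ => nonneg_of_mem_steklovQuotients

theorem stekSigma1_le {q : ℝ} (hq : q ∈ steklovQuotients Ω) : stekSigma1 Ω ≤ q :=
  csInf_le ⟨0, fun _ => nonneg_of_mem_steklovQuotients⟩ hq

theorem gradient_sub_const (f : EuclideanSpace ℝ (Fin n) → ℝ) (c : ℝ)
    (x : EuclideanSpace ℝ (Fin n)) : gradient (fun y => f y - c) x = gradient f x := by
  simp only [gradient, fderiv_sub_const]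

/-- The variance of a function along the frontier. -/
noncomputable def bdryVariance (Ω : Set (EuclideanSpace ℝ (Fin n)))
    (f : EuclideanSpace ℝ (Fin n) → ℝ) : ℝ :=
  (∫ x in frontier Ω, f x ^ 2 ∂μH[(n : ℝ) - 1]) -
    (∫ x in frontier Ω, f x ∂μH[(n : ℝ) - 1]) ^ 2 / (μH[(n : ℝ) - 1] (frontier Ω)).toReal

theorem isBounded_frontier (hb : Bornology.IsBounded Ω) : Bornology.IsBounded (frontier Ω) :=
  hb.closure.subset frontier_subset_closure

theorem integrableOn_frontier (hb : Bornology.IsBounded Ω) (hT : μH[(n : ℝ) - 1] (frontier Ω) ≠ ⊤)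
    {f : EuclideanSpace ℝ (Fin n) → ℝ} (hf : Continuous f) :
    IntegrableOn f (frontier Ω) μH[(n : ℝ) - 1] :=
  integrableOn_of_continuous (isBounded_frontier hb) isClosed_frontier.measurableSet hT hf

theorem integral_sub_mean_sq (hb : Bornology.IsBounded Ω)
    (h0 : μH[(n : ℝ) - 1] (frontier Ω) ≠ 0) (hT : μH[(n : ℝ) - 1] (frontier Ω) ≠ ⊤)
    {f : EuclideanSpace ℝ (Fin n) → ℝ} (hf : Continuous f) :
    ∃ c : ℝ, (∫ x in frontier Ω, (f x - c) ∂μH[(n : ℝ) - 1]) = 0 ∧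
      (∫ x in frontier Ω, (f x - c) ^ 2 ∂μH[(n : ℝ) - 1]) = bdryVariance Ω f := by
  set A := (μH[(n : ℝ) - 1] (frontier Ω)).toReal with hA
  have hA0 : 0 < A := ENNReal.toReal_pos h0 hT
  have hreal : μH[(n : ℝ) - 1].real (frontier Ω) = A := rfl
  have hi1 := integrableOn_frontier hb hT hf
  have hi2 : IntegrableOn (fun x => f x ^ 2) (frontier Ω) μH[(n : ℝ) - 1] :=
    integrableOn_frontier hb hT (hf.pow 2)
  have hc : ∀ c : ℝ, IntegrableOn (fun _ => c) (frontier Ω) μH[(n : ℝ) - 1] := fun c =>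
    integrableOn_frontier hb hT continuous_const
  refine ⟨(∫ x in frontier Ω, f x ∂μH[(n : ℝ) - 1]) / A, ?_, ?_⟩
  · rw [integral_sub hi1 (hc _), setIntegral_const, hreal, smul_eq_mul]
    field_simp
    ring
  · set c := (∫ x in frontier Ω, f x ∂μH[(n : ℝ) - 1]) / A with hcdef
    have e : ∀ x, (f x - c) ^ 2 = f x ^ 2 - (2 * c) * f x + c ^ 2 := fun x => by ring
    simp only [e]
    have hi3 : IntegrableOn (fun x => (2 * c) * f x) (frontier Ω) μH[(n : ℝ) - 1] :=
      hi1.const_mul _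
    have hi4 : IntegrableOn (fun x => f x ^ 2 - (2 * c) * f x) (frontier Ω) μH[(n : ℝ) - 1] :=
      hi2.sub hi3
    rw [integral_add hi4 (hc _), integral_sub hi2 hi3,
      setIntegral_const, hreal, smul_eq_mul, integral_const_mul, bdryVariance, ← hA]
    rw [show (∫ x in frontier Ω, f x ∂μH[(n : ℝ) - 1]) = c * A by rw [hcdef]; field_simp]
    field_simp
    ring

theorem quotient_mem (hb : Bornology.IsBounded Ω)
    (h0 : μH[(n : ℝ) - 1] (frontier Ω) ≠ 0) (hT : μH[(n : ℝ) - 1] (frontier Ω) ≠ ⊤)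
    {f : EuclideanSpace ℝ (Fin n) → ℝ} (hf : ContDiff ℝ (⊤ : ℕ∞) f)
    (hpos : 0 < bdryVariance Ω f) :
    (∫ x in Ω, ‖gradient f x‖ ^ 2) / bdryVariance Ω f ∈ steklovQuotients Ω := by
  obtain ⟨c, hc1, hc2⟩ := integral_sub_mean_sq hb h0 hT hf.continuous
  refine ⟨fun x => f x - c, hf.sub contDiff_const, hc1, by rwa [hc2], ?_⟩
  simp only [hc2, gradient_sub_const]

theorem stekSigma1_mul_bdryVariance_le (hb : Bornology.IsBounded Ω)
    (h0 : μH[(n : ℝ) - 1] (frontier Ω) ≠ 0) (hT : μH[(n : ℝ) - 1] (frontier Ω) ≠ ⊤)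
    {f : EuclideanSpace ℝ (Fin n) → ℝ}
    (hf : ContDiff ℝ (⊤ : ℕ∞) f) :
    stekSigma1 Ω * bdryVariance Ω f ≤ ∫ x in Ω, ‖gradient f x‖ ^ 2 := by
  rcases le_or_gt (bdryVariance Ω f) 0 with h | h
  · exact (mul_nonpos_of_nonneg_of_nonpos stekSigma1_nonneg h).trans
      (integral_nonneg fun _ => by positivity)
  · exact (le_div_iff₀ h).1 (stekSigma1_le (quotient_mem hb h0 hT hf h))

theorem steklovQuotients_nonempty (hb : Bornology.IsBounded Ω)
    (h0 : μH[(n : ℝ) - 1] (frontier Ω) ≠ 0) (hT : μH[(n : ℝ) - 1] (frontier Ω) ≠ ⊤)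
    (hn : 2 ≤ n) : (steklovQuotients Ω).Nonempty := by
  have hd : (0 : ℝ) < (n : ℝ) - 1 := by
    have : (2 : ℝ) ≤ n := by exact_mod_cast hn
    linarith
  have := Measure.nullSingletonClass_hausdorff (EuclideanSpace ℝ (Fin n)) hd
  by_contra hempty
  rw [not_nonempty_iff_eq_empty] at hempty
  have hcoord : ∀ i : Fin n, ∃ c : ℝ, ∀ᵐ x ∂(μH[(n : ℝ) - 1]).restrict (frontier Ω), x i = c := by
    intro i
    have hs : ContDiff ℝ (⊤ : ℕ∞) fun x : EuclideanSpace ℝ (Fin n) => x i := by fun_prop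
    obtain ⟨c, hc1, hc2⟩ := integral_sub_mean_sq hb h0 hT hs.continuous
    refine ⟨c, ?_⟩
    have hle : bdryVariance Ω (fun x => x i) ≤ 0 := by
      by_contra! hpos
      have := quotient_mem hb h0 hT hs hpos
      rw [hempty] at this
      exact this
    have hz : (∫ x in frontier Ω, (x i - c) ^ 2 ∂μH[(n : ℝ) - 1]) = 0 :=
      le_antisymm (hc2 ▸ hle) (integral_nonneg fun _ => by positivity)
    rw [integral_eq_zero_iff_of_nonneg (fun _ => by positivity)
      (integrableOn_frontier hb hT (by fun_prop))] at hz
    filter_upwards [hz] with x hx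
    have : (x i - c) ^ 2 = 0 := hx
    linarith [pow_eq_zero_iff (two_ne_zero) |>.1 this]
  choose c hc using hcoord
  have hall : ∀ᵐ x ∂(μH[(n : ℝ) - 1]).restrict (frontier Ω), x = WithLp.toLp 2 c := by
    filter_upwards [ae_all_iff.2 hc] with x hx
    ext i
    exact hx i
  have hnone : ∀ᵐ x ∂(μH[(n : ℝ) - 1]).restrict (frontier Ω), x ≠ WithLp.toLp 2 c :=
    ae_restrict_of_ae (compl_mem_ae_iff.2 (measure_singleton _))
  have hF : ∀ᵐ x ∂(μH[(n : ℝ) - 1]).restrict (frontier Ω), False := by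
    filter_upwards [hall, hnone] with x h1 h2 using h2 h1
  rw [ae_iff] at hF
  simp at hF
  exact h0 hF

end Quotients

section Compare
variable {n : ℕ} {Ω Ω' : Set (EuclideanSpace ℝ (Fin n))} {χ : EuclideanSpace ℝ (Fin n) → ℝ}
  {η : ℝ}

namespace IsSmallRemoval
theorem frontier_inter_one (h : IsSmallRemoval ((n : ℝ) - 1) η Ω Ω' χ) : frontier Ω ∩ {z | χ z = 1} = frontier Ω' ∩ {z | χ z = 1} := by
  ext z
  simp only [mem_inter_iff, Set.mem_ofPred_eq]
  exact and_congr_left fun hz => h.frontier_iff z (by rw [hz]; exact one_ne_zero)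

theorem frontier_ne_top (h : IsSmallRemoval ((n : ℝ) - 1) η Ω Ω' χ)
    (hT : μH[(n : ℝ) - 1] (frontier Ω) ≠ ⊤) :
    μH[(n : ℝ) - 1] (frontier Ω') ≠ ⊤ := by
  have e : frontier Ω' = frontier Ω' ∩ {z | χ z = 1} ∪ frontier Ω' ∩ {z | χ z ≠ 1} := by
    rw [← inter_union_distrib_left]
    exact (inter_eq_left.2 fun z _ => em _).symm
  rw [e, ← h.frontier_inter_one]
  exact ((measure_union_le _ _).trans_lt (ENNReal.add_lt_top.2
    ⟨(measure_mono inter_subset_left).trans_lt hT.lt_top,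
      h.area_le'.trans_lt ENNReal.ofReal_lt_top⟩)).ne

theorem isBounded (h : IsSmallRemoval ((n : ℝ) - 1) η Ω Ω' χ) (hb : Bornology.IsBounded Ω) : Bornology.IsBounded Ω' := hb.subset h.subset

theorem abs_integral_sub_le (h : IsSmallRemoval ((n : ℝ) - 1) η Ω Ω' χ) (hb : Bornology.IsBounded Ω)
    (hT : μH[(n : ℝ) - 1] (frontier Ω) ≠ ⊤)
    (hη : 0 ≤ η) {f : EuclideanSpace ℝ (Fin n) → ℝ} (hf : Continuous f)
    {M : ℝ} (hM0 : 0 ≤ M) (hM : ∀ z ∈ closure Ω, |f z| ≤ M) :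
    |(∫ z in frontier Ω, f z ∂μH[(n : ℝ) - 1]) - ∫ z in frontier Ω', f z ∂μH[(n : ℝ) - 1]| ≤
      2 * M * η := by
  have hm : MeasurableSet {z | χ z = 1} :=
    (isClosed_eq h.contDiff.continuous continuous_const).measurableSet
  have hi := integrableOn_frontier hb hT hf
  have hi' := integrableOn_frontier (h.isBounded hb) (h.frontier_ne_top hT) hf
  rw [← integral_inter_add_sdiff hm hi, ← integral_inter_add_sdiff hm hi', h.frontier_inter_one,
    add_sub_add_left_eq_sub]
  have key : ∀ S : Set (EuclideanSpace ℝ (Fin n)), S ⊆ closure Ω →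
      μH[(n : ℝ) - 1] (S ∩ {z | χ z ≠ 1}) ≤ ENNReal.ofReal η →
      |∫ z in S \ {z | χ z = 1}, f z ∂μH[(n : ℝ) - 1]| ≤ M * η := by
    intro S hS hle
    have h2 := norm_setIntegral_le_of_norm_le_const (f := f) (C := M)
      (hle.trans_lt ENNReal.ofReal_lt_top) (fun z hz => hM z (hS hz.1))
    exact h2.trans (mul_le_mul_of_nonneg_left (ENNReal.toReal_le_of_le_ofReal hη hle) hM0)
  have h1 := key _ frontier_subset_closure h.area_le
  have h2 := key _ (frontier_subset_closure.trans (closure_mono h.subset)) h.area_le'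
  calc _ ≤ _ := abs_sub _ _
    _ ≤ M * η + M * η := add_le_add h1 h2
    _ = _ := by ring

theorem abs_area_sub_le (h : IsSmallRemoval ((n : ℝ) - 1) η Ω Ω' χ) (hb : Bornology.IsBounded Ω)
    (hT : μH[(n : ℝ) - 1] (frontier Ω) ≠ ⊤)
    (hη : 0 ≤ η) : |(μH[(n : ℝ) - 1] (frontier Ω)).toReal -
    (μH[(n : ℝ) - 1] (frontier Ω')).toReal| ≤ 2 * η := by
  have := h.abs_integral_sub_le hb hT hη (f := fun _ => 1) continuous_const zero_le_one
    (fun z _ => by simp)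
  simpa [Measure.real] using this

theorem volume_sub_le (h : IsSmallRemoval ((n : ℝ) - 1) η Ω Ω' χ) (hb : Bornology.IsBounded Ω)
    (hη : 0 ≤ η) : (volume Ω).toReal - (volume Ω').toReal ≤ η := by
  have h1 : volume Ω ≤ volume Ω' + ENNReal.ofReal η := by
    calc volume Ω ≤ volume (Ω' ∪ (Ω \ Ω')) := measure_mono (by rw [union_sdiff_self]; exact subset_union_right)
      _ ≤ _ := (measure_union_le _ _).trans (add_le_add le_rfl h.volume_le)
  have h2 : volume Ω' ≠ ⊤ := ((h.isBounded hb).measure_lt_top).ne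
  have h3 := ENNReal.toReal_mono (ENNReal.add_ne_top.2 ⟨h2, ENNReal.ofReal_ne_top⟩) h1
  rw [ENNReal.toReal_add h2 ENNReal.ofReal_ne_top, ENNReal.toReal_ofReal hη] at h3
  linarith

theorem dirichlet_le (h : IsSmallRemoval ((n : ℝ) - 1) η Ω Ω' χ) (hb : Bornology.IsBounded Ω)
    (hT : μH[(n : ℝ) - 1] (frontier Ω) ≠ ⊤)
    (hΩ : IsOpen Ω) {f : EuclideanSpace ℝ (Fin n) → ℝ}
    (hf : ContDiff ℝ (⊤ : ℕ∞) f) :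
    (∫ x in Ω', ‖gradient f x‖ ^ 2) ≤ ∫ x in Ω, ‖gradient f x‖ ^ 2 := by
  simp only [norm_gradient_eq]
  refine setIntegral_mono_set ?_ (ae_of_all _ fun _ => by positivity)
    (LE.le.eventuallyLE h.subset)
  refine integrableOn_of_continuous hb hΩ.measurableSet hb.measure_lt_top.ne ?_
  exact ((hf.continuous_fderiv (by simp)).norm.pow 2)

end IsSmallRemoval

/-- For small removals, the eigenvalue cannot increase by much. -/
theorem stekSigma1_upper (hn : 2 ≤ n) (hΩ : IsOpen Ω) (hb : Bornology.IsBounded Ω)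
    (h0 : μH[(n : ℝ) - 1] (frontier Ω) ≠ 0) (hT : μH[(n : ℝ) - 1] (frontier Ω) ≠ ⊤)
    {ε : ℝ} (hε : 0 < ε) :
    ∃ η₀ : ℝ, 0 < η₀ ∧ ∀ η Ω' χ, 0 < η → η ≤ η₀ → IsSmallRemoval ((n : ℝ) - 1) η Ω Ω' χ →
      (steklovQuotients Ω').Nonempty ∧ stekSigma1 Ω' < stekSigma1 Ω + ε := by
  have hσ := stekSigma1_nonneg (Ω := Ω)
  obtain ⟨q, ⟨f, hf, hmean, hD, rfl⟩, hlt⟩ := exists_lt_of_csInf_lt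
    (steklovQuotients_nonempty hb h0 hT hn) (show sInf (steklovQuotients Ω) < stekSigma1 Ω + ε by
      rw [stekSigma1_eq]; linarith)
  set D := ∫ x in frontier Ω, f x ^ 2 ∂μH[(n : ℝ) - 1] with hDdef
  set G := ∫ x in Ω, ‖gradient f x‖ ^ 2 with hG
  set A := (μH[(n : ℝ) - 1] (frontier Ω)).toReal with hA
  have hA0 : 0 < A := ENNReal.toReal_pos h0 hT
  obtain ⟨M', hM'⟩ := hb.isCompact_closure.exists_bound_of_continuousOn hf.continuous.continuousOn
  obtain ⟨M, hM0, hM⟩ : ∃ M : ℝ, 0 ≤ M ∧ ∀ z ∈ closure Ω, |f z| ≤ M :=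
    ⟨max M' 0, le_max_right _ _, fun z hz => (hM' z hz).trans (le_max_left _ _)⟩
  have hσε : 0 < stekSigma1 Ω + ε := by linarith
  rw [div_lt_iff₀ hD] at hlt
  have hGD : G / (stekSigma1 Ω + ε) < D := by rw [div_lt_iff₀ hσε]; linarith
  have hG0 : 0 ≤ G := integral_nonneg fun _ => by positivity
  set c := (D + G / (stekSigma1 Ω + ε)) / 2 with hc
  have hcD : c < D := by rw [hc]; linarith
  have hc0 : 0 < c := by have : 0 ≤ G / (stekSigma1 Ω + ε) := by positivity
                         rw [hc]; linarith
  have hGc : G / c < stekSigma1 Ω + ε := by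
    rw [div_lt_iff₀ hc0, ← div_lt_iff₀' hσε, hc]; linarith
  set B := 2 * M ^ 2 + 8 * M ^ 2 / A + 1 with hB
  have hB0 : 0 < B := by positivity
  refine ⟨min 1 (min (A / 4) ((D - c) / B)), lt_min one_pos (lt_min (by positivity)
    (div_pos (by linarith) hB0)), fun η Ω' χ hη hη₀ h => ?_⟩
  have hη1 : η ≤ 1 := hη₀.trans (min_le_left _ _)
  have hηA : η ≤ A / 4 := hη₀.trans ((min_le_right _ _).trans (min_le_left _ _))
  have hηB : η * B ≤ D - c :=
    (le_div_iff₀ hB0).1 (hη₀.trans ((min_le_right _ _).trans (min_le_right _ _)))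
  have harea := abs_le.1 (h.abs_area_sub_le hb hT hη.le)
  have h1 := abs_le.1 (h.abs_integral_sub_le hb hT hη.le hf.continuous hM0 hM)
  have h2 := abs_le.1 (h.abs_integral_sub_le hb hT hη.le (hf.continuous.pow 2) (sq_nonneg M)
    (fun z hz => by rw [Pi.pow_apply, abs_pow]; exact pow_le_pow_left₀ (abs_nonneg _) (hM z hz) 2))
  simp only [Pi.pow_apply] at h2
  rw [← hDdef] at h2
  rw [hmean] at h1
  rw [← hA] at harea
  have hT' := h.frontier_ne_top hT
  have hA' : A / 2 ≤ (μH[(n : ℝ) - 1] (frontier Ω')).toReal := by linarith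
  have h0' : μH[(n : ℝ) - 1] (frontier Ω') ≠ 0 := fun hz => by
    rw [hz, ENNReal.toReal_zero] at hA'; linarith
  have hvar : c ≤ bdryVariance Ω' f := by
    have h3 : (∫ x in frontier Ω', f x ∂μH[(n : ℝ) - 1]) ^ 2 /
        (μH[(n : ℝ) - 1] (frontier Ω')).toReal ≤ (2 * M * η) ^ 2 / (A / 2) := by
      refine div_le_div₀ (by positivity) (sq_le_sq' ?_ ?_) (by positivity) hA' <;> linarith
    have h4 : (2 * M * η) ^ 2 / (A / 2) ≤ 8 * M ^ 2 / A * η := by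
      rw [div_le_iff₀ (by positivity)]
      have : 8 * M ^ 2 / A * η * (A / 2) = 4 * M ^ 2 * η := by field_simp; ring
      rw [this]
      nlinarith [mul_nonneg (mul_nonneg (sq_nonneg M) hη.le) (sub_nonneg.2 hη1)]
    have h5 : η * B = 2 * M ^ 2 * η + 8 * M ^ 2 / A * η + η := by rw [hB]; ring
    rw [bdryVariance]
    linarith
  have hmem := quotient_mem (h.isBounded hb) h0' hT' hf (hc0.trans_le hvar)
  refine ⟨⟨_, hmem⟩, (stekSigma1_le hmem).trans_lt (lt_of_le_of_lt ?_ hGc)⟩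
  exact div_le_div₀ hG0 (h.dirichlet_le hb hT hΩ hf) hc0 hvar

end Compare

theorem setLIntegral_ofReal_eq {α : Type*} [MeasurableSpace α] {μ : Measure α} {S : Set α}
    {u : α → ℝ} (hu : IntegrableOn u S μ) (h0 : ∀ x, 0 ≤ u x) :
    ∫⁻ x in S, ENNReal.ofReal (u x) ∂μ = ENNReal.ofReal (∫ x in S, u x ∂μ) :=
  (ofReal_integral_eq_lintegral_ofReal hu (ae_of_all _ h0)).symm

theorem sq_setIntegral_le {α : Type*} [MeasurableSpace α] {μ : Measure α} {S : Set α}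
    (hS : μ S ≠ ⊤) {u : α → ℝ} (hu : IntegrableOn u S μ) (hu2 : IntegrableOn (fun x => u x ^ 2) S μ) :
    (∫ x in S, u x ∂μ) ^ 2 ≤ μ.real S * ∫ x in S, u x ^ 2 ∂μ := by
  have key : ∀ c : ℝ, 0 ≤ μ.real S * (c * c) + (-2 * ∫ x in S, u x ∂μ) * c +
      ∫ x in S, u x ^ 2 ∂μ := by
    intro c
    have h0 : 0 ≤ ∫ x in S, (u x - c) ^ 2 ∂μ := integral_nonneg fun _ => by positivity
    have hc : IntegrableOn (fun _ => c ^ 2) S μ := integrableOn_const hS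
    have h3 : IntegrableOn (fun x => (2 * c) * u x) S μ := hu.const_mul _
    have h4 : IntegrableOn (fun x => u x ^ 2 - (2 * c) * u x) S μ := hu2.sub h3
    have e : ∀ x, (u x - c) ^ 2 = u x ^ 2 - (2 * c) * u x + c ^ 2 := fun x => by ring
    simp only [e] at h0
    rw [integral_add h4 hc, integral_sub hu2 h3, setIntegral_const, smul_eq_mul,
      integral_const_mul] at h0
    linarith
  have := discrim_le_zero key
  rw [discrim] at this
  nlinarith

section Compare
variable {n : ℕ} {Ω Ω' : Set (EuclideanSpace ℝ (Fin n))} {χ : EuclideanSpace ℝ (Fin n) → ℝ}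
  {η : ℝ}

namespace IsSmallRemoval
theorem setIntegral_frontier_eq (h : IsSmallRemoval ((n : ℝ) - 1) η Ω Ω' χ)
    {u : EuclideanSpace ℝ (Fin n) → ℝ} (hu : ∀ z, χ z = 0 → u z = 0) :
    ∫ z in frontier Ω, u z ∂μH[(n : ℝ) - 1] = ∫ z in frontier Ω', u z ∂μH[(n : ℝ) - 1] := by
  rw [← integral_indicator isClosed_frontier.measurableSet,
    ← integral_indicator isClosed_frontier.measurableSet]
  congr 1
  funext z
  by_cases hz : χ z = 0
  · simp [indicator, hu z hz]
  · by_cases hzf : z ∈ frontier Ω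
    · rw [indicator_of_mem hzf, indicator_of_mem ((h.frontier_iff z hz).1 hzf)]
    · rw [indicator_of_notMem hzf, indicator_of_notMem (mt (h.frontier_iff z hz).2 hzf)]

theorem steklovEnergy_eq (h : IsSmallRemoval ((n : ℝ) - 1) η Ω Ω' χ) (hΩ' : IsOpen Ω')
    (hb : Bornology.IsBounded Ω) (hT : μH[(n : ℝ) - 1] (frontier Ω) ≠ ⊤)
    {f : EuclideanSpace ℝ (Fin n) → ℝ}
    (hf : ContDiff ℝ (⊤ : ℕ∞) f) : steklovEnergy ((n : ℝ) - 1) Ω' f =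
    ENNReal.ofReal ((∫ x in Ω', ‖gradient f x‖ ^ 2) +
      ∫ x in frontier Ω', f x ^ 2 ∂μH[(n : ℝ) - 1]) := by
  rw [ENNReal.ofReal_add (integral_nonneg fun _ => by positivity)
    (integral_nonneg fun _ => by positivity), steklovEnergy]
  simp only [norm_gradient_eq]
  congr 1
  · refine setLIntegral_ofReal_eq (u := fun x => ‖fderiv ℝ f x‖ ^ 2) ?_ fun _ => by positivity
    exact integrableOn_of_continuous (h.isBounded hb) hΩ'.measurableSet
      (h.isBounded hb).measure_lt_top.ne ((hf.continuous_fderiv (by simp)).norm.pow 2)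
  · refine setLIntegral_ofReal_eq (u := fun x => f x ^ 2) ?_ fun _ => by positivity
    exact integrableOn_frontier (h.isBounded hb) (h.frontier_ne_top hT) (hf.continuous.pow 2)

theorem integral_trace_le (h : IsSmallRemoval ((n : ℝ) - 1) η Ω Ω' χ) (hΩ' : IsOpen Ω')
    (hb : Bornology.IsBounded Ω) (hT : μH[(n : ℝ) - 1] (frontier Ω) ≠ ⊤)
    {f : EuclideanSpace ℝ (Fin n) → ℝ}
    (hf : ContDiff ℝ (⊤ : ℕ∞) f)
    (hη : 0 ≤ η) :
    ∫ z in frontier Ω' ∩ {z | χ z ≠ 1}, f z ^ 2 ∂μH[(n : ℝ) - 1] ≤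
      η * ((∫ x in Ω', ‖gradient f x‖ ^ 2) + ∫ x in frontier Ω', f x ^ 2 ∂μH[(n : ℝ) - 1]) := by
  have h1 := h.trace_le f hf
  rw [h.steklovEnergy_eq hΩ' hb hT hf, ← ENNReal.ofReal_mul hη] at h1
  have hi : IntegrableOn (fun z => f z ^ 2) (frontier Ω' ∩ {z | χ z ≠ 1}) μH[(n : ℝ) - 1] :=
    (integrableOn_frontier (h.isBounded hb) (h.frontier_ne_top hT) (hf.continuous.pow 2)).mono_set
      inter_subset_left
  have h2 := setLIntegral_ofReal_eq hi fun _ => by positivity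
  simp only [sqVal] at h1
  rw [h2] at h1
  exact (ENNReal.ofReal_le_ofReal_iff (mul_nonneg hη (add_nonneg (integral_nonneg fun _ => by positivity)
    (integral_nonneg fun _ => by positivity)))).1 h1

theorem integral_capacity_le (h : IsSmallRemoval ((n : ℝ) - 1) η Ω Ω' χ) (hΩ : IsOpen Ω)
    (hΩ' : IsOpen Ω') (hb : Bornology.IsBounded Ω)
    (hT : μH[(n : ℝ) - 1] (frontier Ω) ≠ ⊤)
    {f : EuclideanSpace ℝ (Fin n) → ℝ}
    (hf : ContDiff ℝ (⊤ : ℕ∞) f)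
    (hη : 0 ≤ η) :
    ∫ z in Ω, f z ^ 2 * ‖fderiv ℝ χ z‖ ^ 2 ≤
      η * ((∫ x in Ω', ‖gradient f x‖ ^ 2) + ∫ x in frontier Ω', f x ^ 2 ∂μH[(n : ℝ) - 1]) := by
  have h1 := h.capacity_le f hf
  rw [h.steklovEnergy_eq hΩ' hb hT hf, ← ENNReal.ofReal_mul hη] at h1
  have hi : IntegrableOn (fun z => f z ^ 2 * ‖fderiv ℝ χ z‖ ^ 2) Ω :=
    integrableOn_of_continuous hb hΩ.measurableSet hb.measure_lt_top.ne
      ((hf.continuous.pow 2).mul ((h.contDiff.continuous_fderiv (by simp)).norm.pow 2))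
  have h2 := setLIntegral_ofReal_eq hi fun _ => by positivity
  have e : ∀ z, sqVal f z * gradSq χ z = ENNReal.ofReal (f z ^ 2 * ‖fderiv ℝ χ z‖ ^ 2) := fun z => by
    rw [sqVal, gradSq, ENNReal.ofReal_mul (sq_nonneg _)]
  simp only [e] at h1
  rw [h2] at h1
  exact (ENNReal.ofReal_le_ofReal_iff (mul_nonneg hη (add_nonneg (integral_nonneg fun _ => by positivity)
    (integral_nonneg fun _ => by positivity)))).1 h1

theorem dirichlet_mul_le (h : IsSmallRemoval ((n : ℝ) - 1) η Ω Ω' χ) (hΩ : IsOpen Ω)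
    (hΩ' : IsOpen Ω') (hb : Bornology.IsBounded Ω)
    (hT : μH[(n : ℝ) - 1] (frontier Ω) ≠ ⊤)
    {f : EuclideanSpace ℝ (Fin n) → ℝ}
    (hf : ContDiff ℝ (⊤ : ℕ∞) f)
    {t : ℝ} (ht : 0 < t) (hη : 0 ≤ η) :
    ∫ z in Ω, ‖gradient (fun z => χ z * f z) z‖ ^ 2 ≤
      (1 + t) * (∫ x in Ω', ‖gradient f x‖ ^ 2) + (1 + 1 / t) *
      (η * ((∫ x in Ω', ‖gradient f x‖ ^ 2) + ∫ x in frontier Ω', f x ^ 2 ∂μH[(n : ℝ) - 1])) := by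
  have hcap := h.integral_capacity_le hΩ hΩ' hb hT hf hη
  simp only [norm_gradient_eq] at hcap ⊢
  have hcf : Continuous fun z => ‖fderiv ℝ f z‖ ^ 2 := (hf.continuous_fderiv (by simp)).norm.pow 2
  have hcg : ContDiff ℝ (⊤ : ℕ∞) fun z => χ z * f z := h.contDiff.mul hf
  have hi1 : IntegrableOn (fun z => ‖fderiv ℝ (fun z => χ z * f z) z‖ ^ 2) Ω :=
    integrableOn_of_continuous hb hΩ.measurableSet hb.measure_lt_top.ne
      ((hcg.continuous_fderiv (by simp)).norm.pow 2)
  have hi2 : IntegrableOn (fun z => f z ^ 2 * ‖fderiv ℝ χ z‖ ^ 2) Ω :=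
    integrableOn_of_continuous hb hΩ.measurableSet hb.measure_lt_top.ne
      ((hf.continuous.pow 2).mul ((h.contDiff.continuous_fderiv (by simp)).norm.pow 2))
  have hi3 : IntegrableOn (Ω'.indicator fun z => ‖fderiv ℝ f z‖ ^ 2) Ω :=
    (integrableOn_of_continuous hb hΩ.measurableSet hb.measure_lt_top.ne hcf).indicator
      hΩ'.measurableSet
  have hind : ∫ z in Ω, Ω'.indicator (fun z => ‖fderiv ℝ f z‖ ^ 2) z =
      ∫ z in Ω', ‖fderiv ℝ f z‖ ^ 2 := by
    rw [setIntegral_indicator hΩ'.measurableSet, inter_eq_right.2 h.subset]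
  have hpt : ∀ z ∈ Ω, ‖fderiv ℝ (fun z => χ z * f z) z‖ ^ 2 ≤
      (1 + t) * Ω'.indicator (fun z => ‖fderiv ℝ f z‖ ^ 2) z +
        (1 + 1 / t) * (f z ^ 2 * ‖fderiv ℝ χ z‖ ^ 2) := by
    intro z hz
    have hd : fderiv ℝ (fun z => χ z * f z) z = χ z • fderiv ℝ f z + f z • fderiv ℝ χ z :=
      fderiv_fun_mul (h.contDiff.differentiable (by simp) z) (hf.differentiable (by simp) z)
    set a := |χ z| * ‖fderiv ℝ f z‖ with ha
    set b := |f z| * ‖fderiv ℝ χ z‖ with hb'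
    have hn : ‖fderiv ℝ (fun z => χ z * f z) z‖ ≤ a + b := by
      rw [hd]
      refine (norm_add_le _ _).trans (le_of_eq ?_)
      rw [norm_smul, norm_smul, Real.norm_eq_abs, Real.norm_eq_abs]
    have hab : (a + b) ^ 2 ≤ (1 + t) * a ^ 2 + (1 + 1 / t) * b ^ 2 := by
      have : (1 + t) * a ^ 2 + (1 + 1 / t) * b ^ 2 - (a + b) ^ 2 = (t * a - b) ^ 2 / t := by
        field_simp; ring
      have : 0 ≤ (t * a - b) ^ 2 / t := by positivity
      linarith
    have hb2 : b ^ 2 = f z ^ 2 * ‖fderiv ℝ χ z‖ ^ 2 := by rw [hb', mul_pow, sq_abs]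
    have ha2 : a ^ 2 ≤ Ω'.indicator (fun z => ‖fderiv ℝ f z‖ ^ 2) z := by
      rw [ha, mul_pow, sq_abs]
      by_cases hχ : χ z = 0
      · rw [hχ]
        simpa using indicator_nonneg (fun _ _ => by positivity) z
      · rw [indicator_of_mem (h.mem z hz hχ)]
        refine mul_le_of_le_one_left (by positivity) ?_
        exact pow_le_one₀ (h.nonneg z) (h.le_one z)
    calc _ ≤ (a + b) ^ 2 := pow_le_pow_left₀ (norm_nonneg _) hn 2
      _ ≤ _ := hab
      _ ≤ _ := by rw [hb2]; gcongr
  have hi4 : IntegrableOn (fun z => (1 + t) * Ω'.indicator (fun z => ‖fderiv ℝ f z‖ ^ 2) z) Ω :=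
    hi3.const_mul _
  have hi5 : IntegrableOn (fun z => (1 + 1 / t) * (f z ^ 2 * ‖fderiv ℝ χ z‖ ^ 2)) Ω :=
    hi2.const_mul _
  calc _ ≤ ∫ z in Ω, ((1 + t) * Ω'.indicator (fun z => ‖fderiv ℝ f z‖ ^ 2) z +
        (1 + 1 / t) * (f z ^ 2 * ‖fderiv ℝ χ z‖ ^ 2)) :=
        setIntegral_mono_on hi1 (hi4.add hi5) hΩ.measurableSet hpt
    _ = (1 + t) * (∫ x in Ω', ‖fderiv ℝ f x‖ ^ 2) +
        (1 + 1 / t) * ∫ z in Ω, f z ^ 2 * ‖fderiv ℝ χ z‖ ^ 2 := by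
        rw [integral_add hi4 hi5, integral_const_mul,
          integral_const_mul, hind]
    _ ≤ _ := by gcongr

theorem bdryVariance_mul_ge (h : IsSmallRemoval ((n : ℝ) - 1) η Ω Ω' χ) (hΩ : IsOpen Ω)
    (hΩ' : IsOpen Ω') (hb : Bornology.IsBounded Ω)
    (hT : μH[(n : ℝ) - 1] (frontier Ω) ≠ ⊤)
    {f : EuclideanSpace ℝ (Fin n) → ℝ}
    (hf : ContDiff ℝ (⊤ : ℕ∞) f)
    (hη : 0 ≤ η) (h0 : μH[(n : ℝ) - 1] (frontier Ω) ≠ 0)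
    (hmean : ∫ x in frontier Ω', f x ∂μH[(n : ℝ) - 1] = 0) :
    (∫ x in frontier Ω', f x ^ 2 ∂μH[(n : ℝ) - 1]) - (η + η ^ 2 / (μH[(n : ℝ) - 1] (frontier Ω)).toReal) *
      ((∫ x in Ω', ‖gradient f x‖ ^ 2) + ∫ x in frontier Ω', f x ^ 2 ∂μH[(n : ℝ) - 1]) ≤
    bdryVariance Ω (fun z => χ z * f z) := by
  set A := (μH[(n : ℝ) - 1] (frontier Ω)).toReal with hA
  have hA0 : 0 < A := ENNReal.toReal_pos h0 hT
  have htr := h.integral_trace_le hΩ' hb hT hf hη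
  set X := (∫ x in Ω', ‖gradient f x‖ ^ 2) + ∫ x in frontier Ω', f x ^ 2 ∂μH[(n : ℝ) - 1] with hX
  have hT' := h.frontier_ne_top hT
  have hb' := h.isBounded hb
  set S := frontier Ω' ∩ {z | χ z ≠ 1} with hS
  have hχc := h.contDiff.continuous
  have hSm : MeasurableSet S := isClosed_frontier.measurableSet.inter
    (isClosed_eq hχc continuous_const).isOpen_compl.measurableSet
  have h_int : ∀ {u : EuclideanSpace ℝ (Fin n) → ℝ}, Continuous u →
      IntegrableOn u (frontier Ω') μH[(n : ℝ) - 1] := fun hu => integrableOn_frontier hb' hT' hu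
  have hST : μH[(n : ℝ) - 1] S ≠ ⊤ := ((measure_mono inter_subset_left).trans_lt hT'.lt_top).ne
  have hSη : (μH[(n : ℝ) - 1]).real S ≤ η := ENNReal.toReal_le_of_le_ofReal hη h.area_le'
  have hfc := hf.continuous
  have hf2 : IntegrableOn (fun x => f x ^ 2) (frontier Ω') μH[(n : ℝ) - 1] := h_int (hfc.pow 2)
  have hf2S : IntegrableOn (S.indicator fun x => f x ^ 2) (frontier Ω') μH[(n : ℝ) - 1] :=
    hf2.indicator hSm
  have hu : Continuous fun z => (χ z - 1) * f z := (hχc.sub continuous_const).mul hfc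
  have hui : IntegrableOn (fun z => (χ z - 1) * f z) (frontier Ω') μH[(n : ℝ) - 1] := h_int hu
  have hsq : (∫ x in frontier Ω', f x ^ 2 ∂μH[(n : ℝ) - 1]) - η * X ≤
      ∫ z in frontier Ω, (χ z * f z) ^ 2 ∂μH[(n : ℝ) - 1] := by
    rw [h.setIntegral_frontier_eq (u := fun z => (χ z * f z) ^ 2) (fun z hz => by simp [hz])]
    have h1 : ∫ x in frontier Ω', (f x ^ 2 - S.indicator (fun x => f x ^ 2) x) ∂μH[(n : ℝ) - 1] ≤
        ∫ z in frontier Ω', (χ z * f z) ^ 2 ∂μH[(n : ℝ) - 1] := by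
      refine setIntegral_mono_on (hf2.sub hf2S)
        (h_int ((hχc.mul hfc).pow 2)) isClosed_frontier.measurableSet fun z hz => ?_
      by_cases hz1 : χ z = 1
      · rw [indicator_of_notMem (fun hzS => hzS.2 hz1), hz1]; simp
      · rw [indicator_of_mem (show z ∈ S from ⟨hz, hz1⟩), sub_self]; positivity
    have h2 : ∫ x in frontier Ω', (f x ^ 2 - S.indicator (fun x => f x ^ 2) x) ∂μH[(n : ℝ) - 1] =
        (∫ x in frontier Ω', f x ^ 2 ∂μH[(n : ℝ) - 1]) - ∫ x in S, f x ^ 2 ∂μH[(n : ℝ) - 1] := by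
      rw [integral_sub hf2 hf2S,
        setIntegral_indicator hSm, inter_eq_right.2 inter_subset_left]
    linarith
  have hm : (∫ z in frontier Ω, χ z * f z ∂μH[(n : ℝ) - 1]) ^ 2 ≤ η * (η * X) := by
    have e1 : ∫ z in frontier Ω, χ z * f z ∂μH[(n : ℝ) - 1] =
        ∫ z in S, (χ z - 1) * f z ∂μH[(n : ℝ) - 1] := by
      rw [h.setIntegral_frontier_eq (u := fun z => χ z * f z) (fun z hz => by simp [hz])]
      have e : ∀ z, χ z * f z = (χ z - 1) * f z + f z := fun z => by ring
      simp only [e]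
      rw [integral_add hui (h_int hfc), hmean, add_zero]
      refine setIntegral_eq_of_subset_of_forall_sdiff_eq_zero isClosed_frontier.measurableSet
        inter_subset_left fun z hz => ?_
      have : χ z = 1 := by
        by_contra hne
        exact hz.2 ⟨hz.1, hne⟩
      rw [this]; ring
    rw [e1]
    refine (sq_setIntegral_le hST ((h_int hu).mono_set inter_subset_left)
      ((h_int (hu.pow 2)).mono_set inter_subset_left)).trans ?_
    refine mul_le_mul hSη (le_trans ?_ htr) (integral_nonneg fun _ => by positivity) hη
    refine setIntegral_mono_on ((h_int (hu.pow 2)).mono_set inter_subset_left)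
      ((h_int (hfc.pow 2)).mono_set inter_subset_left) hSm fun z _ => ?_
    rw [mul_pow]
    refine mul_le_of_le_one_left (sq_nonneg _) ?_
    nlinarith [h.nonneg z, h.le_one z]
  rw [bdryVariance, ← hA]
  have h3 := div_le_div_of_nonneg_right hm hA0.le
  have h4 : (η + η ^ 2 / A) * X = η * X + η * (η * X) / A := by ring
  rw [h4]
  linarith

end IsSmallRemoval

/-- For small removals, the eigenvalue cannot decrease by much. -/
theorem stekSigma1_lower (hΩ : IsOpen Ω) (hb : Bornology.IsBounded Ω)
    (h0 : μH[(n : ℝ) - 1] (frontier Ω) ≠ 0) (hT : μH[(n : ℝ) - 1] (frontier Ω) ≠ ⊤)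
    {ε : ℝ} (hε : 0 < ε) :
    ∃ η₀ : ℝ, 0 < η₀ ∧ ∀ η Ω' χ, 0 < η → η ≤ η₀ → IsOpen Ω' →
      IsSmallRemoval ((n : ℝ) - 1) η Ω Ω' χ → (steklovQuotients Ω').Nonempty →
      stekSigma1 Ω - ε ≤ stekSigma1 Ω' := by
  set σ := stekSigma1 Ω with hσdef
  have hσ : 0 ≤ σ := stekSigma1_nonneg
  set A := (μH[(n : ℝ) - 1] (frontier Ω)).toReal with hA
  have hA0 : 0 < A := ENNReal.toReal_pos h0 hT
  set K := σ * (σ + 1) * (1 + 1 / A) + σ + 2 * (σ + 1) with hK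
  have hK0 : 0 < K := by positivity
  refine ⟨(min 1 (ε / K)) ^ 2, by positivity, fun η Ω' χ hη hη₀ hΩ' h hne => ?_⟩
  refine le_csInf hne ?_
  rintro q ⟨f, hf, hmean, hD, rfl⟩
  obtain ⟨t, ht0, rfl⟩ : ∃ t : ℝ, 0 < t ∧ η = t ^ 2 :=
    ⟨√η, Real.sqrt_pos.2 hη, (Real.sq_sqrt hη.le).symm⟩
  have htle : t ≤ min 1 (ε / K) := le_of_sq_le_sq hη₀ (by positivity)
  have ht1 : t ≤ 1 := htle.trans (min_le_left _ _)
  have htK : t * K ≤ ε := (le_div_iff₀ hK0).1 (htle.trans (min_le_right _ _))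
  have hvar := h.bdryVariance_mul_ge hΩ hΩ' hb hT hf hη.le h0 hmean
  have hdir := h.dirichlet_mul_le hΩ hΩ' hb hT hf ht0 hη.le
  have hmain := stekSigma1_mul_bdryVariance_le hb h0 hT (h.contDiff.mul hf)
  rw [← hσdef] at hmain
  set D := ∫ x in frontier Ω', f x ^ 2 ∂μH[(n : ℝ) - 1] with hDdef
  set G := ∫ x in Ω', ‖gradient f x‖ ^ 2 with hG
  rw [← hA] at hvar
  have hG0 : 0 ≤ G := integral_nonneg fun _ => by positivity
  rw [le_div_iff₀ hD]
  rcases le_or_gt (σ * D) G with hle | hlt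
  · nlinarith
  have hXD : G + D ≤ (σ + 1) * D := by linarith
  have e1 : (1 + 1 / t) * (t ^ 2 * (G + D)) = (t ^ 2 + t) * (G + D) := by field_simp
  rw [e1] at hdir
  have h1 := mul_le_mul_of_nonneg_left hvar hσ
  have h2 : (t ^ 2 + t) * (G + D) ≤ 2 * t * ((σ + 1) * D) :=
    mul_le_mul (by nlinarith) hXD (by linarith) (by positivity)
  have h3 : (t ^ 2 + (t ^ 2) ^ 2 / A) * (G + D) ≤ t * (1 + 1 / A) * ((σ + 1) * D) := by
    refine mul_le_mul ?_ hXD (by linarith) (by positivity)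
    have : (t ^ 2) ^ 2 / A ≤ t / A := by
      gcongr
      have : t ^ 2 ≤ 1 := pow_le_one₀ ht0.le ht1
      nlinarith
    have e : t * (1 + 1 / A) = t + t / A := by ring
    rw [e]
    nlinarith
  have h4 := mul_le_mul_of_nonneg_left h3 hσ
  have h5 : t * K * D ≤ ε * D := mul_le_mul_of_nonneg_right htK hD.le
  have h6 : t * K * D = σ * (t * (1 + 1 / A) * ((σ + 1) * D)) + t * (σ * D) +
      2 * t * ((σ + 1) * D) := by rw [hK]; ring
  have h7 : t * G ≤ t * (σ * D) := mul_le_mul_of_nonneg_left hlt.le ht0.le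
  nlinarith

end Compare

theorem TubeChart.hausdorffMeasure_frontier_ne_zero {E F : Type*} [NormedAddCommGroup E]
    [InnerProductSpace ℝ E] [MeasurableSpace E] [BorelSpace E]
    [NormedAddCommGroup F] [InnerProductSpace ℝ F] [FiniteDimensional ℝ F]
    [MeasurableSpace F] [BorelSpace F] {Ω : Set E} (T : TubeChart F Ω) :
    μH[(Module.finrank ℝ F : ℝ)] (frontier Ω) ≠ 0 := by
  intro h0
  obtain ⟨a, ha0, ha1, ha⟩ := exists_hausdorffMeasure_eq_smul F volume
  have hl : LipschitzOnWith (1 * T.K) (fun z => (T.toFun.symm z).2) (frontier Ω ∩ T.img) :=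
    (LipschitzWith.prod_snd.comp_lipschitzOnWith T.antilipschitz).mono inter_subset_right
  have h1 := hl.hausdorffMeasure_image_le (d := Module.finrank ℝ F) (by positivity)
  rw [measure_mono_null inter_subset_left h0, mul_zero] at h1
  have h2 : ball (0 : F) T.radius ⊆ (fun z => (T.toFun.symm z).2) '' (frontier Ω ∩ T.img) := by
    intro y hy
    have hd : ((0 : ℝ), y) ∈ T.dom := T.mem_dom (by simp) (by simpa using hy)
    exact ⟨T.toFun (0, y), ⟨(T.mem_frontier_iff hd).2 (Or.inl rfl), _, hd, rfl⟩, by simp⟩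
  have h3 := le_antisymm ((measure_mono h2).trans h1) bot_le
  rw [ha, Measure.smul_apply, smul_eq_mul, mul_eq_zero] at h3
  exact h3.elim ha0 (measure_ball_pos volume _ T.radius_pos).ne'

/-- Along a tube chart, one can remove a tunnel which hardly changes the geometry. -/
theorem TubeChart.exists_cut_close {n : ℕ} (hn : 3 ≤ n) {Ω : Set (EuclideanSpace ℝ (Fin n))}
    (hΩ : IsOpen Ω) (hb : Bornology.IsBounded Ω) (hT : μH[(n : ℝ) - 1] (frontier Ω) ≠ ⊤)
    (T : TubeChart (EuclideanSpace ℝ (Fin (n - 1))) Ω) {ε : ℝ} (hε : 0 < ε) :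
    ∃ δ, 0 < δ ∧ δ < T.radius ∧ (volume Ω).toReal - (volume (T.cut δ)).toReal < ε ∧
      |(μH[(n : ℝ) - 1] (frontier Ω)).toReal - (μH[(n : ℝ) - 1] (frontier (T.cut δ))).toReal| < ε ∧
      |stekSigma1 Ω - stekSigma1 (T.cut δ)| < ε := by
  have hdim : (Module.finrank ℝ (EuclideanSpace ℝ (Fin (n - 1))) : ℝ) = (n : ℝ) - 1 := by
    rw [finrank_euclideanSpace_fin, Nat.cast_sub (by omega), Nat.cast_one]
  have h0 := T.hausdorffMeasure_frontier_ne_zero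
  rw [hdim] at h0
  obtain ⟨η₁, hη₁, h₁⟩ := stekSigma1_upper (by omega) hΩ hb h0 hT hε
  obtain ⟨η₂, hη₂, h₂⟩ := stekSigma1_lower hΩ hb h0 hT (half_pos hε)
  obtain ⟨δ, hδ, hδR, χ, h⟩ := T.exists_isSmallRemoval (η := min (min η₁ η₂) (ε / 4))
    (by rw [finrank_euclideanSpace_fin]; omega)
    (by rw [finrank_euclideanSpace_fin, finrank_euclideanSpace_fin]; omega) hΩ
    (lt_min (lt_min hη₁ hη₂) (by positivity))
  rw [hdim] at h
  set η := min (min η₁ η₂) (ε / 4)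
  have hη : 0 < η := lt_min (lt_min hη₁ hη₂) (by positivity)
  have hηε : η ≤ ε / 4 := min_le_right _ _
  obtain ⟨hne, hup⟩ := h₁ η _ χ hη ((min_le_left _ _).trans (min_le_left _ _)) h
  have hlow := h₂ η _ χ hη ((min_le_left _ _).trans (min_le_right _ _)) (T.isOpen_cut hΩ) h hne
  have hv := h.volume_sub_le hb hη.le
  have ha := h.abs_area_sub_le hb hT hη.le
  refine ⟨δ, hδ, hδR, by linarith, by linarith, abs_lt.2 ⟨by linarith, by linarith⟩⟩

section Graph
variable {F : Type*} [NormedAddCommGroup F] [InnerProductSpace ℝ F] [FiniteDimensional ℝ F]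

/-- Multiplying by a bump function extends a local smooth function to a global one. -/
theorem exists_contDiff_extension {φ : F → ℝ} {b a : ℝ} (hb : 0 < b) (ha : 0 < a)
    (hφ : ∀ y, ‖y‖ < b → ContDiffAt ℝ (⊤ : ℕ∞) φ y) (hφa : ∀ y, ‖y‖ < b → |φ y| < a) :
    ∃ φ' : F → ℝ, ContDiff ℝ (⊤ : ℕ∞) φ' ∧ (∀ y, |φ' y| < a) ∧ ∀ y, ‖y‖ < b / 4 → φ' y = φ y := by
  set β : ContDiffBump (0 : F) := ⟨b / 4, b / 2, by positivity, by linarith⟩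
  refine ⟨fun y => β y * φ y, contDiff_iff_contDiffAt.2 fun y => ?_, fun y => ?_, fun y hy => ?_⟩
  · rcases lt_or_ge ‖y‖ b with hy | hy
    · exact β.contDiffAt.mul (hφ y hy)
    · have h1 : ∀ᶠ z in 𝓝 y, b / 2 < ‖z‖ :=
        continuous_norm.continuousAt.eventually_const_lt (by linarith)
      refine (contDiffAt_const (c := (0 : ℝ))).congr_of_eventuallyEq ?_
      filter_upwards [h1] with z hz
      rw [β.zero_of_le_dist (by rw [dist_zero_right]; exact hz.le), zero_mul]
  · rcases lt_or_ge ‖y‖ b with hy | hy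
    · rw [abs_mul, abs_of_nonneg β.nonneg]
      exact (mul_le_of_le_one_left (abs_nonneg _) β.le_one).trans_lt (hφa y hy)
    · simp only
      rw [β.zero_of_le_dist (by rw [dist_zero_right]; show b / 2 ≤ _; linarith), zero_mul, abs_zero]
      exact ha
  · simp only
    rw [β.one_of_mem_closedBall (by simpa using hy.le), one_mul]

/-- The zero set of a function with negative derivative in the first direction is locally a
graph. -/
theorem exists_graph_model {G : ℝ × F → ℝ} (hG : ContDiff ℝ (⊤ : ℕ∞) G) (h0 : G 0 = 0)
    (hG1 : fderiv ℝ G 0 (1, 0) < 0) {U : Set (ℝ × F)} (hU : U ∈ 𝓝 0) {a₀ : ℝ} (ha₀ : 0 < a₀) :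
    ∃ a b, 0 < a ∧ a ≤ a₀ ∧ 0 < b ∧ ∃ φ : F → ℝ, ContDiff ℝ (⊤ : ℕ∞) φ ∧ φ 0 = 0 ∧
      (∀ y, |φ y| < a / 2) ∧ ∀ t y, |t| < a → ‖y‖ < b →
        (t, y) ∈ U ∧ (G (t, y) < 0 ↔ φ y < t) ∧ (G (t, y) = 0 ↔ t = φ y) := by
  have hfc : Continuous fun x => fderiv ℝ G x (1, 0) :=
    (hG.continuous_fderiv (by simp)).clm_apply continuous_const
  have hneg : ∀ᶠ x in 𝓝 (0 : ℝ × F), fderiv ℝ G x (1, 0) < 0 :=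
    hfc.continuousAt.eventually_lt_const hG1
  set H : ℝ × F → ℝ × F := fun x => (G x, x.2) with hH
  have hHs : ContDiff ℝ (⊤ : ℕ∞) H := hG.prodMk contDiff_snd
  have hequiv : ∀ x, fderiv ℝ G x (1, 0) < 0 →
      ∃ e : (ℝ × F) ≃L[ℝ] ℝ × F, HasFDerivAt H (e : (ℝ × F) →L[ℝ] ℝ × F) x := by
    intro x hx
    have hd : HasFDerivAt H ((fderiv ℝ G x).prod (ContinuousLinearMap.snd ℝ ℝ F)) x :=
      ((hG.differentiable (by simp) x).hasFDerivAt).prodMk hasFDerivAt_snd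
    have hinj : Function.Injective ((fderiv ℝ G x).prod (ContinuousLinearMap.snd ℝ ℝ F)) := by
      rw [injective_iff_map_eq_zero]
      rintro ⟨s, v⟩ hsv
      have hv : v = 0 := (Prod.ext_iff.1 hsv).2
      have hs : fderiv ℝ G x (s, v) = 0 := (Prod.ext_iff.1 hsv).1
      have e : ((s, v) : ℝ × F) = s • ((1 : ℝ), (0 : F)) := by simp [hv]
      rw [e, map_smul, smul_eq_mul, mul_eq_zero] at hs
      rw [hv, hs.resolve_right hx.ne]; rfl
    refine ⟨(LinearEquiv.ofInjectiveEndo _ hinj).toContinuousLinearEquiv, ?_⟩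
    exact hd
  obtain ⟨e₀, he₀⟩ := hequiv 0 hG1
  set e := hHs.contDiffAt.toOpenPartialHomeomorph H he₀ (by simp) with he
  have hecoe : ∀ x, e x = H x := fun x => rfl
  have hH0 : H 0 = 0 := by rw [hH]; simp [h0]
  have hsrc : (0 : ℝ × F) ∈ e.source :=
    ContDiffAt.mem_toOpenPartialHomeomorph_source hHs.contDiffAt he₀ (by simp)
  have htgt : (0 : ℝ × F) ∈ e.target := by
    have := e.map_source hsrc
    rwa [hecoe, hH0] at this
  have hsymm0 : e.symm 0 = 0 := by
    have := e.left_inv hsrc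
    rwa [hecoe, hH0] at this
  set φ : F → ℝ := fun y => (e.symm (0, y)).1 with hφ
  have hι : Tendsto (fun y : F => ((0 : ℝ), y)) (𝓝 0) (𝓝 0) :=
    Continuous.tendsto' (by fun_prop) _ _ rfl
  have hsymmc : Tendsto (fun y : F => e.symm (0, y)) (𝓝 0) (𝓝 0) := by
    have := (e.continuousAt_symm htgt).tendsto
    rw [hsymm0] at this
    exact this.comp hι
  have hφ0 : φ 0 = 0 := by
    show (e.symm 0).1 = 0
    rw [hsymm0]; rfl
  obtain ⟨ρ, hρ, hρU⟩ := Metric.eventually_nhds_iff.1 (hneg.and hU)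
  set a := min a₀ (ρ / 2) with ha
  have ha0 : 0 < a := lt_min ha₀ (by positivity)
  have hφc : Tendsto φ (𝓝 0) (𝓝 0) := (continuous_fst.tendsto (0 : ℝ × F)).comp hsymmc
  have hev : ∀ᶠ y in 𝓝 (0 : F), (0, y) ∈ e.target ∧
      fderiv ℝ G (e.symm (0, y)) (1, 0) < 0 ∧ |φ y| < a / 2 ∧ ‖y‖ < ρ := by
    refine (hι.eventually (e.open_target.mem_nhds htgt)).and ((hsymmc.eventually hneg).and
      ((hφc.abs.eventually_lt_const (by simpa using ha0)).and
      (continuous_norm.continuousAt.eventually_lt_const (by simpa using hρ))))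
  obtain ⟨b, hb, hbev⟩ := Metric.eventually_nhds_iff.1 hev
  simp only [dist_zero_right] at hbev hρU
  have hsec : ∀ y, ‖y‖ < b → e.symm (0, y) = (φ y, y) := by
    intro y hy
    have := e.right_inv (hbev hy).1
    rw [hecoe] at this
    exact Prod.ext rfl (Prod.ext_iff.1 this).2
  have hGφ : ∀ y, ‖y‖ < b → G (φ y, y) = 0 := by
    intro y hy
    have := e.right_inv (hbev hy).1
    rw [hecoe, hsec y hy] at this
    exact (Prod.ext_iff.1 this).1
  have hφs : ∀ y, ‖y‖ < b → ContDiffAt ℝ (⊤ : ℕ∞) φ y := by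
    intro y hy
    obtain ⟨e', he'⟩ := hequiv _ (hbev hy).2.1
    have h1 : ContDiffAt ℝ (⊤ : ℕ∞) e.symm (0, y) :=
      e.contDiffAt_symm (hbev hy).1 he' hHs.contDiffAt
    exact contDiffAt_fst.comp y (h1.comp y (contDiffAt_const.prodMk contDiffAt_id))
  obtain ⟨φ', hφ', hφa, hφe⟩ := exists_contDiff_extension hb (half_pos ha0) hφs
    (fun y hy => (hbev hy).2.2.1)
  refine ⟨a, b / 4, ha0, min_le_left _ _, by positivity, φ', hφ', ?_, hφa, fun t y ht hy => ?_⟩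
  · rw [hφe 0 (by simpa using hb), hφ0]
  rw [hφe y hy]
  have hyb : ‖y‖ < b := by linarith
  have haρ : a < ρ := (min_le_right _ _).trans_lt (by linarith)
  have hbox : ∀ s ∈ Icc (-a) a, ‖((s, y) : ℝ × F)‖ < ρ := fun s hs => by
    rw [Prod.norm_def, Real.norm_eq_abs]
    exact max_lt ((abs_le.2 hs).trans_lt haρ) (hbev hyb).2.2.2
  have hanti : StrictAntiOn (fun s => G (s, y)) (Icc (-a) a) := by
    refine strictAntiOn_of_deriv_neg (convex_Icc _ _)
      (hG.continuous.comp (by fun_prop)).continuousOn fun s hs => ?_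
    rw [interior_Icc] at hs
    have hd : HasDerivAt (fun s : ℝ => ((s, y) : ℝ × F)) (1, 0) s :=
      (hasDerivAt_id s).prodMk (hasDerivAt_const s y)
    have := ((hG.differentiable (by simp) (s, y)).hasFDerivAt.comp_hasDerivAt s hd).deriv
    rw [show deriv (fun s => G (s, y)) s = _ from this]
    exact (hρU (hbox s (Ioo_subset_Icc_self hs))).1
  have htI : t ∈ Icc (-a) a := abs_le.1 ht.le
  have hφI : φ y ∈ Icc (-a) a := abs_le.1 (by linarith [(hbev hyb).2.2.1])
  have h1 := hanti.lt_iff_gt htI hφI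
  have h2 := hanti.injOn.eq_iff htI hφI
  simp only [hGφ y hyb] at h1 h2
  exact ⟨(hρU (hbox t htI)).2, h1, h2⟩

variable {E : Type*} [NormedAddCommGroup E] [InnerProductSpace ℝ E]

theorem exists_graph {g : E → ℝ} (hg : ContDiff ℝ (⊤ : ℕ∞) g) {p : E} (hp : g p = 0)
    (L : (ℝ × F) →L[ℝ] E) (hL : fderiv ℝ g p (L (1, 0)) < 0) {U : Set E} (hU : U ∈ 𝓝 p)
    {a₀ : ℝ} (ha₀ : 0 < a₀) :
    ∃ a b, 0 < a ∧ a ≤ a₀ ∧ 0 < b ∧ ∃ φ : F → ℝ, ContDiff ℝ (⊤ : ℕ∞) φ ∧ φ 0 = 0 ∧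
      (∀ y, |φ y| < a / 2) ∧ ∀ t y, |t| < a → ‖y‖ < b →
        p + L (t, y) ∈ U ∧ (g (p + L (t, y)) < 0 ↔ φ y < t) ∧
          (g (p + L (t, y)) = 0 ↔ t = φ y) := by
  have hd : HasFDerivAt (fun x => p + L x) L 0 := L.hasFDerivAt.const_add p
  have h1 : fderiv ℝ (fun x => g (p + L x)) 0 = (fderiv ℝ g p).comp L := by
    have h2 : HasFDerivAt g (fderiv ℝ g p) (p + L 0) := by
      rw [map_zero, add_zero]
      exact (hg.differentiable (by simp) p).hasFDerivAt
    exact (h2.comp (0 : ℝ × F) hd).fderiv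
  refine exists_graph_model (G := fun x => g (p + L x)) (U := (fun x => p + L x) ⁻¹' U)
    (hg.comp (contDiff_const.add L.contDiff)) (by simpa using hp) (by rw [h1]; exact hL) ?_ ha₀
  refine hd.continuousAt.preimage_mem_nhds ?_
  rwa [map_zero, add_zero]

end Graph

section LocalGraph
variable {F : Type*} [NormedAddCommGroup F] [InnerProductSpace ℝ F] [FiniteDimensional ℝ F]
  {E : Type*} [NormedAddCommGroup E] [InnerProductSpace ℝ E]

/-- Near a frontier point, an open set given by a defining function is the region above a graph
in any direction pointing inwards. -/
theorem exists_graph_frontier {Ω U : Set E} {g : E → ℝ} (hg : ContDiff ℝ (⊤ : ℕ∞) g)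
    (hU : IsOpen U) {p : E} (hpU : p ∈ U) (hp : p ∈ frontier Ω)
    (h1 : Ω ∩ U = {y | g y < 0} ∩ U) (h2 : frontier Ω ∩ U = {y | g y = 0} ∩ U)
    (L : (ℝ × F) →L[ℝ] E) (hL : fderiv ℝ g p (L (1, 0)) < 0) {a₀ : ℝ} (ha₀ : 0 < a₀) :
    ∃ a b, 0 < a ∧ a ≤ a₀ ∧ 0 < b ∧ ∃ φ : F → ℝ, ContDiff ℝ (⊤ : ℕ∞) φ ∧ φ 0 = 0 ∧
      (∀ y, |φ y| < a / 2) ∧ ∀ t y, |t| < a → ‖y‖ < b →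
        (p + L (t, y) ∈ Ω ↔ φ y < t) ∧ (p + L (t, y) ∈ frontier Ω ↔ t = φ y) := by
  have hgp : p ∈ {y | g y = 0} ∩ U := h2 ▸ ⟨hp, hpU⟩
  obtain ⟨a, b, ha, haa, hb, φ, hφ, hφ0, hφa, h⟩ :=
    exists_graph hg hgp.1 L hL (hU.mem_nhds hpU) ha₀
  refine ⟨a, b, ha, haa, hb, φ, hφ, hφ0, hφa, fun t y ht hy => ?_⟩
  obtain ⟨hm, hi, he⟩ := h t y ht hy
  have k1 := Set.ext_iff.1 h1 (p + L (t, y))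
  have k2 := Set.ext_iff.1 h2 (p + L (t, y))
  simp only [Set.mem_inter_iff, hm, and_true, Set.mem_ofPred_eq] at k1 k2
  exact ⟨k1.trans hi, k2.trans he⟩

/-- A linear isomorphism from a product sending the first basis vector to a given one. -/
theorem exists_equiv_prod_apply_eq [FiniteDimensional ℝ E]
    (hfr : Module.finrank ℝ E = Module.finrank ℝ F + 1) {v : E} (hv : v ≠ 0) :
    ∃ L : (ℝ × F) ≃L[ℝ] E, L (1, 0) = v := by
  have e : (ℝ × F) ≃L[ℝ] E := ContinuousLinearEquiv.ofFinrankEq (by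
    rw [Module.finrank_prod, hfr, Module.finrank_self, add_comm])
  obtain ⟨A, hA⟩ := SeparatingDual.exists_continuousLinearEquiv_apply_eq (R := ℝ)
    (x := e (1, 0)) (y := v) (by simp) hv
  exact ⟨e.trans A, hA⟩

end LocalGraph

section Finiteness
variable {n : ℕ} {Ω : Set (EuclideanSpace ℝ (Fin n))}

theorem exists_frontier_piece (hn : 3 ≤ n) (hsb : HasSmoothBoundary Ω)
    {p : EuclideanSpace ℝ (Fin n)} (hp : p ∈ frontier Ω) :
    ∃ V, IsOpen V ∧ p ∈ V ∧ IsPreconnected (frontier Ω ∩ V) ∧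
      μH[(n : ℝ) - 1] (frontier Ω ∩ V) ≠ ⊤ := by
  obtain ⟨U, hU, hpU, g, hg, hgr, h1, h2⟩ := hsb p hp
  have hd : fderiv ℝ g p ≠ 0 := by
    rw [← norm_ne_zero_iff, ← norm_gradient_eq, norm_ne_zero_iff]
    exact hgr p hpU
  obtain ⟨w, hw⟩ : ∃ w, fderiv ℝ g p w ≠ 0 := by
    by_contra! h
    exact hd (ContinuousLinearMap.ext h)
  obtain ⟨v, hv⟩ : ∃ v, fderiv ℝ g p v < 0 := by
    rcases hw.lt_or_gt with h | h
    · exact ⟨w, h⟩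
    · exact ⟨-w, by rw [map_neg]; linarith⟩
  obtain ⟨L, hL⟩ := exists_equiv_prod_apply_eq (F := EuclideanSpace ℝ (Fin (n - 1)))
    (by simp only [finrank_euclideanSpace, Fintype.card_fin]; omega)
    (show v ≠ 0 by rintro rfl; simp at hv)
  obtain ⟨a, b, ha, -, hb, φ, hφ, hφ0, hφa, h⟩ := exists_graph_frontier hg hU hpU hp h1 h2
    (L : (ℝ × EuclideanSpace ℝ (Fin (n - 1))) →L[ℝ] EuclideanSpace ℝ (Fin n))
    (by rw [ContinuousLinearEquiv.coe_coe, hL]; exact hv) one_pos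
  set Φ := L.toHomeomorph.trans (Homeomorph.addLeft p) with hΦ
  have hΦa : ∀ x, Φ x = p + L x := fun x => rfl
  have hγ : ContDiff ℝ (⊤ : ℕ∞) fun y => p + L (φ y, y) :=
    contDiff_const.add (L.contDiff.comp (hφ.prodMk contDiff_id))
  have himg : frontier Ω ∩ Φ '' (Ioo (-a) a ×ˢ ball 0 b) =
      (fun y => p + L (φ y, y)) '' ball 0 b := by
    ext z
    constructor
    · rintro ⟨hz, ⟨t, y⟩, ⟨ht, hy⟩, rfl⟩
      refine ⟨y, hy, ?_⟩
      have := (h t y (abs_lt.2 ht) (mem_ball_zero_iff.1 hy)).2.1 hz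
      rw [hΦa, this]
    · rintro ⟨y, hy, rfl⟩
      have hya : |φ y| < a := (hφa y).trans (by linarith)
      exact ⟨(h _ y hya (mem_ball_zero_iff.1 hy)).2.2 rfl, (φ y, y), ⟨abs_lt.1 hya, hy⟩, rfl⟩
  refine ⟨Φ '' (Ioo (-a) a ×ˢ ball 0 b), Φ.isOpenMap _ (isOpen_Ioo.prod isOpen_ball),
    ⟨(0, 0), ⟨⟨by linarith, ha⟩, mem_ball_self hb⟩, ?_⟩, ?_, ?_⟩
  · rw [hΦa]
    show p + L 0 = p
    simp
  · rw [himg]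
    exact (convex_ball _ _).isPreconnected.image _ hγ.continuous.continuousOn
  · rw [himg]
    obtain ⟨K, hK⟩ := (hγ.contDiffOn (s := closedBall 0 b)).exists_lipschitzOnWith (by simp)
      (convex_closedBall _ _) (isCompact_closedBall _ _)
    have hcast : (n : ℝ) - 1 =
        (Module.finrank ℝ (EuclideanSpace ℝ (Fin (n - 1))) : ℝ) := by
      rw [finrank_euclideanSpace, Fintype.card_fin, Nat.cast_sub (by omega), Nat.cast_one]
    obtain ⟨c, -, hc, hμ⟩ := exists_hausdorffMeasure_eq_smul
      (EuclideanSpace ℝ (Fin (n - 1))) volume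
    refine ne_top_of_le_ne_top ?_
      ((hK.mono ball_subset_closedBall).hausdorffMeasure_image_le (by
        rw [hcast]; positivity))
    rw [hcast, hμ, Measure.smul_apply]
    exact ENNReal.mul_ne_top (ENNReal.rpow_ne_top_of_nonneg (by positivity) ENNReal.coe_ne_top)
      (ENNReal.mul_ne_top hc measure_ball_lt_top.ne)

theorem frontier_finiteness (hn : 3 ≤ n) (hb : Bornology.IsBounded Ω)
    (hsb : HasSmoothBoundary Ω) :
    μH[(n : ℝ) - 1] (frontier Ω) ≠ ⊤ ∧ (relClopens (frontier Ω)).Finite := by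
  have hcomp : IsCompact (frontier Ω) :=
    Metric.isCompact_of_isClosed_isBounded isClosed_frontier
      (hb.closure.subset frontier_subset_closure)
  have key : ∀ p : frontier Ω, ∃ V, IsOpen V ∧ (p : EuclideanSpace ℝ (Fin n)) ∈ V ∧
      IsPreconnected (frontier Ω ∩ V) ∧ μH[(n : ℝ) - 1] (frontier Ω ∩ V) ≠ ⊤ := fun p =>
    exists_frontier_piece hn hsb p.2
  choose V hVo hpV hVc hVμ using key
  obtain ⟨t, ht⟩ := hcomp.elim_finite_subcover V hVo fun x hx => mem_iUnion.2 ⟨⟨x, hx⟩, hpV _⟩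
  constructor
  · refine ne_top_of_le_ne_top (b := ∑ i ∈ t, μH[(n : ℝ) - 1] (frontier Ω ∩ V i)) ?_ ?_
    · exact (ENNReal.sum_lt_top.2 fun i _ => (hVμ i).lt_top).ne
    · refine (measure_mono ?_).trans (measure_biUnion_finset_le t _)
      rw [← inter_iUnion₂]
      exact subset_inter subset_rfl ht
  · refine Set.Finite.of_injOn (f := fun C => {i | i ∈ t ∧ frontier Ω ∩ V i ⊆ C})
      (fun C _ => show _ ⊆ (t : Set (frontier Ω)) from fun i hi => hi.1) ?_
      t.finite_toSet.powerset
    · have claim : ∀ C ∈ relClopens (frontier Ω), ∀ D ∈ relClopens (frontier Ω),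
          ({i | i ∈ t ∧ frontier Ω ∩ V i ⊆ C} = {i | i ∈ t ∧ frontier Ω ∩ V i ⊆ D}) → C ⊆ D := by
        intro C hC D hD hCD x hx
        obtain ⟨i, hi, hxi⟩ := mem_iUnion₂.1 (ht (hC.1 hx))
        have hxV : x ∈ frontier Ω ∩ V i := ⟨hC.1 hx, hxi⟩
        have hi' : i ∈ {i | i ∈ t ∧ frontier Ω ∩ V i ⊆ C} := by
          refine ⟨hi, ?_⟩
          refine (disjoint_or_subset_of_mem_relClopens hC inter_subset_left (hVc i)).resolve_left
            fun h => ?_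
          exact Set.disjoint_left.1 h hxV hx
        rw [hCD] at hi'
        exact hi'.2 hxV
      intro C hC D hD hCD
      exact (claim C hC D hD hCD).antisymm (claim D hD C hC hCD.symm)

end Finiteness

section ChartExistence
variable {F : Type*} [NormedAddCommGroup F] [InnerProductSpace ℝ F] [FiniteDimensional ℝ F]
  {E : Type*} [NormedAddCommGroup E] [InnerProductSpace ℝ E] [FiniteDimensional ℝ E]

/-- If the frontier of a connected open set is split into two closed pieces, some ball inside the
set touches both. -/
theorem exists_ball_touching {Ω A B : Set E} (hΩ : IsOpen Ω) (hconn : IsConnected Ω)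
    (hA : IsClosed A) (hB : IsClosed B) (hAne : A.Nonempty) (hBne : B.Nonempty)
    (hAB : Disjoint A B) (hf : frontier Ω = A ∪ B) :
    ∃ x r p q, p ∈ A ∧ q ∈ B ∧ dist x p = r ∧ dist x q = r ∧ 0 < r ∧ ball x r ⊆ Ω := by
  have near : ∀ S T : Set E, IsClosed S → IsClosed T → S.Nonempty → T.Nonempty → Disjoint S T →
      S ⊆ frontier Ω → ∃ x ∈ Ω, infDist x S ≤ infDist x T := by
    rintro S T hS hT ⟨a, ha⟩ hTne hST hSf
    have h0 : infDist a S < infDist a T := by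
      rw [infDist_zero_of_mem ha]
      exact (hT.notMem_iff_infDist_pos hTne).1 (Set.disjoint_left.1 hST ha)
    obtain ⟨y, hy, hyΩ⟩ := mem_closure_iff.1 (frontier_subset_closure (hSf ha))
      {y | infDist y S < infDist y T}
      (isOpen_lt (continuous_infDist_pt _) (continuous_infDist_pt _)) h0
    exact ⟨y, hyΩ, le_of_lt hy⟩
  obtain ⟨x₁, hx₁, h₁⟩ := near A B hA hB hAne hBne hAB (hf ▸ subset_union_left)
  obtain ⟨x₂, hx₂, h₂⟩ := near B A hB hA hBne hAne hAB.symm (hf ▸ subset_union_right)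
  obtain ⟨x, hx, he⟩ := hconn.isPreconnected.intermediate_value₂ hx₁ hx₂
    (continuous_infDist_pt A).continuousOn (continuous_infDist_pt B).continuousOn h₁ h₂
  obtain ⟨p, hp, hxp⟩ := hA.exists_infDist_eq_dist hAne x
  obtain ⟨q, hq, hxq⟩ := hB.exists_infDist_eq_dist hBne x
  have hxf : x ∉ frontier Ω := fun h => by
    rw [hΩ.frontier_eq] at h
    exact h.2 hx
  have hr : 0 < infDist x A :=
    (hA.notMem_iff_infDist_pos hAne).1 fun h => hxf (hf ▸ Or.inl h)
  refine ⟨x, infDist x A, p, q, hp, hq, hxp.symm, he ▸ hxq.symm, hr, ?_⟩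
  refine (convex_ball x (infDist x A)).isPreconnected.subset_left_of_subset_union hΩ
    (isClosed_closure (s := Ω)).isOpen_compl
    (disjoint_compl_right.mono_left subset_closure) (fun z hz => ?_) ⟨x, mem_ball_self hr, hx⟩
  by_contra hzn
  have hzf : z ∈ frontier Ω := by
    rw [hΩ.frontier_eq]
    exact ⟨by_contra fun h => hzn (Or.inr h), fun h => hzn (Or.inl h)⟩
  rw [mem_ball, dist_comm] at hz
  rw [hf] at hzf
  rcases hzf with h | h
  · exact absurd (infDist_le_dist_of_mem h) (not_le.2 hz)
  · exact absurd (infDist_le_dist_of_mem h) (not_le.2 (he ▸ hz))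

/-- At a point where a ball inside the sublevel set `{g < 0}` touches `{g = 0}`, every direction
pointing into the ball decreases `g`. -/
theorem fderiv_neg_of_ball_touching {g : E → ℝ} {p x : E} {r : ℝ} (hg : DifferentiableAt ℝ g p)
    (hgp : g p = 0) (hd : fderiv ℝ g p ≠ 0) {U : Set E} (hU : U ∈ 𝓝 p)
    (hball : ∀ y ∈ ball x r ∩ U, g y < 0) (hp : p ∈ closure (ball x r)) {z : E}
    (hz : z ∈ ball x r) : fderiv ℝ g p (z - p) < 0 := by
  have hle : ∀ y ∈ ball x r, fderiv ℝ g p (y - p) ≤ 0 := by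
    intro y hy
    have hmax : IsLocalMaxOn g (insert p (ball x r)) p := by
      filter_upwards [mem_nhdsWithin_of_mem_nhds hU, self_mem_nhdsWithin] with w hw hw'
      rcases hw' with rfl | hw'
      · exact le_rfl
      · rw [hgp]; exact (hball w ⟨hw', hw⟩).le
    refine hmax.hasFDerivWithinAt_nonpos hg.hasFDerivAt.hasFDerivWithinAt
      (sub_mem_posTangentConeAt_of_openSegment_subset ?_)
    have := (convex_ball x r).openSegment_closure_interior_subset_interior hp
      (by rwa [isOpen_ball.interior_eq])
    rw [isOpen_ball.interior_eq] at this
    exact this.trans (subset_insert _ _)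
  refine lt_of_le_of_ne (hle z hz) fun h0 => hd ?_
  have hmax : IsLocalMax (fun y => fderiv ℝ g p (y - p)) z := by
    filter_upwards [isOpen_ball.mem_nhds hz] with y hy
    rw [h0]
    exact hle y hy
  have h1 : HasFDerivAt (fun y => fderiv ℝ g p (y - p)) (fderiv ℝ g p) z :=
    (fderiv ℝ g p).hasFDerivAt.comp z ((hasFDerivAt_id z).sub_const p)
  rw [← h1.fderiv]
  exact hmax.fderiv_eq_zero

/-- The shear of a product straightening the region between two graphs. -/
noncomputable def shear (φ ψ : F → ℝ) (hφ : Continuous φ) (hψ : Continuous ψ)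
    (h : ∀ y, φ y < ψ y) : (ℝ × F) ≃ₜ (ℝ × F) where
  toFun x := (φ x.2 + x.1 * (ψ x.2 - φ x.2), x.2)
  invFun x := ((x.1 - φ x.2) / (ψ x.2 - φ x.2), x.2)
  left_inv x := by
    have := (sub_pos.2 (h x.2)).ne'
    ext
    · simp only
      field_simp
      ring
    · rfl
  right_inv x := by
    have := (sub_pos.2 (h x.2)).ne'
    ext
    · simp only
      field_simp
      ring
    · rfl
  continuous_toFun := by fun_prop
  continuous_invFun := by
    have := fun x : ℝ × F => (sub_pos.2 (h x.2)).ne'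
    fun_prop (disch := assumption)

/-- A region which in a linear tube is bounded by two graphs has a tube chart. -/
theorem exists_tubeChart_of_graphs {Ω : Set E} {p : E} (L : (ℝ × F) ≃L[ℝ] E) {φ ψ : F → ℝ}
    (hφ : ContDiff ℝ (⊤ : ℕ∞) φ) (hψ : ContDiff ℝ (⊤ : ℕ∞) ψ) (hφ0 : φ 0 = 0) (hψ0 : ψ 0 = 1)
    {a c b : ℝ} (ha : 0 < a) (hc : 0 < c) (hb : 0 < b) (ha' : a ≤ 1 / 4) (hc' : c ≤ 1 / 4)
    (hφa : ∀ y, |φ y| < a / 2) (hψc : ∀ y, |ψ y - 1| < c / 2)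
    (hΩ : ∀ t y, -a < t → t < 1 + c → ‖y‖ < b → (p + L (t, y) ∈ Ω ↔ φ y < t ∧ t < ψ y)) :
    ∃ T : TubeChart F Ω, T.toFun (0, 0) = p ∧ T.toFun (1, 0) = p + L (1, 0) := by
  have hlt : ∀ y, φ y < ψ y := fun y => by
    linarith [(abs_lt.1 (hφa y)).2, (abs_lt.1 (hψc y)).1]
  set S := shear φ ψ hφ.continuous hψ.continuous hlt with hS
  set Φ : (ℝ × F) ≃ₜ E := (S.trans L.toHomeomorph).trans (Homeomorph.addLeft p) with hΦ
  have hΦa : ∀ x, Φ x = p + L (φ x.2 + x.1 * (ψ x.2 - φ x.2), x.2) := fun x => rfl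
  have hΦs : ∀ z, Φ.symm z = (((L.symm (-p + z)).1 - φ (L.symm (-p + z)).2) /
      (ψ (L.symm (-p + z)).2 - φ (L.symm (-p + z)).2), (L.symm (-p + z)).2) := fun z => rfl
  have h1 : ContDiff ℝ (⊤ : ℕ∞) Φ := by
    rw [show (Φ : ℝ × F → E) = _ from funext hΦa]
    fun_prop
  have h2 : ContDiff ℝ (⊤ : ℕ∞) Φ.symm := by
    rw [show (Φ.symm : E → ℝ × F) = _ from funext hΦs]
    have hne : ∀ z, ψ (L.symm (-p + z)).2 - φ (L.symm (-p + z)).2 ≠ 0 :=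
      fun z => (sub_pos.2 (hlt _)).ne'
    fun_prop (disch := assumption)
  set m := min a c / 4 with hm
  have hm0 : 0 < m := by positivity
  have hma : m ≤ a / 4 := by rw [hm]; linarith [min_le_left a c]
  have hmc : m ≤ c / 4 := by rw [hm]; linarith [min_le_right a c]
  have hbox : Ioo (-m) (1 + m) ×ˢ ball (0 : F) b ⊆ Icc (-m) (1 + m) ×ˢ closedBall (0 : F) b :=
    prod_mono Ioo_subset_Icc_self ball_subset_closedBall
  have hcomp : IsCompact (Icc (-m) (1 + m) ×ˢ closedBall (0 : F) b) :=
    isCompact_Icc.prod (isCompact_closedBall _ _)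
  obtain ⟨K₁, hK₁⟩ := h1.contDiffOn.exists_lipschitzOnWith (by simp)
    ((convex_Icc (-m) (1 + m)).prod (convex_closedBall (0 : F) b)) hcomp
  obtain ⟨R, hR⟩ := (hcomp.image Φ.continuous).isBounded.subset_closedBall 0
  obtain ⟨K₂, hK₂⟩ := h2.contDiffOn.exists_lipschitzOnWith (by simp)
    (convex_closedBall (0 : E) R) (isCompact_closedBall _ _)
  refine ⟨⟨Φ, h1, h2, m, hm0, b, hb, max K₁ K₂, (hK₁.mono hbox).weaken (le_max_left _ _),
    (hK₂.mono ((image_mono hbox).trans hR)).weaken (le_max_right _ _), ?_⟩, ?_, ?_⟩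
  · rintro ⟨τ, y⟩ ⟨⟨hτ1, hτ2⟩, hy⟩
    simp only at hτ1 hτ2 hy
    have e1 := abs_lt.1 (hφa y)
    have e2 := abs_lt.1 (hψc y)
    have hD : 0 < ψ y - φ y := sub_pos.2 (hlt y)
    have hD' : ψ y - φ y ≤ 5 / 4 := by linarith
    rw [hΦa, hΩ _ _ ?_ ?_ (mem_ball_zero_iff.1 hy)]
    · simp only
      constructor
      · rintro ⟨k1, k2⟩
        constructor
        · by_contra! h; nlinarith
        · by_contra! h; nlinarith
      · rintro ⟨k1, k2⟩
        constructor
        · nlinarith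
        · nlinarith
    · simp only
      nlinarith
    · simp only
      nlinarith
  · simp only [hΦa, hφ0, zero_mul, add_zero]
    show p + L 0 = p
    simp
  · simp [hΦa, hφ0, hψ0]

end ChartExistence

section ChartBetween
variable {F : Type*} [NormedAddCommGroup F] [InnerProductSpace ℝ F] [FiniteDimensional ℝ F]
  {E : Type*} [NormedAddCommGroup E] [InnerProductSpace ℝ E] [FiniteDimensional ℝ E]

/-- Two inward graphs at the ends of a chord inside `Ω` bound a common thin tube. -/
theorem exists_graphs_of_chord {Ω : Set E} (hΩ : IsOpen Ω) {p : E} (L : (ℝ × F) ≃L[ℝ] E)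
    (hseg : ∀ t, 0 < t → t < 1 → p + L (t, 0) ∈ Ω) {φ χ : F → ℝ} {a b c d : ℝ}
    (ha : 0 < a) (hb : 0 < b) (hc : 0 < c) (hd : 0 < d) (ha' : a ≤ 1 / 4) (hc' : c ≤ 1 / 4)
    (hφa : ∀ y, |φ y| < a / 2) (hχc : ∀ y, |χ y| < c / 2)
    (hp : ∀ t y, |t| < a → ‖y‖ < b → (p + L (t, y) ∈ Ω ↔ φ y < t))
    (hq : ∀ t y, |t| < c → ‖y‖ < d → (p + L (1 - t, y) ∈ Ω ↔ χ y < t)) :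
    ∃ ρ, 0 < ρ ∧ ∀ t y, -a < t → t < 1 + c → ‖y‖ < ρ →
      (p + L (t, y) ∈ Ω ↔ φ y < t ∧ t < 1 - χ y) := by
  have hopen : IsOpen ((fun x : ℝ × F => p + L x) ⁻¹' Ω) :=
    hΩ.preimage (continuous_const.add L.continuous)
  obtain ⟨u, v, -, hv, hu', hv', huv⟩ := generalized_tube_lemma
    (isCompact_Icc (a := a) (b := 1 - c)) (isCompact_singleton (x := (0 : F))) hopen (by
      rintro ⟨t, y⟩ ⟨ht, rfl⟩
      exact hseg t (by linarith [ht.1]) (by linarith [ht.2]))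
  obtain ⟨ρ, hρ, hρv⟩ := Metric.isOpen_iff.1 hv 0 (hv' rfl)
  refine ⟨min ρ (min b d), by positivity, fun t y ht ht' hy => ?_⟩
  have hyρ := hy.trans_le (min_le_left _ _)
  have hyb := hy.trans_le ((min_le_right _ _).trans (min_le_left _ _))
  have hyd := hy.trans_le ((min_le_right _ _).trans (min_le_right _ _))
  have e1 := abs_lt.1 (hφa y)
  have e2 := abs_lt.1 (hχc y)
  rcases lt_or_ge t a with h | h
  · rw [hp t y (abs_lt.2 ⟨ht, h⟩) hyb]
    exact (and_iff_left (by linarith)).symm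
  rcases lt_or_ge (1 - c) t with h' | h'
  · have := hq (1 - t) y (abs_lt.2 ⟨by linarith, by linarith⟩) hyd
    rw [sub_sub_cancel] at this
    rw [this]
    constructor
    · exact fun k => ⟨by linarith, by linarith⟩
    · exact fun k => by linarith [k.2]
  · refine iff_of_true (huv ⟨hu' ⟨h, h'⟩, hρv (mem_ball_zero_iff.2 hyρ)⟩) ⟨by linarith, by linarith⟩

end ChartBetween

section ChartSmooth
variable {n : ℕ} {Ω : Set (EuclideanSpace ℝ (Fin n))}

/-- A tube chart joining two prescribed complementary pieces of the frontier. -/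
theorem exists_tubeChart (hn : 3 ≤ n) (hΩ : IsOpen Ω) (hconn : IsConnected Ω)
    (hsb : HasSmoothBoundary Ω) {C : Set (EuclideanSpace ℝ (Fin n))}
    (hC : C ∈ relClopens (frontier Ω)) (hC0 : C ≠ ∅) (hC1 : C ≠ frontier Ω) :
    ∃ T : TubeChart (EuclideanSpace ℝ (Fin (n - 1))) Ω,
      T.toFun (0, 0) ∈ C ∧ T.toFun (1, 0) ∉ C := by
  have hclosed : ∀ D ∈ relClopens (frontier Ω), IsClosed D := by
    rintro D ⟨hDZ, -, V, hV, hDV⟩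
    have : D = frontier Ω ∩ Vᶜ := by
      ext x
      have := Set.ext_iff.1 hDV x
      simp only [Set.mem_sdiff, Set.mem_inter_iff, Set.mem_compl_iff] at this ⊢
      have hx := @hDZ x
      tauto
    rw [this]
    exact isClosed_frontier.inter hV.isClosed_compl
  obtain ⟨x, r, p, q, hp, hq, hxp, hxq, hr, hball⟩ := exists_ball_touching hΩ hconn
    (hclosed C hC) (hclosed _ (diff_mem_relClopens hC)) (nonempty_iff_ne_empty.2 hC0)
    (Set.nonempty_of_ssubset (hC.1.ssubset_of_ne hC1)) disjoint_sdiff_right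
    (Set.union_sdiff_cancel hC.1).symm
  have hpq : p ≠ q := fun h => hq.2 (h ▸ hp)
  have hpb : p ∈ closedBall x r := by rw [mem_closedBall, dist_comm, hxp]
  have hqb : q ∈ closedBall x r := by rw [mem_closedBall, dist_comm, hxq]
  have hmid : ∀ t : ℝ, 0 < t → t < 1 → p + t • (q - p) ∈ ball x r := fun t h0 h1 =>
    openSegment_subset_ball_of_ne hpb hqb hpq ⟨1 - t, t, by linarith, h0, by ring, by
      rw [smul_sub, sub_smul, one_smul]; abel⟩
  have hdef : ∀ w ∈ frontier Ω, w ∈ closedBall x r → ∃ U, IsOpen U ∧ w ∈ U ∧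
      ∃ g : EuclideanSpace ℝ (Fin n) → ℝ, ContDiff ℝ (⊤ : ℕ∞) g ∧
        Ω ∩ U = {y | g y < 0} ∩ U ∧ frontier Ω ∩ U = {y | g y = 0} ∩ U ∧
        ∀ z ∈ ball x r, fderiv ℝ g w (z - w) < 0 := by
    intro w hw hwb
    obtain ⟨U, hU, hwU, g, hg, hgr, h1, h2⟩ := hsb w hw
    have hd : fderiv ℝ g w ≠ 0 := by
      rw [← norm_ne_zero_iff, ← norm_gradient_eq, norm_ne_zero_iff]
      exact hgr w hwU
    have hgw : w ∈ {y | g y = 0} ∩ U := h2 ▸ ⟨hw, hwU⟩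
    refine ⟨U, hU, hwU, g, hg, h1, h2, fun z hz => ?_⟩
    refine fderiv_neg_of_ball_touching (hg.differentiable (by simp) w) hgw.1 hd (hU.mem_nhds hwU)
      (fun y hy => ?_) (by rwa [closure_ball x hr.ne']) hz
    have : y ∈ {y | g y < 0} ∩ U := h1 ▸ ⟨hball hy.1, hy.2⟩
    exact this.1
  obtain ⟨L, hL⟩ := exists_equiv_prod_apply_eq (F := EuclideanSpace ℝ (Fin (n - 1)))
    (by simp only [finrank_euclideanSpace, Fintype.card_fin]; omega) (sub_ne_zero.2 hpq.symm)
  have hLt : ∀ t : ℝ, L (t, 0) = t • (q - p) := fun t => by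
    rw [← hL, ← map_smul]
    simp
  have hseg : ∀ t : ℝ, 0 < t → t < 1 → p + L (t, 0) ∈ Ω := fun t h0 h1 => by
    rw [hLt]
    exact hball (hmid t h0 h1)
  obtain ⟨U, hU, hpU, g, hg, h1, h2, hgp⟩ := hdef p (hC.1 hp) hpb
  obtain ⟨U', hU', hqU, g', hg', h1', h2', hgq⟩ := hdef q hq.1 hqb
  obtain ⟨a, b, ha, ha', hb, φ, hφ, hφ0, hφa, hφ'⟩ := exists_graph_frontier hg hU hpU (hC.1 hp)
    h1 h2 (L : (ℝ × EuclideanSpace ℝ (Fin (n - 1))) →L[ℝ] EuclideanSpace ℝ (Fin n)) (by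
      have := hgp _ (hmid (1 / 2) (by norm_num) (by norm_num))
      rw [add_sub_cancel_left, map_smul, smul_eq_mul] at this
      rw [ContinuousLinearEquiv.coe_coe, hL]
      linarith) (show (0 : ℝ) < 1 / 4 by norm_num)
  obtain ⟨c, d, hc, hc', hd, χ, hχ, hχ0, hχc, hχ'⟩ := exists_graph_frontier hg' hU' hqU hq.1
    h1' h2' ((L : (ℝ × EuclideanSpace ℝ (Fin (n - 1))) →L[ℝ] EuclideanSpace ℝ (Fin n)).comp
      ((-ContinuousLinearMap.fst ℝ ℝ (EuclideanSpace ℝ (Fin (n - 1)))).prod (ContinuousLinearMap.snd ℝ ℝ _))) (by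
      have := hgq _ (hmid (1 / 2) (by norm_num) (by norm_num))
      have e : p + (1 / 2 : ℝ) • (q - p) - q = (1 / 2 : ℝ) • L (-1, 0) := by
        rw [hLt]
        module
      rw [e, map_smul, smul_eq_mul] at this
      have e' : (((L : (ℝ × EuclideanSpace ℝ (Fin (n - 1))) →L[ℝ] EuclideanSpace ℝ (Fin n)).comp
          ((-ContinuousLinearMap.fst ℝ ℝ (EuclideanSpace ℝ (Fin (n - 1)))).prod (ContinuousLinearMap.snd ℝ ℝ _))) (1, 0)) =
          L (-1, 0) := rfl
      rw [e']
      linarith) (show (0 : ℝ) < 1 / 4 by norm_num)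
  have hχ'' : ∀ t y, |t| < c → ‖y‖ < d → (p + L (1 - t, y) ∈ Ω ↔ χ y < t) := fun t y ht hy => by
    rw [← (hχ' t y ht hy).1]
    have e : p + L (1 - t, y) = q + L (-t, y) := by
      have : ((1 - t, y) : ℝ × EuclideanSpace ℝ (Fin (n - 1))) = (1, 0) + (-t, y) := by
        ext <;> simp [sub_eq_add_neg]
      rw [this, map_add, hL]
      abel
    rw [e]
    rfl
  obtain ⟨ρ, hρ, h⟩ := exists_graphs_of_chord hΩ L hseg ha hb hc hd ha' hc' hφa hχc
    (fun t y ht hy => (hφ' t y ht hy).1) hχ''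
  obtain ⟨T, hT0, hT1⟩ := exists_tubeChart_of_graphs L hφ (contDiff_const.sub hχ) hφ0
    (by simp [hχ0]) ha hc hρ ha' hc' hφa (fun y => by
      rw [sub_sub_cancel_left, abs_neg]; exact hχc y) h
  refine ⟨T, hT0 ▸ hp, ?_⟩
  rw [hT1, hL, add_sub_cancel]
  exact hq.2

end ChartSmooth

theorem nonempty_frontier_of_isBounded {n : ℕ} (hn : 3 ≤ n)
    {Ω : Set (EuclideanSpace ℝ (Fin n))} (hb : Bornology.IsBounded Ω) (hne : Ω.Nonempty) :
    (frontier Ω).Nonempty := by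
  have : Nontrivial (EuclideanSpace ℝ (Fin n)) :=
    Module.nontrivial_of_finrank_pos (R := ℝ) (by rw [finrank_euclideanSpace_fin]; omega)
  refine nonempty_frontier_iff.2 ⟨hne, ?_⟩
  rintro rfl
  exact NormedSpace.unbounded_univ ℝ (EuclideanSpace ℝ (Fin n)) hb

/-- Cutting tunnels between components of the boundary until it is connected. -/
theorem exists_connected_frontier {n : ℕ} (hn : 3 ≤ n) (N : ℕ) :
    ∀ (Ω : Set (EuclideanSpace ℝ (Fin n))), IsOpen Ω → Bornology.IsBounded Ω → IsConnected Ω →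
      HasSmoothBoundary Ω → (relClopens (frontier Ω)).ncard = N → ∀ ε : ℝ, 0 < ε →
      ∃ Ω' : Set (EuclideanSpace ℝ (Fin n)), Ω' ⊆ Ω ∧ IsOpen Ω' ∧ IsConnected Ω' ∧
        HasSmoothBoundary Ω' ∧ IsConnected (frontier Ω') ∧
        (volume Ω).toReal - (volume Ω').toReal < ε ∧
        |(μH[(n : ℝ) - 1] (frontier Ω)).toReal - (μH[(n : ℝ) - 1] (frontier Ω')).toReal| < ε ∧
        |stekSigma1 Ω - stekSigma1 Ω'| < ε := by
  induction N using Nat.strong_induction_on with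
  | _ N ih =>
  intro Ω hΩ hb hconn hsb hN ε hε
  by_cases hall : ∀ A ∈ relClopens (frontier Ω), A = ∅ ∨ A = frontier Ω
  · refine ⟨Ω, subset_rfl, hΩ, hconn, hsb, ⟨nonempty_frontier_of_isBounded hn hb hconn.nonempty,
      isPreconnected_of_relClopens hall⟩, ?_, ?_, ?_⟩ <;> simpa using hε
  push Not at hall
  obtain ⟨C, hC, hC0, hC1⟩ := hall
  obtain ⟨hμ, hfin⟩ := frontier_finiteness hn hb hsb
  obtain ⟨T, hp, hq⟩ := exists_tubeChart hn hΩ hconn hsb hC hC0.ne_empty hC1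
  obtain ⟨δ, hδ, hδR, h1, h2, h3⟩ := T.exists_cut_close hn hΩ hb hμ (half_pos hε)
  have hF : 2 ≤ Module.finrank ℝ (EuclideanSpace ℝ (Fin (n - 1))) := by
    rw [finrank_euclideanSpace_fin]; omega
  obtain ⟨-, -, hlt⟩ := T.relClopens_frontier_cut hF hδ hδR hfin hC hp hq
  obtain ⟨Ω', hsub, ho', hc', hs', hf', k1, k2, k3⟩ := ih _ (hN ▸ hlt) (T.cut δ)
    (T.isOpen_cut hΩ) (hb.subset T.cut_subset) (T.isConnected_cut hF hδ hδR hconn)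
    (T.hasSmoothBoundary_cut hδ hδR hsb) rfl _ (half_pos hε)
  refine ⟨Ω', hsub.trans T.cut_subset, ho', hc', hs', hf', by linarith, ?_, ?_⟩
  · exact (abs_sub_le _ _ _).trans_lt (by linarith)
  · exact (abs_sub_le _ _ _).trans_lt (by linarith)

end Steklov

/-- Theorem 1.2 (Euclidean case): for `n ≥ 3`, any smooth bounded domain `Ω ⊆ ℝⁿ` can be
approximated in volume, boundary volume, and first Steklov eigenvalue by a smooth subdomain
with connected boundary. -/
theorem stmt18 {n : ℕ} (hn : 3 ≤ n) (Ω : Set (EuclideanSpace ℝ (Fin n)))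
    (ho : IsOpen Ω) (hb : Bornology.IsBounded Ω) (hne : Ω.Nonempty)
    (hconn : IsConnected Ω) (hsb : HasSmoothBoundary Ω) (ε : ℝ) (hε : 0 < ε) :
    ∃ Ω' : Set (EuclideanSpace ℝ (Fin n)), Ω' ⊆ Ω ∧
      IsOpen Ω' ∧ Bornology.IsBounded Ω' ∧ Ω'.Nonempty ∧ IsConnected Ω' ∧
      HasSmoothBoundary Ω' ∧ IsConnected (frontier Ω') ∧
      (volume Ω).toReal - (volume Ω').toReal < ε ∧
      |(μH[(n : ℝ) - 1] (frontier Ω)).toReal - (μH[(n : ℝ) - 1] (frontier Ω')).toReal| < ε ∧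
      |stekSigma1 Ω - stekSigma1 Ω'| < ε := by
  obtain ⟨Ω', h1, h2, h3, h4, h5, h6, h7, h8⟩ :=
    Steklov.exists_connected_frontier hn _ Ω ho hb hconn hsb rfl ε hε
  exact ⟨Ω', h1, h2, hb.subset h1, h3.nonempty, h3, h4, h5, h6, h7, h8⟩
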